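/- Let T > 0, Q = (0,1)×(0,T), and let a : [0,1] → ℝ be continuous, nonnegative, and continuously differentiable on (0,1]. Let b : [0,T] → ℝ be continuous with 0 < m ≤ b(t) ≤ M, and let c₁, d₁ : Q → ℝ be measurable with |c₁|, |d₁| ≤ Λ. Fix constants s > 0, K₁ < 0 < K₂, τ₀ > 0, ζ₀ ≥ 1, C₃ > 0 and a differentiable function τ : [0,T) → ℝ with τ ≥ τ₀ and |τ'| ≤ C₃τ^{5/4}; set A* = K₁τ, ζ* = K₂τ, ζ̂ = ζ*/ζ₀, ρ₀ = e^{−sA*}, ρ₁ = e^{−sA*}(ζ*)^{−3/2}, ρ̂ = e^{−sA*}(ζ*)^{−3/4}, ρ₂ = e^{−3sA*/2}(ζ̂)^{−1}. Let ω₁ ⊂ (0,1) be open, and let z : [0,1]×[0,T] → ℝ be continuous, with z_x, (a z_x)_x and z_t existing and continuous on (0,1)×(0,T), satisfying z_t − b(t)(a(x)z_x)_x − d₁(x,t)√(a(x)) z_x + c₁(x,t)z = h̃·1_{ω₁} + G pointwise in (0,1)×(0,T), z(0,t) = z(1,t) = 0 for all t, and z(x,0) = z₀(x); assume all the integrals below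 are finite. Then there exists a constant C > 0, depending only on T, m, M, Λ and the weight constants (and not on z, h̃, G, z₀), such that sup_{t∈[0,T)} ρ̂(t)² ∫₀¹ z(x,t)² dx + ∫₀ᵀ∫₀¹ ρ̂² a(x) z_x² dx dt ≤ C ( ∫₀ᵀ∫₀¹ ρ₀² z² dx dt + ∫₀ᵀ∫_{ω₁} ρ₁² h̃² dx dt + ∫₀ᵀ∫₀¹ ρ₂² G² dx dt + ∫₀¹ z₀² dx ). -/

import Mathlib

open MeasureTheory Set

/-- The Carleman weight `ρ₀ = e^{−sA*}` with `A* = K₁τ`. -/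
noncomputable def rho0 (s K₁ : ℝ) (τ : ℝ → ℝ) (t : ℝ) : ℝ :=
  Real.exp (-(s * (K₁ * τ t)))

/-- The Carleman weight `ρ₁ = e^{−sA*}(ζ*)^{−3/2}` with `ζ* = K₂τ`. -/
noncomputable def rho1 (s K₁ K₂ : ℝ) (τ : ℝ → ℝ) (t : ℝ) : ℝ :=
  Real.exp (-(s * (K₁ * τ t))) * (K₂ * τ t) ^ (-(3:ℝ)/2)

/-- The Carleman weight `ρ̂ = e^{−sA*}(ζ*)^{−3/4}`. -/
noncomputable def rhoHat (s K₁ K₂ : ℝ) (τ : ℝ → ℝ) (t : ℝ) : ℝ :=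
  Real.exp (-(s * (K₁ * τ t))) * (K₂ * τ t) ^ (-(3:ℝ)/4)

/-- The Carleman weight `ρ₂ = e^{−3sA*/2}(ζ̂)⁻¹`, `ζ̂ = ζ*/ζ₀`. -/
noncomputable def rho2 (s K₁ K₂ ζ₀ : ℝ) (τ : ℝ → ℝ) (t : ℝ) : ℝ :=
  Real.exp (-(3 * s * (K₁ * τ t) / 2)) * (K₂ * τ t / ζ₀)⁻¹

/-- null sets are mapped to null sets by monotone functions with finite left Dini derivatives -/
lemma mono_image_null (H : ℝ → ℝ) (hH : Monotone H) (N : Set ℝ) (hN : volume N = 0)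
    (hK : ∀ t ∈ N, ∃ K : ℝ, ∃ ε > 0, ∀ s, t - ε < s → s ≤ t → H t - H s ≤ K * (t - s)) :
    volume (H '' N) = 0 := by
  set A : ℕ → ℤ → Set ℝ := fun n j =>
    {t ∈ N | (∀ s, t - 1 / ((n : ℝ) + 1) < s → s ≤ t → H t - H s ≤ n * (t - s)) ∧
      (j : ℝ) ≤ t * ((n : ℝ) + 1) ∧ t * ((n : ℝ) + 1) < j + 1} with hA
  have hcov : N ⊆ ⋃ n, ⋃ j, A n j := by
    intro t ht
    obtain ⟨K, ε, hε, h⟩ := hK t ht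
    obtain ⟨n1, hn1⟩ := exists_nat_gt K
    obtain ⟨n2, hn2⟩ := exists_nat_one_div_lt hε
    simp only [mem_iUnion]
    refine ⟨max n1 n2, ⌊t * (((max n1 n2 : ℕ) : ℝ) + 1)⌋, ht, ?_, Int.floor_le _,
      Int.lt_floor_add_one _⟩
    intro s hs1 hs2
    have h1 : (1 : ℝ) / (((max n1 n2 : ℕ) : ℝ) + 1) ≤ 1 / ((n2 : ℝ) + 1) := by
      apply one_div_le_one_div_of_le (by positivity)
      have : (n2 : ℝ) ≤ ((max n1 n2 : ℕ) : ℝ) := by exact_mod_cast le_max_right _ _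
      linarith
    have h2 := h s (by linarith) hs2
    have h3 : (n1 : ℝ) ≤ ((max n1 n2 : ℕ) : ℝ) := by exact_mod_cast le_max_left _ _
    exact h2.trans (mul_le_mul_of_nonneg_right (by linarith) (by linarith))
  have hnull : ∀ n j, volume (H '' (A n j)) = 0 := by
    intro n j
    have hL : LipschitzOnWith (n : NNReal) H (A n j) := by
      have key : ∀ s ∈ A n j, ∀ t ∈ A n j, s ≤ t → H t - H s ≤ n * (t - s) := by
        intro s hs t ht hst
        refine ht.2.1 s ?_ hst
        have hn : (0 : ℝ) < (n : ℝ) + 1 := by positivity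
        rw [sub_lt_iff_lt_add, ← sub_lt_iff_lt_add', lt_div_iff₀ hn]
        have := hs.2.2.1
        have := ht.2.2.2
        nlinarith
      apply LipschitzOnWith.of_dist_le_mul
      intro s hs t ht
      rw [Real.dist_eq, Real.dist_eq]
      simp only [NNReal.coe_natCast]
      rcases le_total s t with h | h
      · rw [abs_sub_comm, abs_of_nonneg (sub_nonneg.2 (hH h)), abs_sub_comm s t,
          abs_of_nonneg (sub_nonneg.2 h)]
        exact key s hs t ht h
      · rw [abs_of_nonneg (sub_nonneg.2 (hH h)), abs_of_nonneg (sub_nonneg.2 h)]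
        exact key t ht s hs h
    have h1 := hL.hausdorffMeasure_image_le (d := 1) zero_le_one
    rw [hausdorffMeasure_real] at h1
    have h0 : volume (A n j) = 0 := measure_mono_null (fun t ht => ht.1) hN
    rw [h0, mul_zero] at h1
    exact le_antisymm h1 (zero_le)
  refine measure_mono_null (image_mono hcov) ?_
  rw [image_iUnion]
  refine measure_iUnion_null fun n => ?_
  rw [image_iUnion]
  exact measure_iUnion_null fun j => hnull n j

lemma mono_image_le (H : ℝ → ℝ) (hH : Monotone H) (C : Set ℝ) (hC : MeasurableSet C)
    (hK : ∀ t ∈ C, ∃ K : ℝ, ∃ ε > 0, ∀ s, t - ε < s → s ≤ t → H t - H s ≤ K * (t - s)) :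
    volume (H '' C) ≤ ∫⁻ t in C, ENNReal.ofReal (deriv H t) := by
  set D := {t | DifferentiableAt ℝ H t}
  have hD : MeasurableSet D := measurableSet_of_differentiableAt ℝ H
  have hN : volume (C \ D) = 0 := by
    have := hH.ae_differentiableAt
    rw [ae_iff] at this
    exact measure_mono_null (fun t ht => ht.2) this
  have h1 : volume (H '' (C \ D)) = 0 :=
    mono_image_null H hH _ hN (fun t ht => hK t ht.1)
  have h2 : volume (H '' (C ∩ D)) = ∫⁻ t in C ∩ D, ENNReal.ofReal (deriv H t) :=
    (lintegral_deriv_eq_volume_image_of_monotoneOn (hC.inter hD)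
      (fun x hx => (hx.2 : DifferentiableAt ℝ H x).hasDerivAt.hasDerivWithinAt)
      (hH.monotoneOn _)).symm
  calc volume (H '' C) = volume (H '' (C ∩ D) ∪ H '' (C \ D)) := by
        rw [← image_union, inter_union_sdiff]
    _ ≤ volume (H '' (C ∩ D)) + volume (H '' (C \ D)) := measure_union_le _ _
    _ = ∫⁻ t in C ∩ D, ENNReal.ofReal (deriv H t) := by rw [h1, h2, add_zero]
    _ ≤ _ := lintegral_mono_set inter_subset_left

lemma contact_x {x1 x2 p : ℝ} {a Y U Ux : ℝ → ℝ} {vx x : ℝ}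
    (ha : ∀ w ∈ Ioo x1 x2, 0 < a w)
    (hY : ∀ w ∈ Ioo x1 x2, HasDerivAt Y (1 / a w) w)
    (hU : ∀ w ∈ Ioo x1 x2, HasDerivAt U (Ux w) w)
    (hx : x ∈ Ioo x1 x2)
    (hv : HasDerivAt (fun w => a w * Ux w) vx x)
    (hmax : ∀ w ∈ Ioo x1 x2, U w - p * Y w ≤ U x - p * Y x) :
    a x * Ux x = p ∧ vx ≤ 0 := by
  have hd : ∀ w ∈ Ioo x1 x2, HasDerivAt (fun w => U w - p * Y w) (Ux w - p * (1 / a w)) w :=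
    fun w hw => (hU w hw).sub ((hY w hw).const_mul p)
  have hnh : Ioo x1 x2 ∈ nhds x := isOpen_Ioo.mem_nhds hx
  have hlm : IsLocalMax (fun w => U w - p * Y w) x := by
    filter_upwards [hnh] with w hw using hmax w hw
  have h0 := hlm.hasDerivAt_eq_zero (hd x hx)
  have hax := ha x hx
  have hp : a x * Ux x = p := by
    field_simp at h0
    linarith
  refine ⟨hp, ?_⟩
  by_contra hvx
  push Not at hvx
  have hs := hv.tendsto_slope
  have he := hs.eventually (lt_mem_nhds hvx)
  rw [eventually_nhdsWithin_iff, Metric.eventually_nhds_iff] at he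
  obtain ⟨η, hη, he⟩ := he
  obtain ⟨y, hy1, hy2⟩ : ∃ y, x < y ∧ y < min (x + η) x2 :=
    exists_between (lt_min (by linarith) hx.2)
  have hy3 := hy2.trans_le (min_le_left _ _)
  have hy4 := hy2.trans_le (min_le_right _ _)
  have hsub : Icc x y ⊆ Ioo x1 x2 := fun w hw => ⟨hx.1.trans_le hw.1, hw.2.trans_lt hy4⟩
  have hmono : StrictMonoOn (fun w => U w - p * Y w) (Icc x y) := by
    apply strictMonoOn_of_deriv_pos (convex_Icc _ _)
    · exact fun w hw => (hd w (hsub hw)).continuousAt.continuousWithinAt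
    · intro w hw
      rw [interior_Icc] at hw
      have hwI := hsub (Ioo_subset_Icc_self hw)
      rw [(hd w hwI).deriv]
      have h1 := he (y := w) (by rw [Real.dist_eq, abs_of_pos (by linarith [hw.1])]; linarith [hw.2])
        (by simpa using hw.1.ne')
      rw [slope_def_field, hp] at h1
      have h2 : 0 < a w * Ux w - p := by
        rcases div_pos_iff.1 h1 with h | h
        · exact h.1
        · linarith [h.2, hw.1]
      have h3 := ha w hwI
      have : Ux w - p * (1 / a w) = (a w * Ux w - p) / a w := by field_simp
      rw [this]
      positivity
  have h1 := hmono (left_mem_Icc.2 hy1.le) (right_mem_Icc.2 hy1.le) hy1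
  have h2 := hmax y (hsub (right_mem_Icc.2 hy1.le))
  simp only at h1
  linarith

lemma contact_t {t1 t ut : ℝ} {U H : ℝ → ℝ} (ht : t1 < t)
    (hut : HasDerivWithinAt U ut (Iic t) t) (hH : Monotone H)
    (h : ∀ s, t1 ≤ s → s ≤ t → H t - H s ≤ U t - U s) :
    0 ≤ ut ∧ deriv H t ≤ ut ∧
      ∃ K : ℝ, ∃ ε > 0, ∀ s, t - ε < s → s ≤ t → H t - H s ≤ K * (t - s) := by
  have hs : Filter.Tendsto (slope U t) (nhdsWithin t (Iio t)) (nhds ut) := by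
    rw [hasDerivWithinAt_iff_tendsto_slope] at hut
    simpa using hut
  have hev : ∀ᶠ s in nhdsWithin t (Iio t), slope H t s ≤ slope U t s ∧ 0 ≤ slope U t s := by
    have : Ioo t1 t ∈ nhdsWithin t (Iio t) := Ioo_mem_nhdsLT ht
    filter_upwards [this] with s hs
    have h1 := h s hs.1.le hs.2.le
    have h3 := hH hs.2.le
    have h2 : 0 < t - s := by linarith [hs.2]
    rw [slope_def_field, slope_def_field, ← neg_div_neg_eq, ← neg_div_neg_eq (U s - U t)]
    constructor
    · apply div_le_div_of_nonneg_right _ (by linarith); linarith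
    · apply div_nonneg <;> linarith
  have h0 : 0 ≤ ut := ge_of_tendsto hs (hev.mono fun s hs => hs.2)
  refine ⟨h0, ?_, ?_⟩
  · by_cases hd : DifferentiableAt ℝ H t
    · have h1 : Filter.Tendsto (slope H t) (nhdsWithin t (Iio t)) (nhds (deriv H t)) := by
        have := (hd.hasDerivAt.hasDerivWithinAt (s := Iic t))
        rw [hasDerivWithinAt_iff_tendsto_slope] at this
        simpa using this
      exact le_of_tendsto_of_tendsto h1 hs (hev.mono fun s hs => hs.1)
    · rw [deriv_zero_of_not_differentiableAt hd]; exact h0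
  · have h1 := hs.eventually (gt_mem_nhds (lt_add_one ut))
    have h2 := h1.and hev
    rw [eventually_nhdsWithin_iff, Metric.eventually_nhds_iff] at h2
    obtain ⟨ε, hε, h2⟩ := h2
    refine ⟨ut + 1, ε, hε, fun s hs1 hs2 => ?_⟩
    rcases hs2.eq_or_lt with rfl | hlt
    · simp
    · have h3 := h2 (y := s) (by rw [Real.dist_eq, abs_sub_comm, abs_of_pos (by linarith)]; linarith) hlt
      have h4 : slope H t s < ut + 1 := h3.2.1.trans_lt h3.1
      rw [slope_def_field, ← neg_div_neg_eq, div_lt_iff₀ (by linarith)] at h4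
      linarith

lemma abp_aux {x1 x2 t1 t2 L M x0 : ℝ} (ht : t1 < t2) (hL : 0 < L) (hM : 0 < M)
    (hx0 : x0 ∈ Icc x1 x2) {a Y : ℝ → ℝ} (ha : ∀ w ∈ Ioo x1 x2, 0 < a w)
    (hYc : Continuous Y) (hY0 : ∀ x, 0 ≤ Y x ∧ Y x ≤ L)
    (hYd : ∀ w ∈ Ioo x1 x2, HasDerivAt Y (1 / a w) w)
    {u ux vx ut : ℝ → ℝ → ℝ} (hu : Continuous (fun p : ℝ × ℝ => u p.1 p.2))
    (hux : ∀ x ∈ Ioo x1 x2, ∀ t ∈ Ioc t1 t2, HasDerivAt (fun w => u w t) (ux x t) x)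
    (hvx : ∀ x ∈ Ioo x1 x2, ∀ t ∈ Ioc t1 t2, HasDerivAt (fun w => a w * ux w t) (vx x t) x)
    (hut : ∀ x ∈ Ioo x1 x2, ∀ t ∈ Ioc t1 t2,
      HasDerivWithinAt (fun s => u x s) (ut x t) (Iic t) t)
    (hl : ∀ t ∈ Icc t1 t2, u x1 t ≤ 0 ∧ u x2 t ≤ 0)
    (hb : ∀ x ∈ Icc x1 x2, u x t1 ≤ 0)
    (hMu : M ≤ u x0 t2) :
    ENNReal.ofReal (M ^ 2 / L) ≤ ∫⁻ t in Ioc t1 t2, ∫⁻ x in Ioo x1 x2,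
      ENNReal.ofReal ((max 0 (ut x t - vx x t)) ^ 2) := by
  set δ := M / (2 * L) with hδ
  have hδ0 : 0 < δ := by positivity
  set φ : ℝ → ℝ → ℝ → ℝ := fun p x t => u x t - p * Y x with hφ
  set K : Set (ℝ × ℝ) := Icc x1 x2 ×ˢ Icc t1 t2 with hK
  have hKc : IsCompact K := isCompact_Icc.prod isCompact_Icc
  have hx12 : x1 ≤ x2 := hx0.1.trans hx0.2
  set H : ℝ → ℝ → ℝ := fun p t => sSup ((fun q : ℝ × ℝ => φ p q.1 (max t1 (min q.2 t))) '' K) with hH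
  set m : ℝ → ℝ → ℝ := fun p t => sSup ((fun x : ℝ => φ p x t) '' Icc x1 x2) with hm
  have hHc : Continuous (Function.uncurry H) := by
    have := hKc.continuous_sSup (γ := ℝ × ℝ)
      (f := fun (r : ℝ × ℝ) (q : ℝ × ℝ) => φ r.1 q.1 (max t1 (min q.2 r.2))) (by
        simp only [hφ]
        show Continuous (fun z : (ℝ × ℝ) × (ℝ × ℝ) => u z.2.1 (max t1 (min z.2.2 z.1.2)) - z.1.1 * Y z.2.1)
        have h1 : Continuous (fun z : (ℝ × ℝ) × (ℝ × ℝ) => u z.2.1 (max t1 (min z.2.2 z.1.2))) :=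
          hu.comp (by fun_prop : Continuous (fun z : (ℝ × ℝ) × (ℝ × ℝ) => (z.2.1, (max t1 (min z.2.2 z.1.2)))))
        fun_prop)
    exact this
  have hmc : Continuous (Function.uncurry m) := by
    have := (isCompact_Icc (a := x1) (b := x2)).continuous_sSup (γ := ℝ × ℝ)
      (f := fun (r : ℝ × ℝ) (q : ℝ) => φ r.1 q r.2) (by
        simp only [hφ]
        show Continuous (fun z : (ℝ × ℝ) × ℝ => u z.2 z.1.2 - z.1.1 * Y z.2)
        have h1 : Continuous (fun z : (ℝ × ℝ) × ℝ => u z.2 z.1.2) :=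
          hu.comp (by fun_prop : Continuous (fun z : (ℝ × ℝ) × ℝ => (z.2, z.1.2)))
        fun_prop)
    exact this
  have hφc : ∀ p t, Continuous (fun q : ℝ × ℝ => φ p q.1 (max t1 (min q.2 t))) := by
    intro p t
    have h1 : Continuous (fun z : ℝ × ℝ => u z.1 (max t1 (min z.2 t))) :=
      hu.comp (by fun_prop : Continuous (fun z : ℝ × ℝ => (z.1, (max t1 (min z.2 t)))))
    simp only [hφ]
    fun_prop
  have hφc' : ∀ p t, Continuous (fun x : ℝ => φ p x t) := by
    intro p t
    have h1 : Continuous (fun z : ℝ => u z t) :=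
      hu.comp (by fun_prop : Continuous (fun z : ℝ => (z, t)))
    simp only [hφ]
    fun_prop
  have hle : ∀ p t x s, x ∈ Icc x1 x2 → s ∈ Icc t1 t2 → s ≤ t → φ p x s ≤ H p t := by
    intro p t x s hx hs hst
    apply le_csSup (hKc.bddAbove_image (hφc p t).continuousOn)
    refine ⟨(x, s), ⟨hx, hs⟩, ?_⟩
    simp [min_eq_left hst, max_eq_right hs.1]
  have hKne : K.Nonempty := ⟨(x0, t1), hx0, left_mem_Icc.2 ht.le⟩
  have hatt : ∀ p t, t1 ≤ t → ∃ x ∈ Icc x1 x2, ∃ s ∈ Icc t1 t2, s ≤ t ∧ φ p x s = H p t := by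
    intro p t htt
    obtain ⟨q, hq, hq2⟩ := hKc.exists_sSup_image_eq hKne (hφc p t).continuousOn
    refine ⟨q.1, hq.1, max t1 (min q.2 t), ⟨le_max_left _ _, max_le ht.le ((min_le_left _ _).trans hq.2.2)⟩,
      max_le htt (min_le_right _ _), hq2.symm⟩
  have hmono : ∀ p, Monotone (H p) := by
    intro p s t hst
    obtain ⟨q, hq, hq2⟩ := hKc.exists_sSup_image_eq hKne (hφc p s).continuousOn
    show H p s ≤ H p t
    rw [show H p s = _ from hq2]
    apply le_csSup (hKc.bddAbove_image (hφc p t).continuousOn)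
    refine ⟨(q.1, max t1 (min q.2 s)), ⟨hq.1, ⟨le_max_left _ _, max_le ht.le ((min_le_left _ _).trans hq.2.2)⟩⟩, ?_⟩
    simp only
    congr 1
    rcases le_total t1 (min q.2 s) with h | h
    · rw [max_eq_right h, min_eq_left ((min_le_right _ _).trans hst), max_eq_right h]
    · rw [max_eq_left h, max_eq_left (min_le_left _ _)]
  have hmle : ∀ p t x, x ∈ Icc x1 x2 → φ p x t ≤ m p t := fun p t x hx =>
    le_csSup (isCompact_Icc.bddAbove_image (hφc' p t).continuousOn) ⟨x, hx, rfl⟩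
  have hmatt : ∀ p t, ∃ x ∈ Icc x1 x2, φ p x t = m p t := by
    intro p t
    obtain ⟨q, hq, hq2⟩ := isCompact_Icc.exists_sSup_image_eq ⟨x0, hx0⟩ (hφc' p t).continuousOn
    exact ⟨q, hq, hq2.symm⟩
  set C : Set (ℝ × ℝ) := {q | q.1 ∈ Ioo 0 δ ∧ q.2 ∈ Ioc t1 t2 ∧ m q.1 q.2 = H q.1 q.2 ∧ 0 < H q.1 q.2} with hC
  have hCm : MeasurableSet C := by
    have e1 : MeasurableSet {q : ℝ × ℝ | q.1 ∈ Ioo 0 δ} := measurable_fst measurableSet_Ioo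
    have e2 : MeasurableSet {q : ℝ × ℝ | q.2 ∈ Ioc t1 t2} := measurable_snd measurableSet_Ioc
    have e3 : MeasurableSet {q : ℝ × ℝ | m q.1 q.2 = H q.1 q.2} :=
      measurableSet_eq_fun hmc.measurable hHc.measurable
    have e4 : MeasurableSet {q : ℝ × ℝ | 0 < H q.1 q.2} :=
      measurableSet_lt measurable_const hHc.measurable
    exact e1.inter (e2.inter (e3.inter e4))
  -- interior contact point
  have h_itg : ∀ p t, (p, t) ∈ C → ∃ x ∈ Ioo x1 x2, φ p x t = H p t := by
    intro p t hpt
    obtain ⟨x, hx, hxe⟩ := hmatt p t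
    have h1 : φ p x t = H p t := hxe.trans hpt.2.2.1
    have hpos : 0 < φ p x t := h1 ▸ hpt.2.2.2
    have hp0 : 0 < p := hpt.1.1
    have hYp : 0 ≤ p * Y x := mul_nonneg hp0.le (hY0 x).1
    have hlt := hl t (Ioc_subset_Icc_self hpt.2.1)
    refine ⟨x, ⟨lt_of_le_of_ne hx.1 ?_, lt_of_le_of_ne hx.2 ?_⟩, h1⟩
    · rintro rfl
      simp only [hφ] at hpos
      linarith [hlt.1]
    · rintro rfl
      simp only [hφ] at hpos
      linarith [hlt.2]
  have hkey : ∀ p t x, (p, t) ∈ C → x ∈ Ioo x1 x2 → φ p x t = H p t →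
      (a x * ux x t = p ∧ vx x t ≤ 0) ∧ (0 ≤ ut x t ∧ deriv (H p) t ≤ ut x t ∧
      ∃ K : ℝ, ∃ ε > 0, ∀ s, t - ε < s → s ≤ t → H p t - H p s ≤ K * (t - s)) := by
    intro p t x hpt hx hxe
    have htI : t ∈ Ioc t1 t2 := hpt.2.1
    constructor
    · refine contact_x (U := fun w => u w t) (Ux := fun w => ux w t) ha hYd (fun w hw => hux w hw t htI) hx (hvx x hx t htI) ?_
      intro w hw
      have := hle p t w t (Ioo_subset_Icc_self hw) (Ioc_subset_Icc_self htI) le_rfl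
      rw [← hxe] at this
      exact this
    · refine contact_t htI.1 (hut x hx t htI) (hmono p) ?_
      intro s hs1 hs2
      have := hle p s x s (Ioo_subset_Icc_self hx) ⟨hs1, hs2.trans htI.2⟩ le_rfl
      simp only [hφ] at this hxe
      linarith
  -- step 1
  have hstep1 : ∀ p ∈ Ioo 0 δ, ENNReal.ofReal (M / 2) ≤
      ∫⁻ t, C.indicator (fun q => ENNReal.ofReal (deriv (H q.1) q.2)) (p, t) := by
    intro p hp
    set Cp : Set ℝ := {t | (p, t) ∈ C} with hCp
    have hCpm : MeasurableSet Cp := measurable_prodMk_left hCm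
    have h1 : ∫⁻ t, C.indicator (fun q => ENNReal.ofReal (deriv (H q.1) q.2)) (p, t)
        = ∫⁻ t in Cp, ENNReal.ofReal (deriv (H p) t) := by
      rw [← lintegral_indicator hCpm]
      rfl
    rw [h1]
    refine le_trans ?_ (mono_image_le (H p) (hmono p) Cp hCpm ?_)
    · have : Ioo 0 (M / 2) ⊆ H p '' Cp := by
        intro h hh
        have hH1 : H p t1 ≤ 0 := by
          obtain ⟨x, hx, s, hs, hst, he⟩ := hatt p t1 le_rfl
          have : s = t1 := le_antisymm hst hs.1
          subst this
          rw [← he]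
          have := hb x hx
          have h2 : 0 ≤ p * Y x := mul_nonneg hp.1.le (hY0 x).1
          simp only [hφ]
          linarith
        have hH2 : M / 2 ≤ H p t2 := by
          refine le_trans ?_ (hle p t2 x0 t2 hx0 (right_mem_Icc.2 ht.le) le_rfl)
          have h2 : p * Y x0 ≤ δ * L :=
            mul_le_mul hp.2.le (hY0 x0).2 (hY0 x0).1 hδ0.le
          have h3 : δ * L = M / 2 := by rw [hδ]; field_simp
          simp only [hφ]
          linarith
        have hc : ContinuousOn (H p) (Icc t1 t2) := by
          have : Continuous (fun t => Function.uncurry H (p, t)) := hHc.comp (by fun_prop)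
          exact this.continuousOn
        obtain ⟨t, htI, hte⟩ := intermediate_value_Icc ht.le hc
          (show h ∈ Icc (H p t1) (H p t2) from ⟨hH1.trans hh.1.le, hh.2.le.trans hH2⟩)
        obtain ⟨x, hx, s, hs, hst, he⟩ := hatt p t htI.1
        have h2 : H p s = h := le_antisymm (hte ▸ hmono p hst) (by
          rw [← hte, ← he]; exact hle p s x s hx hs le_rfl)
        refine ⟨s, ⟨hp, ⟨lt_of_le_of_ne hs.1 ?_, hs.2⟩, ?_, ?_⟩, h2⟩
        · rintro rfl
          linarith [hh.1]
        · apply le_antisymm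
          · obtain ⟨y, hy, hye⟩ := hmatt p s
            simp only
            rw [← hye]
            exact hle p s y s hy hs le_rfl
          · simp only
            rw [h2, ← hte, ← he]
            exact hmle p s x hx
        · simp only [h2]; exact hh.1
      calc ENNReal.ofReal (M / 2) = volume (Ioo 0 (M / 2)) := by rw [Real.volume_Ioo, sub_zero]
        _ ≤ _ := measure_mono this
    · intro t ht
      obtain ⟨x, hx, hxe⟩ := h_itg p t ht
      exact (hkey p t x ht hx hxe).2.2.2
  -- step 2
  have hstep2 : ∀ t, ∫⁻ p, C.indicator (fun q => ENNReal.ofReal (deriv (H q.1) q.2)) (p, t) ≤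
      (Ioc t1 t2).indicator (fun t => ∫⁻ x in Ioo x1 x2,
      ENNReal.ofReal ((max 0 (ut x t - vx x t)) ^ 2 / 4)) t := by
    intro t
    by_cases htI : t ∈ Ioc t1 t2
    swap
    · have : ∀ p, C.indicator (fun q => ENNReal.ofReal (deriv (H q.1) q.2)) (p, t) = 0 := by
        intro p
        apply indicator_of_notMem
        exact fun h => htI h.2.1
      simp [this]
    rw [indicator_of_mem htI]
    set f : ℝ → ℝ := fun x => a x * ux x t with hf
    have hfc : ContinuousOn f (Ioo x1 x2) := fun x hx =>
      (hvx x hx t htI).continuousAt.continuousWithinAt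
    classical
    have hfm : Measurable ((Ioo x1 x2).piecewise f (fun _ => 0)) :=
      hfc.measurable_piecewise continuousOn_const measurableSet_Ioo
    set A : Set ℝ := {x | x ∈ Ioo x1 x2 ∧ (f x, t) ∈ C ∧ φ (f x) x t = H (f x) t} with hA
    have hAm : MeasurableSet A := by
      set g := (Ioo x1 x2).piecewise f (fun _ => 0) with hg
      have hA2 : A = Ioo x1 x2 ∩ ({x | (g x, t) ∈ C} ∩ {x | φ (g x) x t = H (g x) t}) := by
        ext x
        simp only [hA, mem_ofPred_eq, mem_inter_iff]
        constructor
        · rintro ⟨h1, h2, h3⟩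
          have : g x = f x := piecewise_eq_of_mem _ _ _ h1
          rw [this]
          exact ⟨h1, h2, h3⟩
        · rintro ⟨h1, h2, h3⟩
          have : g x = f x := piecewise_eq_of_mem _ _ _ h1
          rw [this] at h2 h3
          exact ⟨h1, h2, h3⟩
      rw [hA2]
      refine measurableSet_Ioo.inter (MeasurableSet.inter ?_ ?_)
      · exact (hfm.prodMk measurable_const) hCm
      · apply measurableSet_eq_fun
        · have h1 : Measurable (fun z : ℝ => u z t) :=
            (hu.comp (by fun_prop : Continuous (fun z : ℝ => (z, t)))).measurable
          exact h1.sub (hfm.mul hYc.measurable)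
        · exact hHc.measurable.comp (hfm.prodMk measurable_const)
    have hAanti : AntitoneOn f A := by
      intro x hx y hy hxy
      rcases hxy.eq_or_lt with rfl | hlt
      · exact le_rfl
      have hYlt : Y x < Y y := by
        have : StrictMonoOn Y (Ioo x1 x2) := by
          apply strictMonoOn_of_deriv_pos (convex_Ioo _ _) hYc.continuousOn
          intro w hw
          rw [interior_Ioo] at hw
          rw [(hYd w hw).deriv]
          have := ha w hw
          positivity
        exact this hx.1 hy.1 hlt
      have h1 := hle (f x) t y t (Ioo_subset_Icc_self hy.1) (Ioc_subset_Icc_self htI) le_rfl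
      have h2 := hle (f y) t x t (Ioo_subset_Icc_self hx.1) (Ioc_subset_Icc_self htI) le_rfl
      rw [← hx.2.2] at h1
      rw [← hy.2.2] at h2
      simp only [hφ] at h1 h2
      by_contra hcon
      push Not at hcon
      nlinarith
    have hsub : {p | (p, t) ∈ C} ⊆ f '' A := by
      intro p hp
      obtain ⟨x, hx, hxe⟩ := h_itg p t hp
      have h1 := (hkey p t x hp hx hxe).1.1
      refine ⟨x, ⟨hx, ?_, ?_⟩, h1⟩
      · simp only [hf, h1]; exact hp
      · simp only [hf, h1]; exact hxe
    have hCtm : MeasurableSet {p | (p, t) ∈ C} := measurable_prodMk_right hCm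
    calc ∫⁻ p, C.indicator (fun q => ENNReal.ofReal (deriv (H q.1) q.2)) (p, t)
        = ∫⁻ p in {p | (p, t) ∈ C}, ENNReal.ofReal (deriv (H p) t) := by
          rw [← lintegral_indicator hCtm]
          rfl
      _ ≤ ∫⁻ p in f '' A, ENNReal.ofReal (deriv (H p) t) := lintegral_mono_set hsub
      _ = ∫⁻ x in A, ENNReal.ofReal (-vx x t) * ENNReal.ofReal (deriv (H (f x)) t) :=
          lintegral_image_eq_lintegral_deriv_mul_of_antitoneOn hAm
            (fun x hx => (hvx x hx.1 t htI).hasDerivWithinAt) hAanti _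
      _ ≤ ∫⁻ x in A, ENNReal.ofReal ((max 0 (ut x t - vx x t)) ^ 2 / 4) := by
          apply setLIntegral_mono' hAm
          intro x hx
          obtain ⟨⟨-, h2⟩, h3, h4, -⟩ := hkey (f x) t x hx.2.1 hx.1 hx.2.2
          rw [← ENNReal.ofReal_mul (by linarith)]
          apply ENNReal.ofReal_le_ofReal
          rw [max_eq_right (by linarith)]
          nlinarith [sq_nonneg (ut x t + vx x t), mul_le_mul_of_nonneg_left h4 (neg_nonneg.2 h2)]
      _ ≤ _ := lintegral_mono_set (fun x hx => hx.1)
  have hmeas : Measurable (C.indicator (fun q : ℝ × ℝ => ENNReal.ofReal (deriv (H q.1) q.2))) :=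
    (measurable_deriv_with_param hHc).ennreal_ofReal.indicator hCm
  have hfin : ENNReal.ofReal (M ^ 2 / L / 4) ≤ ∫⁻ t in Ioc t1 t2, ∫⁻ x in Ioo x1 x2,
      ENNReal.ofReal ((max 0 (ut x t - vx x t)) ^ 2 / 4) := by
    calc ENNReal.ofReal (M ^ 2 / L / 4) = ∫⁻ p in Ioo 0 δ, ENNReal.ofReal (M / 2) := by
          rw [setLIntegral_const, Real.volume_Ioo, ← ENNReal.ofReal_mul (by positivity)]
          congr 1
          rw [hδ]; field_simp; ring
      _ ≤ ∫⁻ p in Ioo 0 δ, ∫⁻ t, C.indicator (fun q => ENNReal.ofReal (deriv (H q.1) q.2)) (p, t) :=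
          setLIntegral_mono' measurableSet_Ioo hstep1
      _ ≤ ∫⁻ p, ∫⁻ t, C.indicator (fun q => ENNReal.ofReal (deriv (H q.1) q.2)) (p, t) :=
          setLIntegral_le_lintegral _ _
      _ = ∫⁻ t, ∫⁻ p, C.indicator (fun q => ENNReal.ofReal (deriv (H q.1) q.2)) (p, t) :=
          lintegral_lintegral_swap hmeas.aemeasurable
      _ ≤ ∫⁻ t, (Ioc t1 t2).indicator (fun t => ∫⁻ x in Ioo x1 x2,
            ENNReal.ofReal ((max 0 (ut x t - vx x t)) ^ 2 / 4)) t := lintegral_mono hstep2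
      _ = _ := lintegral_indicator measurableSet_Ioc _
  obtain ⟨c, hc⟩ : ∃ c : ENNReal, c = ENNReal.ofReal (1 / 4) := ⟨_, rfl⟩
  have h4 : ∀ r : ℝ, ENNReal.ofReal (r / 4) = c * ENNReal.ofReal r := by
    intro r
    rw [hc, ← ENNReal.ofReal_mul (by norm_num)]
    congr 1; ring
  simp_rw [h4] at hfin
  have hne : c ≠ 0 := by rw [hc]; simp
  have hnt : c ≠ ⊤ := by rw [hc]; exact ENNReal.ofReal_ne_top
  rw [show (∫⁻ t in Ioc t1 t2, ∫⁻ x in Ioo x1 x2, c *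
      ENNReal.ofReal ((max 0 (ut x t - vx x t)) ^ 2)) = c *
      ∫⁻ t in Ioc t1 t2, ∫⁻ x in Ioo x1 x2, ENNReal.ofReal ((max 0 (ut x t - vx x t)) ^ 2) by
    rw [← lintegral_const_mul' _ _ hnt]
    congr 1
    ext t
    rw [lintegral_const_mul' _ _ hnt]] at hfin
  exact (ENNReal.mul_le_mul_iff_right hne hnt).1 hfin

lemma riemann_unif {x1 x2 A B k : ℝ} (hk : 0 < k) {y : ℝ → ℝ → ℝ}
    (hy : Continuous fun p : ℝ × ℝ => y p.1 p.2) {ε : ℝ} (hε : 0 < ε) :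
    ∃ N : ℕ, ∀ n ≥ N, 0 < n → ∀ x ∈ Icc x1 x2, ∀ t ∈ Icc A B,
      |(k / n) * ∑ i ∈ Finset.range n, y x (t + i * (k / n)) - ∫ s in t..(t + k), y x s| ≤ ε := by
  have hcomp : IsCompact (Icc x1 x2 ×ˢ Icc A (B + k)) := isCompact_Icc.prod isCompact_Icc
  have huc := hcomp.uniformContinuousOn_of_continuous hy.continuousOn
  rw [Metric.uniformContinuousOn_iff] at huc
  obtain ⟨δ, hδ, H⟩ := huc (ε / k) (by positivity)
  obtain ⟨N, hN⟩ := exists_nat_gt (k / δ)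
  refine ⟨N, fun n hn hn0 x hx t ht => ?_⟩
  have hn' : (0 : ℝ) < n := by exact_mod_cast hn0
  have hkn : k / n < δ := by
    rw [div_lt_iff₀ hn']
    have : (N : ℝ) ≤ n := by exact_mod_cast hn
    rw [div_lt_iff₀ hδ] at hN
    nlinarith
  have hyx : Continuous (y x) := hy.comp (by fun_prop : Continuous fun s : ℝ => (x, s))
  have hsum := intervalIntegral.sum_integral_adjacent_intervals (f := y x) (μ := volume)
    (a := fun i : ℕ => t + i * (k / n)) (n := n) (fun i _ => hyx.intervalIntegrable _ _)
  have hend : t + (n : ℝ) * (k / n) = t + k := by field_simp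
  simp only [Nat.cast_zero, zero_mul, add_zero, hend] at hsum
  rw [← hsum, Finset.mul_sum, ← Finset.sum_sub_distrib]
  have hpos : 0 < k / n := by positivity
  calc |∑ i ∈ Finset.range n, ((k / n) * y x (t + i * (k / n)) -
          ∫ s in (t + i * (k / n))..(t + ((i + 1 : ℕ) : ℝ) * (k / n)), y x s)|
      ≤ ∑ i ∈ Finset.range n, |(k / n) * y x (t + i * (k / n)) -
          ∫ s in (t + i * (k / n))..(t + ((i + 1 : ℕ) : ℝ) * (k / n)), y x s| :=
        Finset.abs_sum_le_sum_abs _ _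
    _ ≤ ∑ i ∈ Finset.range n, ε / k * (k / n) := by
        refine Finset.sum_le_sum fun i hi => ?_
        have hi' : (i : ℝ) + 1 ≤ n := by exact_mod_cast Finset.mem_range.1 hi
        have hi0 : (0 : ℝ) ≤ i := Nat.cast_nonneg i
        have hlen : (t + ((i + 1 : ℕ) : ℝ) * (k / n)) = (t + i * (k / n)) + k / n := by
          push_cast; ring
        have hmax : ((i : ℝ) + 1) * (k / n) ≤ k := by
          calc ((i : ℝ) + 1) * (k / n) ≤ n * (k / n) := by gcongr
            _ = k := by field_simp
        have hi2 : 0 ≤ (i : ℝ) * (k / n) := by positivity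
        have e1 : (k / n) * y x (t + i * (k / n)) -
            ∫ s in (t + i * (k / n))..(t + ((i + 1 : ℕ) : ℝ) * (k / n)), y x s =
            ∫ s in (t + i * (k / n))..(t + ((i + 1 : ℕ) : ℝ) * (k / n)),
              (y x (t + i * (k / n)) - y x s) := by
          rw [intervalIntegral.integral_sub (by simp) (hyx.intervalIntegrable _ _),
            intervalIntegral.integral_const, hlen]
          simp
        rw [e1, ← Real.norm_eq_abs]
        refine (intervalIntegral.norm_integral_le_of_norm_le_const (C := ε / k) ?_).trans ?_
        · intro s hs
          rw [hlen, uIoc_of_le (by linarith)] at hs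
          have := H (x, t + i * (k / n)) ⟨hx, by constructor <;> linarith [ht.1, ht.2]⟩ (x, s)
            ⟨hx, by constructor <;> linarith [ht.1, ht.2, hs.1, hs.2]⟩ (by
              rw [Prod.dist_eq, dist_self, Real.dist_eq, abs_sub_comm,
                abs_of_nonneg (by linarith [hs.1])]
              simp only [max_lt_iff]; exact ⟨hδ, by linarith [hs.2]⟩)
          rw [← dist_eq_norm]
          exact this.le
        · rw [hlen, add_sub_cancel_left, abs_of_pos hpos]
    _ = ε := by
        rw [Finset.sum_const, Finset.card_range, nsmul_eq_mul]; field_simp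

lemma avg_contr {k : ℝ} {n : ℕ} (hn : 0 < n) {e : ℝ → ℝ → ℝ}
    (he : Measurable fun p : ℝ × ℝ => e p.1 p.2) (I J : Set ℝ) :
    ∫⁻ t in J, ∫⁻ x in I, ENNReal.ofReal (((k / n) * ∑ i ∈ Finset.range n,
        e x (t + i * (k / n))) ^ 2) ≤
      ENNReal.ofReal (k ^ 2) * ∫⁻ t, ∫⁻ x in I, ENNReal.ofReal (e x t ^ 2) := by
  have hn' : (0 : ℝ) < n := by exact_mod_cast hn
  have hm : ∀ c : ℝ, Measurable fun p : ℝ × ℝ => ENNReal.ofReal (e p.2 (p.1 + c) ^ 2) := by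
    intro c
    have : Measurable fun p : ℝ × ℝ => e p.2 (p.1 + c) :=
      he.comp (by fun_prop : Measurable fun p : ℝ × ℝ => (p.2, p.1 + c))
    exact (this.pow_const 2).ennreal_ofReal
  calc ∫⁻ t in J, ∫⁻ x in I, ENNReal.ofReal (((k / n) * ∑ i ∈ Finset.range n,
        e x (t + i * (k / n))) ^ 2)
      ≤ ∫⁻ t in J, ∫⁻ x in I, ∑ i ∈ Finset.range n, ENNReal.ofReal (k ^ 2 / n) *
        ENNReal.ofReal (e x (t + i * (k / n)) ^ 2) := by
        refine lintegral_mono fun t => lintegral_mono fun x => ?_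
        have h1 : ((k / n) * ∑ i ∈ Finset.range n, e x (t + i * (k / n))) ^ 2 ≤
            ∑ i ∈ Finset.range n, (k ^ 2 / n) * e x (t + i * (k / n)) ^ 2 := by
          have := sq_sum_le_card_mul_sum_sq (s := Finset.range n)
            (f := fun i : ℕ => e x (t + i * (k / n)))
          rw [Finset.card_range] at this
          rw [mul_pow, ← Finset.mul_sum]
          calc (k / n) ^ 2 * (∑ i ∈ Finset.range n, e x (t + i * (k / n))) ^ 2
              ≤ (k / n) ^ 2 * (n * ∑ i ∈ Finset.range n, e x (t + i * (k / n)) ^ 2) := by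
                gcongr
            _ = _ := by field_simp
        refine (ENNReal.ofReal_le_ofReal h1).trans ?_
        rw [ENNReal.ofReal_sum_of_nonneg (fun i _ => by positivity)]
        refine Finset.sum_le_sum fun i _ => ?_
        rw [ENNReal.ofReal_mul (by positivity)]
    _ = ∑ i ∈ Finset.range n, ENNReal.ofReal (k ^ 2 / n) * ∫⁻ t in J, ∫⁻ x in I,
        ENNReal.ofReal (e x (t + i * (k / n)) ^ 2) := by
        have h1 : ∀ t, ∫⁻ x in I, ∑ i ∈ Finset.range n, ENNReal.ofReal (k ^ 2 / n) *
            ENNReal.ofReal (e x (t + i * (k / n)) ^ 2) =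
            ∑ i ∈ Finset.range n, ENNReal.ofReal (k ^ 2 / n) *
              ∫⁻ x in I, ENNReal.ofReal (e x (t + i * (k / n)) ^ 2) := by
          intro t
          rw [lintegral_finsetSum]
          · refine Finset.sum_congr rfl fun i _ => ?_
            rw [lintegral_const_mul' _ _ ENNReal.ofReal_ne_top]
          · intro i _
            exact ((hm (i * (k / n))).comp
              (by fun_prop : Measurable fun x : ℝ => (t, x))).const_mul _
        simp_rw [h1]
        rw [lintegral_finsetSum]
        · refine Finset.sum_congr rfl fun i _ => ?_
          rw [lintegral_const_mul' _ _ ENNReal.ofReal_ne_top]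
        · intro i _
          exact ((hm (i * (k / n))).lintegral_prod_right').const_mul _
    _ ≤ ∑ i ∈ Finset.range n, ENNReal.ofReal (k ^ 2 / n) * ∫⁻ t, ∫⁻ x in I,
        ENNReal.ofReal (e x t ^ 2) := by
        refine Finset.sum_le_sum fun i _ => ?_
        refine mul_le_mul' le_rfl ?_
        refine (setLIntegral_le_lintegral _ _).trans ?_
        rw [lintegral_add_right_eq_self (fun t => ∫⁻ x in I, ENNReal.ofReal (e x t ^ 2))]
    _ = _ := by
        rw [Finset.sum_const, Finset.card_range, nsmul_eq_mul, ← mul_assoc]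
        congr 1
        rw [← ENNReal.ofReal_natCast, ← ENNReal.ofReal_mul (by positivity)]
        congr 1
        field_simp

lemma cs_interval {c d : ℝ} (hcd : c ≤ d) {f : ℝ → ℝ} (hf : IntervalIntegrable f volume c d)
    (hf2 : IntervalIntegrable (fun x => f x ^ 2) volume c d) :
    (∫ x in c..d, f x) ^ 2 ≤ (d - c) * ∫ x in c..d, f x ^ 2 := by
  rcases hcd.eq_or_lt with h | h
  · subst h; simp
  set m := (∫ x in c..d, f x) / (d - c) with hm
  have h0 : 0 ≤ ∫ x in c..d, (f x - m) ^ 2 :=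
    intervalIntegral.integral_nonneg hcd fun x _ => sq_nonneg _
  have h1 : ∫ x in c..d, (f x - m) ^ 2 = (∫ x in c..d, f x ^ 2) - 2 * m * (∫ x in c..d, f x)
      + m ^ 2 * (d - c) := by
    rw [← intervalIntegral.integral_const_mul, ← intervalIntegral.integral_sub hf2
      (hf.const_mul _)]
    have : m ^ 2 * (d - c) = ∫ x in c..d, m ^ 2 := by simp; ring
    rw [this, ← intervalIntegral.integral_add (hf2.sub (hf.const_mul _)) (by simp)]
    congr 1; ext x; ring
  have hd : 0 < d - c := by linarith
  have h2 : (∫ x in c..d, f x) = m * (d - c) := by rw [hm]; field_simp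
  rw [h1, h2] at h0
  rw [h2]
  nlinarith [mul_nonneg hd.le h0]

lemma strip_bound {ts r k : ℝ} (hr : 0 < r) {f : ℝ → ℝ → ℝ}
    (hf : Continuous fun p : ℝ × ℝ => f p.1 p.2) (I : Set ℝ) :
    ∫⁻ t in Ioc (ts - r) ts, ∫⁻ x in I,
      ENNReal.ofReal (((∫ s in t..(t + k), f x s) - ∫ s in ts..(ts + k), f x s) ^ 2) ≤
    ENNReal.ofReal (2 * r ^ 2) * (
      (∫⁻ t in Ioc (ts - r) ts, ∫⁻ x in I, ENNReal.ofReal (f x t ^ 2)) +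
      ∫⁻ t in Ioc (ts + k - r) (ts + k), ∫⁻ x in I, ENNReal.ofReal (f x t ^ 2)) := by
  have hfx : ∀ x, Continuous (f x) := fun x =>
    hf.comp (by fun_prop : Continuous fun s : ℝ => (x, s))
  have hm : Measurable fun p : ℝ × ℝ => ENNReal.ofReal (f p.1 p.2 ^ 2) :=
    (hf.measurable.pow_const 2).ennreal_ofReal
  have hpart : ∀ c x t, t ∈ Ioc (c - r) c →
      ENNReal.ofReal ((∫ s in t..c, f x s) ^ 2) ≤
        ENNReal.ofReal r * ∫⁻ s in Ioc (c - r) c, ENNReal.ofReal (f x s ^ 2) := by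
    intro c x t ht
    have h1 := cs_interval ht.2 ((hfx x).intervalIntegrable _ _)
      (((hfx x).pow 2).intervalIntegrable _ _)
    have h2 : (∫ s in t..c, f x s ^ 2) ≤ ∫ s in (c - r)..c, f x s ^ 2 :=
      intervalIntegral.integral_mono_interval ht.1.le ht.2 le_rfl
        (Filter.Eventually.of_forall fun s => sq_nonneg _) (((hfx x).pow 2).intervalIntegrable _ _)
    have h3 : ∫⁻ s in Ioc (c - r) c, ENNReal.ofReal (f x s ^ 2) =
        ENNReal.ofReal (∫ s in (c - r)..c, f x s ^ 2) := by
      rw [intervalIntegral.integral_of_le (by linarith), ofReal_integral_eq_lintegral_ofReal]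
      · exact (((hfx x).pow 2).intervalIntegrable (c - r) c).1
      · exact Filter.Eventually.of_forall fun s => sq_nonneg _
    rw [h3, ← ENNReal.ofReal_mul hr.le]
    apply ENNReal.ofReal_le_ofReal
    have h4 : 0 ≤ ∫ s in t..c, f x s ^ 2 :=
      intervalIntegral.integral_nonneg ht.2 fun s _ => sq_nonneg _
    have : c - t ≤ r := by linarith [ht.1]
    calc _ ≤ _ := h1
      _ ≤ r * ∫ s in t..c, f x s ^ 2 := by gcongr
      _ ≤ _ := by gcongr
  set A : ℝ → ENNReal := fun x => ∫⁻ s in Ioc (ts - r) ts, ENNReal.ofReal (f x s ^ 2) with hA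
  set B : ℝ → ENNReal := fun x => ∫⁻ s in Ioc (ts + k - r) (ts + k), ENNReal.ofReal (f x s ^ 2)
    with hB
  have hAm : Measurable A := hm.lintegral_prod_right'
  have hBm : Measurable B := hm.lintegral_prod_right'
  calc ∫⁻ t in Ioc (ts - r) ts, ∫⁻ x in I,
      ENNReal.ofReal (((∫ s in t..(t + k), f x s) - ∫ s in ts..(ts + k), f x s) ^ 2)
      ≤ ∫⁻ t in Ioc (ts - r) ts, ∫⁻ x in I, ENNReal.ofReal (2 * r) * (A x + B x) := by
        refine setLIntegral_mono' measurableSet_Ioc fun t ht => lintegral_mono fun x => ?_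
        have e1 : (∫ s in t..(t + k), f x s) - ∫ s in ts..(ts + k), f x s =
            (∫ s in t..ts, f x s) - ∫ s in (t + k)..(ts + k), f x s := by
          have hi := fun a b => (hfx x).intervalIntegrable (μ := volume) a b
          have h1 := intervalIntegral.integral_add_adjacent_intervals (hi t ts) (hi ts (ts + k))
          have h2 := intervalIntegral.integral_add_adjacent_intervals (hi t (t + k))
            (hi (t + k) (ts + k))
          linarith
        have e2 : ((∫ s in t..(t + k), f x s) - ∫ s in ts..(ts + k), f x s) ^ 2 ≤
            2 * ((∫ s in t..ts, f x s) ^ 2 + (∫ s in (t + k)..(ts + k), f x s) ^ 2) := by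
          rw [e1]
          nlinarith [sq_nonneg ((∫ s in t..ts, f x s) + ∫ s in (t + k)..(ts + k), f x s)]
        refine (ENNReal.ofReal_le_ofReal e2).trans ?_
        rw [ENNReal.ofReal_mul (by norm_num), ENNReal.ofReal_add (by positivity) (by positivity),
          ENNReal.ofReal_mul (by norm_num), mul_assoc, mul_add (ENNReal.ofReal r)]
        refine mul_le_mul' le_rfl (add_le_add (hpart ts x t ht) (hpart (ts + k) x (t + k) ?_))
        constructor <;> linarith [ht.1, ht.2]
    _ = ENNReal.ofReal (2 * r ^ 2) * ((∫⁻ x in I, A x) + ∫⁻ x in I, B x) := by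
        rw [setLIntegral_const, lintegral_const_mul' _ _ ENNReal.ofReal_ne_top,
          lintegral_add_left hAm, Real.volume_Ioc, mul_right_comm,
          ← ENNReal.ofReal_mul (by positivity)]
        congr 2; ring
    _ = _ := by
        have hsw : ∀ J : Set ℝ, (∫⁻ x in I, ∫⁻ s in J, ENNReal.ofReal (f x s ^ 2)) =
            ∫⁻ s in J, ∫⁻ x in I, ENNReal.ofReal (f x s ^ 2) := fun J =>
          lintegral_lintegral_swap hm.aemeasurable
        rw [hA, hB, hsw, hsw]

lemma core_abp {x1 x2 T1 T2 ts k r L M x0 ε δ B : ℝ} (hr : 0 < r) (hk : 0 < k)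
    (hT1 : T1 ≤ ts - r) (hT2 : ts + k < T2) (hL : 0 < L) (hM : 0 < M)
    (hx0 : x0 ∈ Icc x1 x2) {a a' Yc : ℝ → ℝ} (ha : ∀ w, 0 < a w)
    (ha' : ∀ x ∈ Ioo x1 x2, HasDerivAt a (a' x) x)
    (hYc : Continuous Yc) (hY0 : ∀ x, 0 ≤ Yc x ∧ Yc x ≤ L)
    (hYd : ∀ w ∈ Ioo x1 x2, HasDerivAt Yc (1 / a w) w)
    {y yx v F f : ℝ → ℝ → ℝ} (hy : Continuous (fun p : ℝ × ℝ => y p.1 p.2))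
    (hyx : ∀ x ∈ Ioo x1 x2, ∀ t ∈ Ioo T1 T2, HasDerivAt (fun w => y w t) (yx x t) x)
    (hvx : ∀ x ∈ Ioo x1 x2, ∀ t ∈ Ioo T1 T2, HasDerivAt (fun w => a w * yx w t) (v x t) x)
    (hyt : ∀ x ∈ Ioo x1 x2, ∀ t ∈ Ioo T1 T2, HasDerivAt (fun s => y x s) (v x t + F x t) t)
    {D p P pp γ : ℝ → ℝ} (hD : ∀ x, HasDerivAt D (p x / a x) x)
    (hp : ∀ x, HasDerivAt p (γ x - ∫ s in ts..(ts + k), f x s) x)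
    (hP : ∀ x, HasDerivAt P (pp x / a x) x)
    (hpp : ∀ x, HasDerivAt pp (-ε) x) (hε : 0 < ε) (hδ : δ = ε / 2) {g : Polynomial ℝ}
    (hg : ∀ x ∈ Icc x1 x2, |g.eval x - (γ x - δ / 2)| < δ / 8)
    (hB : ∀ x ∈ Ioo x1 x2, |a' x * g.derivative.eval x + a x * g.derivative.derivative.eval x| ≤ B)
    (hrB : r * B ≤ ε / 4) {n : ℕ} (hn : 0 < n)
    (hl : ∀ t ∈ Icc (ts - r) ts, ∀ x, x = x1 ∨ x = x2 →
      (k / n) * ∑ i ∈ Finset.range n, y x (t + i * (k / n)) - D x - P x - g.eval x * (t - ts)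
        + δ * r / 8 ≤ 0)
    (hb : ∀ x ∈ Icc x1 x2,
      (k / n) * ∑ i ∈ Finset.range n, y x (ts - r + i * (k / n)) - D x - P x - g.eval x * (-r)
        + δ * r / 8 ≤ 0)
    (hMu : M ≤ (k / n) * ∑ i ∈ Finset.range n, y x0 (ts + i * (k / n)) - D x0 - P x0
        + δ * r / 8) :
    ENNReal.ofReal (M ^ 2 / L) ≤ ∫⁻ t in Ioc (ts - r) ts, ∫⁻ x in Ioo x1 x2,
      ENNReal.ofReal (((k / n) * ∑ i ∈ Finset.range n, F x (t + i * (k / n)) -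
        ∫ s in ts..(ts + k), f x s) ^ 2) := by
  have hn' : (0 : ℝ) < n := by exact_mod_cast hn
  have hkn : 0 < k / n := by positivity
  have htime : ∀ t ∈ Ioc (ts - r) ts, ∀ i ∈ Finset.range n, t + i * (k / n) ∈ Ioo T1 T2 := by
    intro t ht i hi
    have hi' : (i : ℝ) ≤ n := by exact_mod_cast (Finset.mem_range.1 hi).le
    have h1 : (i : ℝ) * (k / n) ≤ k := by
      calc (i : ℝ) * (k / n) ≤ n * (k / n) := by gcongr
        _ = k := by field_simp
    have h2 : 0 ≤ (i : ℝ) * (k / n) := by positivity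
    constructor <;> linarith [ht.1, ht.2]
  have hDc : Continuous D := continuous_iff_continuousAt.2 fun x => (hD x).continuousAt
  have hPc : Continuous P := continuous_iff_continuousAt.2 fun x => (hP x).continuousAt
  have hgc : Continuous fun x : ℝ => g.eval x := g.continuous
  refine (abp_aux (t1 := ts - r) (t2 := ts) (L := L) (M := M) (x0 := x0) (a := a) (Y := Yc)
    (u := fun x t => (k / n) * ∑ i ∈ Finset.range n, y x (t + i * (k / n)) - D x - P x
      - g.eval x * (t - ts) + δ * r / 8)
    (ux := fun x t => (k / n) * ∑ i ∈ Finset.range n, yx x (t + i * (k / n)) - p x / a x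
      - pp x / a x - g.derivative.eval x * (t - ts))
    (vx := fun x t => (k / n) * ∑ i ∈ Finset.range n, v x (t + i * (k / n))
      - (γ x - ∫ s in ts..(ts + k), f x s) - (-ε)
      - (a' x * g.derivative.eval x + a x * g.derivative.derivative.eval x) * (t - ts))
    (ut := fun x t => (k / n) * ∑ i ∈ Finset.range n, (v x (t + i * (k / n)) +
      F x (t + i * (k / n))) - g.eval x)
    (by linarith) hL hM hx0 (fun w _ => ha w) hYc hY0 hYd ?_ ?_ ?_ ?_ ?_ ?_ ?_).trans ?_
  · have h1 : ∀ i : ℕ, Continuous fun q : ℝ × ℝ => y q.1 (q.2 + i * (k / n)) := fun i =>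
      hy.comp (by fun_prop : Continuous fun q : ℝ × ℝ => (q.1, q.2 + i * (k / n)))
    have h2 : Continuous fun q : ℝ × ℝ => ∑ i ∈ Finset.range n, y q.1 (q.2 + i * (k / n)) :=
      continuous_finsetSum _ fun i _ => h1 i
    fun_prop
  · intro x hx t ht
    have h1 : HasDerivAt (fun w => ∑ i ∈ Finset.range n, y w (t + i * (k / n)))
        (∑ i ∈ Finset.range n, yx x (t + i * (k / n))) x :=
      HasDerivAt.fun_sum fun i hi => hyx x hx _ (htime t ht i hi)
    exact ((((h1.const_mul (k / n)).sub (hD x)).sub (hP x)).sub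
      ((g.hasDerivAt x).mul_const (t - ts))).add_const _
  · intro x hx t ht
    have h1 : HasDerivAt (fun w => ∑ i ∈ Finset.range n, a w * yx w (t + i * (k / n)))
        (∑ i ∈ Finset.range n, v x (t + i * (k / n))) x :=
      HasDerivAt.fun_sum fun i hi => hvx x hx _ (htime t ht i hi)
    have h2 := ((((h1.const_mul (k / n)).sub (hp x)).sub (hpp x)).sub
      (((ha' x hx).mul (g.derivative.hasDerivAt x)).mul_const (t - ts)))
    refine h2.congr_of_eventuallyEq (Filter.Eventually.of_forall fun w => ?_)
    have := (ha w).ne'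
    simp only [Pi.sub_apply, Pi.mul_apply, ← Finset.mul_sum]
    field_simp
  · intro x hx t ht
    have h1 : HasDerivAt (fun s => ∑ i ∈ Finset.range n, y x (s + i * (k / n)))
        (∑ i ∈ Finset.range n, (v x (t + i * (k / n)) + F x (t + i * (k / n)))) t :=
      HasDerivAt.fun_sum fun i hi =>
        (hyt x hx _ (htime t ht i hi)).comp_add_const t (i * (k / n))
    have h2 := ((((h1.const_mul (k / n)).sub_const (D x)).sub_const (P x)).sub
      (((hasDerivAt_id t).sub_const ts).const_mul (g.eval x))).add_const (δ * r / 8)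
    rw [mul_one] at h2
    exact h2.hasDerivWithinAt
  · intro t ht
    exact ⟨hl t ht x1 (Or.inl rfl), hl t ht x2 (Or.inr rfl)⟩
  · intro x hx
    have := hb x hx
    simpa using this
  · simpa using hMu
  · refine setLIntegral_mono' measurableSet_Ioc fun t ht => setLIntegral_mono' measurableSet_Ioo
      fun x hx => ?_
    apply ENNReal.ofReal_le_ofReal
    have h1 := abs_lt.1 (hg x (Ioo_subset_Icc_self hx))
    have h2 := hB x hx
    set Lg := a' x * g.derivative.eval x + a x * g.derivative.derivative.eval x
    have h3 : Lg * (t - ts) ≤ ε / 4 := by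
      calc Lg * (t - ts) ≤ |Lg * (t - ts)| := le_abs_self _
        _ = |Lg| * |t - ts| := abs_mul _ _
        _ ≤ B * r := by
          have : |t - ts| ≤ r := by rw [abs_le]; constructor <;> linarith [ht.1, ht.2]
          have := abs_nonneg Lg
          gcongr
          linarith
        _ ≤ ε / 4 := by linarith
    rw [Finset.sum_add_distrib, mul_add]
    set S := (k / n) * ∑ i ∈ Finset.range n, F x (t + i * (k / n))
    set V := (k / n) * ∑ i ∈ Finset.range n, v x (t + i * (k / n))
    set fk := ∫ s in ts..(ts + k), f x s
    have h4 : V + S - g.eval x - (V - (γ x - fk) - -ε - Lg * (t - ts)) ≤ S - fk := by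
      linarith [h1.1]
    rcases le_total (V + S - g.eval x - (V - (γ x - fk) - -ε - Lg * (t - ts))) 0 with h | h
    · rw [max_eq_left h]; simpa using sq_nonneg (S - fk)
    · rw [max_eq_right h]
      exact pow_le_pow_left₀ h h4 2

set_option maxHeartbeats 200000 in
lemma core_est {x1 x2 ts k r η η1 σ : ℝ} (hx : x1 ≤ x2) (hr : 0 < r) (hη : 0 ≤ η) (hη1 : 0 ≤ η1)
    (hσ : 0 ≤ σ)
    {F f : ℝ → ℝ → ℝ} (hF : Measurable (fun p : ℝ × ℝ => F p.1 p.2))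
    (hf : Continuous (fun p : ℝ × ℝ => f p.1 p.2))
    (hFf : ∫⁻ t, ∫⁻ x in Ioo x1 x2, ENNReal.ofReal ((F x t - f x t) ^ 2) ≤ ENNReal.ofReal η)
    (hst : (∫⁻ t in Ioc (ts - r) ts, ∫⁻ x in Ioo x1 x2, ENNReal.ofReal (F x t ^ 2)) +
      (∫⁻ t in Ioc (ts + k - r) (ts + k), ∫⁻ x in Ioo x1 x2, ENNReal.ofReal (F x t ^ 2)) ≤
        ENNReal.ofReal σ) {n : ℕ} (hn : 0 < n)
    (hrie : ∀ x ∈ Icc x1 x2, ∀ t ∈ Icc (ts - r) ts,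
      |(k / n) * ∑ i ∈ Finset.range n, f x (t + i * (k / n)) - ∫ s in t..(t + k), f x s| ≤ η1) :
    ∫⁻ t in Ioc (ts - r) ts, ∫⁻ x in Ioo x1 x2,
      ENNReal.ofReal (((k / n) * ∑ i ∈ Finset.range n, F x (t + i * (k / n)) -
        ∫ s in ts..(ts + k), f x s) ^ 2) ≤
    ENNReal.ofReal (3 * (k ^ 2 * η + η1 ^ 2 * (r * (x2 - x1)) + 2 * r ^ 2 * (2 * σ + 4 * η))) := by
  have he : Measurable (fun p : ℝ × ℝ => F p.1 p.2 - f p.1 p.2) := hF.sub hf.measurable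
  have h1 := avg_contr (k := k) hn (e := fun x t => F x t - f x t) he (Ioo x1 x2) (Ioc (ts - r) ts)
  have h2 := strip_bound (ts := ts) (k := k) hr hf (Ioo x1 x2)
  have hmeas2 : ∀ t, Measurable fun x => ENNReal.ofReal ((F x t - f x t) ^ 2) := fun t =>
    ((he.comp (by fun_prop : Measurable fun x : ℝ => (x, t))).pow_const 2).ennreal_ofReal
  have hmF : ∀ t, Measurable fun x => ENNReal.ofReal ((F x t) ^ 2) := fun t =>
    ((hF.comp (by fun_prop : Measurable fun x : ℝ => (x, t))).pow_const 2).ennreal_ofReal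
  have hmFt : Measurable fun t => ∫⁻ x in Ioo x1 x2, ENNReal.ofReal ((F x t) ^ 2) := by
    have : Measurable fun p : ℝ × ℝ => ENNReal.ofReal ((F p.1 p.2) ^ 2) :=
      (hF.pow_const 2).ennreal_ofReal
    exact this.lintegral_prod_left'
  have hstrip : ∀ J : Set ℝ, (∫⁻ t in J, ∫⁻ x in Ioo x1 x2, ENNReal.ofReal (f x t ^ 2)) ≤
      2 * (∫⁻ t in J, ∫⁻ x in Ioo x1 x2, ENNReal.ofReal (F x t ^ 2)) + 2 * ENNReal.ofReal η := by
    intro J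
    calc (∫⁻ t in J, ∫⁻ x in Ioo x1 x2, ENNReal.ofReal (f x t ^ 2))
        ≤ ∫⁻ t in J, (2 * (∫⁻ x in Ioo x1 x2, ENNReal.ofReal (F x t ^ 2)) +
          2 * ∫⁻ x in Ioo x1 x2, ENNReal.ofReal ((F x t - f x t) ^ 2)) := by
          refine lintegral_mono fun t => ?_
          rw [← lintegral_const_mul' _ _ (by simp), ← lintegral_const_mul' _ _ (by simp),
            ← lintegral_add_left ((hmF t).const_mul _)]
          refine lintegral_mono fun x => ?_
          have : f x t ^ 2 ≤ 2 * F x t ^ 2 + 2 * (F x t - f x t) ^ 2 := by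
            nlinarith [sq_nonneg (2 * F x t - f x t)]
          refine (ENNReal.ofReal_le_ofReal this).trans ?_
          rw [ENNReal.ofReal_add (by positivity) (by positivity), ENNReal.ofReal_mul (by norm_num),
            ENNReal.ofReal_mul (by norm_num)]
          simp
      _ = 2 * (∫⁻ t in J, ∫⁻ x in Ioo x1 x2, ENNReal.ofReal (F x t ^ 2)) +
          2 * ∫⁻ t in J, ∫⁻ x in Ioo x1 x2, ENNReal.ofReal ((F x t - f x t) ^ 2) := by
          rw [lintegral_add_left (hmFt.const_mul _), lintegral_const_mul' _ _ (by simp),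
            lintegral_const_mul' _ _ (by simp)]
      _ ≤ _ := by
          refine add_le_add le_rfl (mul_le_mul' le_rfl ((setLIntegral_le_lintegral _ _).trans hFf))
  have hfsum : (∫⁻ t in Ioc (ts - r) ts, ∫⁻ x in Ioo x1 x2, ENNReal.ofReal (f x t ^ 2)) +
      (∫⁻ t in Ioc (ts + k - r) (ts + k), ∫⁻ x in Ioo x1 x2, ENNReal.ofReal (f x t ^ 2)) ≤
      ENNReal.ofReal (2 * σ + 4 * η) := by
    calc _ ≤ _ := add_le_add (hstrip _) (hstrip _)
      _ = 2 * ((∫⁻ t in Ioc (ts - r) ts, ∫⁻ x in Ioo x1 x2, ENNReal.ofReal (F x t ^ 2)) +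
        (∫⁻ t in Ioc (ts + k - r) (ts + k), ∫⁻ x in Ioo x1 x2, ENNReal.ofReal (F x t ^ 2)))
        + 4 * ENNReal.ofReal η := by ring
      _ ≤ 2 * ENNReal.ofReal σ + 4 * ENNReal.ofReal η := by gcongr
      _ = _ := by
        rw [ENNReal.ofReal_add (by positivity) (by positivity), ENNReal.ofReal_mul (by norm_num),
            ENNReal.ofReal_mul (by norm_num)]
        simp
  obtain ⟨E1, hE1⟩ : ∃ E1 : ℝ → ℝ → ENNReal, ∀ x t, E1 x t =
      ENNReal.ofReal (((k / n) * ∑ i ∈ Finset.range n,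
        (F x (t + i * (k / n)) - f x (t + i * (k / n)))) ^ 2) := ⟨_, fun _ _ => rfl⟩
  obtain ⟨E3, hE3⟩ : ∃ E3 : ℝ → ℝ → ENNReal, ∀ x t, E3 x t =
    ENNReal.ofReal (((∫ s in t..(t + k), f x s) - ∫ s in ts..(ts + k), f x s) ^ 2) :=
    ⟨_, fun _ _ => rfl⟩
  simp_rw [← hE1] at h1
  simp_rw [← hE3] at h2
  have hE1m : Measurable fun p : ℝ × ℝ => E1 p.2 p.1 := by
    simp_rw [hE1]
    have h1 : ∀ i : ℕ, Measurable fun p : ℝ × ℝ => F p.2 (p.1 + i * (k / n)) -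
        f p.2 (p.1 + i * (k / n)) := fun i =>
      he.comp (by fun_prop : Measurable fun p : ℝ × ℝ => (p.2, p.1 + i * (k / n)))
    have h2 : Measurable fun p : ℝ × ℝ => ∑ i ∈ Finset.range n, (F p.2 (p.1 + i * (k / n)) -
        f p.2 (p.1 + i * (k / n))) := Finset.measurable_fun_sum _ fun i _ => h1 i
    exact ((h2.const_mul (k / n)).pow_const 2).ennreal_ofReal
  have hE1x : ∀ t, Measurable fun x => E1 x t := fun t =>
    hE1m.comp (by fun_prop : Measurable fun x : ℝ => (t, x))
  have hE1t : Measurable fun t => ∫⁻ x in Ioo x1 x2, E1 x t := hE1m.lintegral_prod_right'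
  calc _ ≤ ∫⁻ t in Ioc (ts - r) ts, ∫⁻ x in Ioo x1 x2,
        3 * (E1 x t + (ENNReal.ofReal (η1 ^ 2) + E3 x t)) := by
        refine setLIntegral_mono' measurableSet_Ioc fun t ht => setLIntegral_mono' measurableSet_Ioo
          fun x hx => ?_
        have h5 := hrie x (Ioo_subset_Icc_self hx) t (Ioc_subset_Icc_self ht)
        simp only [hE1, hE3]
        rw [← ENNReal.ofReal_add (by positivity) (by positivity),
          ← ENNReal.ofReal_add (by positivity) (by positivity),
          show (3 : ENNReal) = ENNReal.ofReal 3 by simp, ← ENNReal.ofReal_mul (by norm_num)]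
        apply ENNReal.ofReal_le_ofReal
        rw [Finset.sum_sub_distrib, mul_sub]
        generalize (k / n) * ∑ i ∈ Finset.range n, F x (t + i * (k / n)) = A at *
        generalize (k / n) * ∑ i ∈ Finset.range n, f x (t + i * (k / n)) = A1 at *
        generalize (∫ s in t..(t + k), f x s) = A2 at *
        generalize (∫ s in ts..(ts + k), f x s) = A3 at *
        have h6 : (A1 - A2) ^ 2 ≤ η1 ^ 2 := sq_le_sq' (by linarith [(abs_le.1 h5).1]) (abs_le.1 h5).2
        nlinarith [sq_nonneg ((A - A1) - (A1 - A2)), sq_nonneg ((A - A1) - (A2 - A3)),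
          sq_nonneg ((A1 - A2) - (A2 - A3))]
    _ = 3 * ((∫⁻ t in Ioc (ts - r) ts, ∫⁻ x in Ioo x1 x2, E1 x t) +
        (ENNReal.ofReal (η1 ^ 2) * ENNReal.ofReal (r * (x2 - x1)) +
        ∫⁻ t in Ioc (ts - r) ts, ∫⁻ x in Ioo x1 x2, E3 x t)) := by
        have h7 : ∀ t, ∫⁻ x in Ioo x1 x2, 3 * (E1 x t + (ENNReal.ofReal (η1 ^ 2) + E3 x t)) =
            3 * ((∫⁻ x in Ioo x1 x2, E1 x t) + (ENNReal.ofReal (η1 ^ 2) *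
            ENNReal.ofReal (x2 - x1) + ∫⁻ x in Ioo x1 x2, E3 x t)) := by
          intro t
          rw [lintegral_const_mul' _ _ (by simp), lintegral_add_left (hE1x t),
            lintegral_add_left measurable_const, setLIntegral_const, Real.volume_Ioo]
        simp_rw [h7]
        rw [lintegral_const_mul' _ _ (by simp), lintegral_add_left hE1t,
            lintegral_add_left measurable_const, setLIntegral_const, Real.volume_Ioc, mul_assoc,
            ← ENNReal.ofReal_mul (by linarith)]
        rw [show (x2 - x1) * (ts - (ts - r)) = r * (x2 - x1) by ring]
    _ ≤ 3 * (ENNReal.ofReal (k ^ 2) * ENNReal.ofReal η +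
        (ENNReal.ofReal (η1 ^ 2) * ENNReal.ofReal (r * (x2 - x1)) +
        ENNReal.ofReal (2 * r ^ 2) * ENNReal.ofReal (2 * σ + 4 * η))) := by
        refine mul_le_mul' le_rfl (add_le_add (h1.trans (mul_le_mul' le_rfl hFf))
          (add_le_add le_rfl (h2.trans (mul_le_mul' le_rfl hfsum))))
    _ = _ := by
        have : 0 ≤ r * (x2 - x1) := mul_nonneg hr.le (by linarith)
        rw [← ENNReal.ofReal_mul (by positivity), ← ENNReal.ofReal_mul (by positivity),
          ← ENNReal.ofReal_mul (by positivity),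
          ← ENNReal.ofReal_add (by positivity) (by positivity),
          ← ENNReal.ofReal_add (by positivity) (by positivity),
          show (3 : ENNReal) = ENNReal.ofReal 3 by simp, ← ENNReal.ofReal_mul (by norm_num)]
        congr 1; ring

lemma strip_small {Φ : ℝ → ENNReal} (h : ∫⁻ t, Φ t ≠ ⊤) (c : ℝ) {σ : ℝ} (hσ : 0 < σ) :
    ∀ᶠ r in nhdsWithin (0 : ℝ) (Ioi 0), ∫⁻ t in Ioc (c - r) c, Φ t ≤ ENNReal.ofReal σ := by
  have h1 : Filter.Tendsto (fun r : ℝ => volume (Ioc (c - r) c)) (nhdsWithin (0 : ℝ) (Ioi 0))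
      (nhds 0) := by
    have : ∀ r : ℝ, volume (Ioc (c - r) c) = ENNReal.ofReal r := by
      intro r; rw [Real.volume_Ioc]; congr 1; ring
    simp_rw [this]
    have h2 : Filter.Tendsto (fun r : ℝ => ENNReal.ofReal r) (nhds 0) (nhds (ENNReal.ofReal 0)) :=
      ENNReal.continuous_ofReal.tendsto 0
    rw [ENNReal.ofReal_zero] at h2
    exact h2.mono_left nhdsWithin_le_nhds
  have h2 := tendsto_setLIntegral_zero h h1
  have h3 : (0 : ENNReal) < ENNReal.ofReal σ := ENNReal.ofReal_pos.2 hσ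
  exact (h2.eventually (gt_mem_nhds h3)).mono fun r hr => hr.le

lemma shift_expand {x1 x2 ts k δ : ℝ} (hδ : 0 < δ) {y : ℝ → ℝ → ℝ}
    (hy : Continuous (fun p : ℝ × ℝ => y p.1 p.2)) :
    ∀ᶠ r in nhdsWithin (0 : ℝ) (Ioi 0), ∀ x ∈ Icc x1 x2, ∀ t ∈ Icc (ts - r) ts,
      |(∫ s in t..(t + k), y x s) - (∫ s in ts..(ts + k), y x s) -
        (y x (ts + k) - y x ts) * (t - ts)| ≤ δ * r := by
  have hH : Continuous fun p : ℝ × ℝ => y p.1 (p.2 + k) - y p.1 p.2 :=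
    (hy.comp (by fun_prop : Continuous fun p : ℝ × ℝ => (p.1, p.2 + k))).sub hy
  have hcomp : IsCompact (Icc x1 x2 ×ˢ Icc (ts - 1) ts) := isCompact_Icc.prod isCompact_Icc
  have huc := hcomp.uniformContinuousOn_of_continuous hH.continuousOn
  rw [Metric.uniformContinuousOn_iff] at huc
  obtain ⟨d, hd, H⟩ := huc δ hδ
  have hmem : Ioo (0 : ℝ) (min d 1) ∈ nhdsWithin (0 : ℝ) (Ioi 0) :=
    Ioo_mem_nhdsGT (by positivity)
  filter_upwards [hmem] with r hr x hx t ht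
  have hr1 : r < d := hr.2.trans_le (min_le_left _ _)
  have hr2 : r < 1 := hr.2.trans_le (min_le_right _ _)
  have hyx : Continuous (y x) := hy.comp (by fun_prop : Continuous fun s : ℝ => (x, s))
  have hi := fun a b => hyx.intervalIntegrable (μ := volume) a b
  have hyk : Continuous fun s => y x (s + k) := hyx.comp (by fun_prop)
  have h1 := intervalIntegral.integral_add_adjacent_intervals (hi t ts) (hi ts (ts + k))
  have h2 := intervalIntegral.integral_add_adjacent_intervals (hi t (t + k)) (hi (t + k) (ts + k))
  have h3 : ∫ s in t..ts, y x (s + k) = ∫ s in (t + k)..(ts + k), y x s :=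
    intervalIntegral.integral_comp_add_right (fun s => y x s) k
  have h4 : ∫ s in t..ts, (y x (ts + k) - y x ts - (y x (s + k) - y x s)) =
      (y x (ts + k) - y x ts) * (ts - t) - ((∫ s in t..ts, y x (s + k)) - ∫ s in t..ts, y x s) := by
    rw [intervalIntegral.integral_sub (by simp)
      ((hyk.intervalIntegrable _ _).sub (hi _ _)), intervalIntegral.integral_sub
      (hyk.intervalIntegrable _ _) (hi _ _), intervalIntegral.integral_const, smul_eq_mul]
    ring
  have h5 : (∫ s in t..(t + k), y x s) - (∫ s in ts..(ts + k), y x s) -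
        (y x (ts + k) - y x ts) * (t - ts) =
      ∫ s in t..ts, (y x (ts + k) - y x ts - (y x (s + k) - y x s)) := by
    rw [h4, h3]; linarith
  rw [h5, ← Real.norm_eq_abs]
  refine (intervalIntegral.norm_integral_le_of_norm_le_const (C := δ) ?_).trans ?_
  · intro s hs
    rw [uIoc_of_le ht.2] at hs
    have := H (x, ts) ⟨hx, by constructor <;> linarith⟩ (x, s)
      ⟨hx, by constructor <;> linarith [ht.1, hs.1, hs.2]⟩ (by
        rw [Prod.dist_eq, dist_self, Real.dist_eq, abs_of_nonneg (by linarith [hs.2])]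
        simp only [max_lt_iff]; exact ⟨hd, by linarith [hs.1, ht.1]⟩)
    rw [Real.dist_eq] at this
    exact this.le
  · rw [abs_of_nonneg (by linarith [ht.2])]
    have := ht.1
    gcongr
    linarith

set_option maxHeartbeats 1000000 in
lemma core_max {x1 x2 T1 T2 ts k A : ℝ} (hx : x1 < x2) (hk : 0 < k)
    (hT1 : T1 < ts) (hT2 : ts + k < T2) {a a' : ℝ → ℝ} (hac : Continuous a) (ha : ∀ w, 0 < a w)
    (ha' : ∀ x ∈ Ioo x1 x2, HasDerivAt a (a' x) x) (hA : ∀ x ∈ Ioo x1 x2, |a' x| ≤ A)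
    {y yx v F : ℝ → ℝ → ℝ} (hy : Continuous (fun p : ℝ × ℝ => y p.1 p.2))
    (hyx : ∀ x ∈ Ioo x1 x2, ∀ t ∈ Ioo T1 T2, HasDerivAt (fun w => y w t) (yx x t) x)
    (hvx : ∀ x ∈ Ioo x1 x2, ∀ t ∈ Ioo T1 T2, HasDerivAt (fun w => a w * yx w t) (v x t) x)
    (hyt : ∀ x ∈ Ioo x1 x2, ∀ t ∈ Ioo T1 T2, HasDerivAt (fun s => y x s) (v x t + F x t) t)
    (hF : Measurable (fun p : ℝ × ℝ => F p.1 p.2))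
    (hF2 : ∫⁻ t, ∫⁻ x in Ioo x1 x2, ENNReal.ofReal (F x t ^ 2) ≠ ⊤)
    {w : ℝ → ℝ} (hwc : ContinuousOn w (Icc x1 x2))
    (hw : ∀ η > 0, ∃ (f : ℝ → ℝ → ℝ) (D p : ℝ → ℝ), Continuous (fun p : ℝ × ℝ => f p.1 p.2) ∧
      (∀ x, HasDerivAt D (p x / a x) x) ∧
      (∀ x, HasDerivAt p ((y x (ts + k) - y x ts) - ∫ s in ts..(ts + k), f x s) x) ∧
      (∀ x ∈ Icc x1 x2, |D x - w x| ≤ η) ∧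
      ∫⁻ t, ∫⁻ x in Ioo x1 x2, ENNReal.ofReal ((F x t - f x t) ^ 2) ≤ ENNReal.ofReal η)
    {α β : ℝ} (hend : ∀ x, x = x1 ∨ x = x2 →
      (∫ s in ts..(ts + k), y x s) - w x - α - β * (∫ ξ in x1..x, 1 / a ξ) ≤ 0) :
    ∀ x ∈ Icc x1 x2,
      (∫ s in ts..(ts + k), y x s) - w x - α - β * (∫ ξ in x1..x, 1 / a ξ) ≤ 0 := by
  by_contra hcon
  push Not at hcon
  obtain ⟨xh, hxh, hN⟩ := hcon
  have hainv : Continuous fun ξ => 1 / a ξ := continuous_const.div hac fun ξ => (ha ξ).ne'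
  obtain ⟨Y, hY⟩ : ∃ Y : ℝ → ℝ, ∀ x, Y x = ∫ ξ in x1..x, 1 / a ξ := ⟨_, fun _ => rfl⟩
  obtain ⟨W, hW⟩ : ∃ W : ℝ → ℝ, ∀ x, W x = ∫ s in ts..(ts + k), y x s := ⟨_, fun _ => rfl⟩
  simp_rw [← hY, ← hW] at hN hend
  have hYd : ∀ x, HasDerivAt Y (1 / a x) x := by
    intro x
    have := intervalIntegral.integral_hasDerivAt_right (hainv.intervalIntegrable x1 x)
      (hainv.stronglyMeasurableAtFilter _ _) hainv.continuousAt
    rwa [← funext hY] at this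
  have hWc : Continuous W := by
    rw [funext hW]
    exact intervalIntegral.continuous_parametric_intervalIntegral_of_continuous' hy ts (ts + k)
  -- q
  have hqc : Continuous fun ξ => (ξ - x1) / a ξ :=
    (continuous_id.sub continuous_const).div hac fun ξ => (ha ξ).ne'
  obtain ⟨q, hq⟩ : ∃ q : ℝ → ℝ, ∀ x, q x = ∫ ξ in x1..x, (ξ - x1) / a ξ := ⟨_, fun _ => rfl⟩
  have hqd : ∀ x, HasDerivAt q ((x - x1) / a x) x := by
    intro x
    have := intervalIntegral.integral_hasDerivAt_right (hqc.intervalIntegrable x1 x)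
      (hqc.stronglyMeasurableAtFilter _ _) hqc.continuousAt
    rwa [← funext hq] at this
  have hq0 : ∀ x ∈ Icc x1 x2, 0 ≤ q x ∧ q x ≤ q x2 := by
    intro x hx'
    rw [hq, hq]
    constructor
    · exact intervalIntegral.integral_nonneg hx'.1 fun ξ hξ =>
        div_nonneg (by linarith [hξ.1]) (ha ξ).le
    · refine intervalIntegral.integral_mono_interval le_rfl hx'.1 hx'.2 ?_
        (hqc.intervalIntegrable _ _)
      rw [Filter.EventuallyLE, ae_restrict_iff' measurableSet_Ioc]
      exact Filter.Eventually.of_forall fun ξ hξ => div_nonneg (by linarith [hξ.1]) (ha ξ).le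
  have hYc : Continuous Y := continuous_iff_continuousAt.2 fun x => (hYd x).continuousAt
  have hqC : Continuous q := continuous_iff_continuousAt.2 fun x => (hqd x).continuousAt
  set N := W xh - w xh - α - β * Y xh with hNdef
  set Q := q x2 with hQ
  have hQ0 : 0 ≤ Q := (hq0 x2 (right_mem_Icc.2 hx.le)).1
  set ε := N / (4 * (Q + 1)) with hε
  have hε0 : 0 < ε := by positivity
  have hεQ : ε * Q ≤ N / 4 := by
    rw [hε, div_mul_eq_mul_div, div_le_iff₀ (by positivity)]
    nlinarith
  obtain ⟨x0, hx0, hmax⟩ := isCompact_Icc.exists_isMaxOn (nonempty_Icc.2 hx.le)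
    (f := fun x => W x - w x - α - β * Y x + ε * q x) (by fun_prop)
  set N' := W x0 - w x0 - α - β * Y x0 + ε * q x0 with hN'
  have hmax' : ∀ x ∈ Icc x1 x2, W x - w x - α - β * Y x + ε * q x ≤ N' := fun x hx => hmax hx
  have hNN' : N ≤ N' := by
    have h1 := hmax' xh hxh
    have h2 := mul_nonneg hε0.le (hq0 xh hxh).1
    linarith
  set δ := ε / 2 with hδ
  have hδ0 : 0 < δ := by positivity
  obtain ⟨γ, hγ⟩ : ∃ γ : ℝ → ℝ, ∀ x, γ x = y x (ts + k) - y x ts := ⟨_, fun _ => rfl⟩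
  have hγc : Continuous γ := by
    rw [funext hγ]
    exact (hy.comp (by fun_prop : Continuous fun x : ℝ => (x, ts + k))).sub
      (hy.comp (by fun_prop : Continuous fun x : ℝ => (x, ts)))
  obtain ⟨g, hg⟩ := exists_polynomial_near_of_continuousOn x1 x2 (fun x => γ x - δ / 2)
    (by fun_prop) (δ / 8) (by positivity)
  obtain ⟨B1, hB1⟩ := (isCompact_Icc (a := x1) (b := x2)).exists_bound_of_continuousOn
    (f := fun x => g.derivative.eval x) g.derivative.continuous.continuousOn
  obtain ⟨B2, hB2⟩ := (isCompact_Icc (a := x1) (b := x2)).exists_bound_of_continuousOn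
    (f := fun x => a x * g.derivative.derivative.eval x)
    (hac.mul g.derivative.derivative.continuous).continuousOn
  have hxm : (x1 + x2) / 2 ∈ Ioo x1 x2 := by constructor <;> linarith
  have hA0 : 0 ≤ A := (abs_nonneg _).trans (hA _ hxm)
  have hB20 : 0 ≤ B2 := (norm_nonneg _).trans (hB2 _ (Ioo_subset_Icc_self hxm))
  have hB10 : 0 ≤ B1 := (norm_nonneg _).trans (hB1 _ (Ioo_subset_Icc_self hxm))
  set B := A * B1 + B2 + 1 with hB
  have hB0 : 0 < B := by positivity
  have hBb : ∀ x ∈ Ioo x1 x2,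
      |a' x * g.derivative.eval x + a x * g.derivative.derivative.eval x| ≤ B := by
    intro x hx'
    have h1 := hB1 x (Ioo_subset_Icc_self hx')
    have h2 := hB2 x (Ioo_subset_Icc_self hx')
    rw [Real.norm_eq_abs] at h1 h2
    calc _ ≤ |a' x * g.derivative.eval x| + |a x * g.derivative.derivative.eval x| :=
          abs_add_le _ _
      _ ≤ A * B1 + B2 := by
          rw [abs_mul]
          gcongr
          exact hA x hx'
      _ ≤ B := by linarith
  set L := Y x2 with hL
  have hL0 : 0 < L := by
    rw [hL, hY]
    exact intervalIntegral.intervalIntegral_pos_of_pos (hainv.intervalIntegrable _ _)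
      (fun ξ => by have := ha ξ; positivity) hx
  set c := (δ / 16) ^ 2 / L with hc
  have hc0 : 0 < c := by positivity
  -- choose r
  have e1 : ∀ᶠ r in nhdsWithin (0 : ℝ) (Ioi 0), r < min (min (ts - T1) (ε / (4 * B))) (N / δ) := by
    have : (0 : ℝ) < min (min (ts - T1) (ε / (4 * B))) (N / δ) := by
      refine lt_min (lt_min (by linarith) (by positivity)) (by positivity)
    exact (Ioo_mem_nhdsGT this |> Filter.mem_of_superset) fun r hr => hr.2
  obtain ⟨r, hr1, hr2, hr3, hr4, hr0⟩ := (e1.and ((shift_expand (x1 := x1) (x2 := x2) (ts := ts)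
    (k := k) (δ := δ / 8) (by positivity) hy).and
    ((strip_small hF2 ts (σ := c / 144) (by positivity)).and
    ((strip_small hF2 (ts + k) (σ := c / 144) (by positivity)).and
      (self_mem_nhdsWithin))))).exists
  have hr0 : 0 < r := hr0
  have hr11 : r < ts - T1 := hr1.trans_le ((min_le_left _ _).trans (min_le_left _ _))
  have hr12 : r * B ≤ ε / 4 := by
    have : r < ε / (4 * B) := hr1.trans_le ((min_le_left _ _).trans (min_le_right _ _))
    rw [lt_div_iff₀ (by positivity)] at this
    linarith
  have hr13 : δ * r ≤ N := by
    have : r < N / δ := hr1.trans_le (min_le_right _ _)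
    rw [lt_div_iff₀ hδ0] at this
    linarith
  -- choose η
  obtain ⟨η, hη0, hη1, hη2, hη3⟩ : ∃ η > 0, η ≤ δ * r / 32 ∧ 3 * (k ^ 2 * η) ≤ c * r ^ 2 / 6 ∧
      24 * η ≤ c / 6 := by
    refine ⟨min (min (δ * r / 32) (c * r ^ 2 / (18 * k ^ 2))) (c / 144), ?_, ?_, ?_, ?_⟩
    · exact lt_min (lt_min (by positivity) (by positivity)) (by positivity)
    · exact (min_le_left _ _).trans (min_le_left _ _)
    · have h1 : min (min (δ * r / 32) (c * r ^ 2 / (18 * k ^ 2))) (c / 144) ≤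
        c * r ^ 2 / (18 * k ^ 2) := (min_le_left _ _).trans (min_le_right _ _)
      calc 3 * (k ^ 2 * _) ≤ 3 * (k ^ 2 * (c * r ^ 2 / (18 * k ^ 2))) := by gcongr
        _ = c * r ^ 2 / 6 := by field_simp; norm_num
    · have h1 := min_le_right (min (δ * r / 32) (c * r ^ 2 / (18 * k ^ 2))) (c / 144)
      linarith
  obtain ⟨f, D, p, hf, hD, hp, hDw, hFf⟩ := hw η hη0
  simp_rw [← hγ] at hp hr2
  simp_rw [← hW] at hr2
  obtain ⟨η1, hη10, hη11⟩ : ∃ η1 > 0, 3 * (η1 ^ 2 * (r * (x2 - x1))) ≤ c * r ^ 2 / 6 := by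
    have hpos : 0 < c * r / (18 * (x2 - x1)) := div_pos (by positivity) (by linarith)
    refine ⟨Real.sqrt (c * r / (18 * (x2 - x1))), Real.sqrt_pos.2 hpos, ?_⟩
    rw [Real.sq_sqrt hpos.le]
    have : x2 - x1 ≠ 0 := by linarith
    apply le_of_eq
    field_simp; norm_num
  obtain ⟨n1, hn1⟩ := riemann_unif (x1 := x1) (x2 := x2) (A := ts - r) (B := ts) hk hy
    (ε := δ * r / 32) (by positivity)
  obtain ⟨n2, hn2⟩ := riemann_unif (x1 := x1) (x2 := x2) (A := ts - r) (B := ts) hk hf hη10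
  obtain ⟨n, hn⟩ : ∃ n, n = max (max n1 n2) 1 := ⟨_, rfl⟩
  have hn0 : 0 < n := by rw [hn]; exact lt_of_lt_of_le one_pos (le_max_right _ _)
  have hry := hn1 n (by rw [hn]; exact (le_max_left _ _).trans (le_max_left _ _)) hn0
  have hrf := hn2 n (by rw [hn]; exact (le_max_right _ _).trans (le_max_left _ _)) hn0
  have hest := core_est (σ := c / 72) hx.le hr0 hη0.le hη10.le (by positivity) hF hf hFf
    ((add_le_add hr3 hr4).trans (by
      rw [← ENNReal.ofReal_add (by positivity) (by positivity)]
      apply ENNReal.ofReal_le_ofReal; linarith)) hn0 hrf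
  have habp := core_abp (x1 := x1) (x2 := x2) (T1 := T1) (T2 := T2) (ts := ts) (k := k) (r := r)
    (L := L) (M := δ * r / 16) (x0 := x0) (ε := ε) (δ := δ) (B := B) hr0 hk (by linarith) hT2 hL0
    (by positivity) hx0 ha ha' (Yc := fun x => Y (max x1 (min x x2))) (by fun_prop) (by
      intro x
      have hcl : max x1 (min x x2) ∈ Icc x1 x2 :=
        ⟨le_max_left _ _, max_le hx.le (min_le_right _ _)⟩
      have hnn : ∀ ξ, 0 ≤ 1 / a ξ := fun ξ => by have := ha ξ; positivity
      rw [hL, hY, hY]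
      constructor
      · exact intervalIntegral.integral_nonneg hcl.1 fun ξ hξ => hnn ξ
      · exact intervalIntegral.integral_mono_interval le_rfl hcl.1 hcl.2
          (Filter.Eventually.of_forall hnn) (hainv.intervalIntegrable _ _)) (by
      intro x hx'
      refine (hYd x).congr_of_eventuallyEq ?_
      filter_upwards [Ioo_mem_nhds hx'.1 hx'.2] with z hz
      rw [min_eq_left hz.2.le, max_eq_right hz.1.le]) hy hyx hvx hyt hD hp
    (P := fun x => α + β * Y x - ε * q x + N') (pp := fun x => β - ε * (x - x1)) (by
      intro x
      have h1 := ((((hYd x).const_mul β).const_add α).sub ((hqd x).const_mul ε)).add_const N'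
      have h2 : β * (1 / a x) - ε * ((x - x1) / a x) = (β - ε * (x - x1)) / a x := by ring
      rw [h2] at h1
      exact h1) (by
      intro x
      have h1 := (((hasDerivAt_id x).sub_const x1).const_mul ε).const_sub β
      simpa using h1) hε0 hδ hg hBb hr12 hn0 (F := F) (f := f) (y := y) (by
      intro t ht x hxe
      have hxI : x ∈ Icc x1 x2 := by
        rcases hxe with h | h <;> rw [h]
        · exact left_mem_Icc.2 hx.le
        · exact right_mem_Icc.2 hx.le
      have h1 := (abs_le.1 (hry x hxI t ht)).2
      have h2 := (abs_le.1 (hr2 x hxI t ht)).2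
      have h3 := (abs_le.1 (hDw x hxI)).1
      have h4 := hend x hxe
      have h5 := abs_lt.1 (hg x hxI)
      have h6 : ε * q x ≤ ε * Q := by
        have := (hq0 x hxI).2
        gcongr
      have h7 : (γ x - g.eval x) * (t - ts) ≤ 0 :=
        mul_nonpos_of_nonneg_of_nonpos (by linarith [h5.2]) (by linarith [ht.2])
      nlinarith) (by
      intro x hxI
      have ht : ts - r ∈ Icc (ts - r) ts := ⟨le_rfl, by linarith⟩
      have h1 := (abs_le.1 (hry x hxI _ ht)).2
      have h2 := (abs_le.1 (hr2 x hxI _ ht)).2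
      have h3 := (abs_le.1 (hDw x hxI)).1
      have h4 := hmax' x hxI
      have h5 := abs_lt.1 (hg x hxI)
      have h7 : (γ x - g.eval x) * (-r) ≤ (3 * δ / 8) * (-r) :=
        mul_le_mul_of_nonpos_right (by linarith [h5.2]) (by linarith)
      rw [show ts - r - ts = -r by ring] at h2
      nlinarith) (by
      have ht : ts ∈ Icc (ts - r) ts := ⟨by linarith, le_rfl⟩
      have h1 := (abs_le.1 (hry x0 hx0 _ ht)).1
      rw [← hW] at h1
      have h3 := (abs_le.1 (hDw x0 hx0)).2
      linarith)
  have hfin := habp.trans hest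
  rw [ENNReal.ofReal_le_ofReal_iff (by
    have : 0 ≤ r * (x2 - x1) := mul_nonneg hr0.le (by linarith)
    positivity)] at hfin
  have h8 : (δ * r / 16) ^ 2 / L = c * r ^ 2 := by rw [hc]; ring
  rw [h8] at hfin
  have h9 : r ^ 2 * (24 * η) ≤ r ^ 2 * (c / 6) := by gcongr
  nlinarith [mul_pos hc0 (pow_pos hr0 2)]

lemma rect_int {u : ℝ × ℝ → ℝ} (hu : MemLp u 2 volume) (A B c d : ℝ) :
    Integrable u ((volume.restrict (Ioc A B)).prod (volume.restrict (Ioc c d))) := by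
  have h : MemLp u 2 ((volume.restrict (Ioc A B)).prod (volume.restrict (Ioc c d))) := by
    rw [Measure.prod_restrict]
    exact hu.restrict _
  exact h.integrable one_le_two

lemma rect_inner {u : ℝ × ℝ → ℝ} (hu : MemLp u 2 volume) {c d : ℝ} (hcd : c ≤ d) (A B : ℝ) :
    IntervalIntegrable (fun x => ∫ s in c..d, u (x, s)) volume A B := by
  simp_rw [intervalIntegral.integral_of_le hcd]
  exact ⟨(rect_int hu A B c d).integral_prod_left, (rect_int hu B A c d).integral_prod_left⟩

lemma rect_bound {u : ℝ × ℝ → ℝ} (hu : MemLp u 2 volume) {A B c d lam : ℝ} (hAB : A ≤ B)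
    (hcd : c ≤ d) (hl : 0 < lam) :
    ∫ x in A..B, |∫ s in c..d, u (x, s)| ≤ lam * ((B - A) * (d - c)) + (∫ p, u p ^ 2) / lam := by
  have h1 := rect_int hu A B c d
  rw [intervalIntegral.integral_of_le hAB]
  have h2 : ∀ x, |∫ s in c..d, u (x, s)| ≤ ∫ s in Ioc c d, |u (x, s)| := fun x => by
    rw [intervalIntegral.integral_of_le hcd]
    exact abs_integral_le_integral_abs
  have h3 : ∫ x in Ioc A B, |∫ s in c..d, u (x, s)| ≤ ∫ x in Ioc A B, ∫ s in Ioc c d, |u (x, s)| := by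
    refine integral_mono_of_nonneg (Filter.Eventually.of_forall fun x => abs_nonneg _)
      h1.abs.integral_prod_left (Filter.Eventually.of_forall h2)
  refine h3.trans ?_
  rw [← integral_prod (fun p : ℝ × ℝ => |u p|) h1.abs, Measure.prod_restrict,
    ← Measure.volume_eq_prod]
  have hsq : Integrable (fun p => u p ^ 2) := hu.integrable_sq
  have hfin : (volume (Ioc A B ×ˢ Ioc c d) : ENNReal) ≠ ⊤ := by
    rw [Measure.volume_eq_prod, Measure.prod_prod]
    simp [ENNReal.mul_eq_top]
  have : ∫ p in Ioc A B ×ˢ Ioc c d, |u p| ≤ ∫ p in Ioc A B ×ˢ Ioc c d, (lam + u p ^ 2 / lam) := by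
    refine integral_mono_of_nonneg (Filter.Eventually.of_forall fun x => abs_nonneg _)
      ((integrableOn_const hfin).add (hsq.div_const lam).integrableOn)
      (Filter.Eventually.of_forall fun p => ?_)
    have : lam + u p ^ 2 / lam - |u p| = ((lam - |u p| / 2) ^ 2 + 3 / 4 * |u p| ^ 2) / lam := by
      rw [← sq_abs (u p)]; field_simp; ring
    have h0 : 0 ≤ lam + u p ^ 2 / lam - |u p| := by rw [this]; positivity
    simpa using h0
  refine this.trans ?_
  rw [integral_add (f := fun _ => lam) (integrableOn_const hfin).integrable (hsq.div_const lam).integrableOn.integrable, integral_div]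
  have e1 : ∫ p in Ioc A B ×ˢ Ioc c d, lam = lam * ((B - A) * (d - c)) := by
    rw [setIntegral_const, Measure.real, Measure.volume_eq_prod, Measure.prod_prod]
    simp [ENNReal.toReal_mul, sub_nonneg.2 hAB, sub_nonneg.2 hcd, mul_comm]
  rw [e1]
  have e2 : ∫ p in Ioc A B ×ˢ Ioc c d, u p ^ 2 ≤ ∫ p, u p ^ 2 :=
    setIntegral_le_integral hsq (Filter.Eventually.of_forall fun p => sq_nonneg _)
  gcongr

lemma iter_sq_le {u : ℝ × ℝ → ℝ} (hu : MemLp u 2 volume) (hm : Measurable u) (S : Set ℝ) :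
    ∫⁻ t, ∫⁻ x in S, ENNReal.ofReal (u (x, t) ^ 2) ≤ ENNReal.ofReal (∫ p, u p ^ 2) := by
  rw [ofReal_integral_eq_lintegral_ofReal hu.integrable_sq
    (Filter.Eventually.of_forall fun p => sq_nonneg _), Measure.volume_eq_prod,
    lintegral_prod_symm _ (by fun_prop)]
  exact lintegral_mono fun t => setLIntegral_le_lintegral _ _

lemma l2_approx {u : ℝ × ℝ → ℝ} (hu : MemLp u 2 volume) {ε : ℝ} (hε : 0 < ε) :
    ∃ g : ℝ × ℝ → ℝ, Continuous g ∧ MemLp g 2 volume ∧ ∫ p, (u p - g p) ^ 2 ≤ ε := by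
  obtain ⟨g, -, h1, h2, h3⟩ := hu.exists_hasCompactSupport_eLpNorm_sub_le (by simp)
    (ε := ENNReal.ofReal (Real.sqrt ε)) (by simpa using hε)
  refine ⟨g, h2, h3, ?_⟩
  have hd : MemLp (u - g) 2 volume := hu.sub h3
  have : eLpNorm (u - g) 2 volume ^ (2:ℝ) = ENNReal.ofReal (∫ p, (u p - g p) ^ 2) := by
    rw [show (∫ p, (u p - g p) ^ 2) = ∫ p, (u - g) p ^ 2 from rfl,
      ofReal_integral_eq_lintegral_ofReal hd.integrable_sq
      (Filter.Eventually.of_forall fun p => sq_nonneg _),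
      eLpNorm_eq_lintegral_rpow_enorm_toReal (by simp) (by simp), ← ENNReal.rpow_mul]
    simp only [ENNReal.toReal_ofNat, one_div, ENNReal.rpow_ofNat]
    norm_num
    refine lintegral_congr fun p => ?_
    rw [← ofReal_norm, ← ENNReal.ofReal_pow (norm_nonneg _)]
    simp
  have h4 : eLpNorm (u - g) 2 volume ^ (2:ℝ) ≤ ENNReal.ofReal ε := by
    calc _ ≤ (ENNReal.ofReal (Real.sqrt ε)) ^ (2:ℝ) := by gcongr
      _ = ENNReal.ofReal ε := by
        rw [ENNReal.rpow_ofNat, ← ENNReal.ofReal_pow (Real.sqrt_nonneg _), Real.sq_sqrt hε.le]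
  rw [this] at h4
  exact (ENNReal.ofReal_le_ofReal_iff hε.le).1 h4

set_option maxHeartbeats 1000000 in
lemma core_le {x1 x2 T1 T2 ts k A : ℝ} (hx : x1 < x2) (hk : 0 < k)
    (hT1 : T1 < ts) (hT2 : ts + k < T2) {a a' : ℝ → ℝ} (hac : Continuous a) (ha : ∀ w, 0 < a w)
    (ha' : ∀ x ∈ Ioo x1 x2, HasDerivAt a (a' x) x) (hA : ∀ x ∈ Ioo x1 x2, |a' x| ≤ A)
    {y yx v F : ℝ → ℝ → ℝ} (hy : Continuous (fun p : ℝ × ℝ => y p.1 p.2))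
    (hyx : ∀ x ∈ Ioo x1 x2, ∀ t ∈ Ioo T1 T2, HasDerivAt (fun w => y w t) (yx x t) x)
    (hvx : ∀ x ∈ Ioo x1 x2, ∀ t ∈ Ioo T1 T2, HasDerivAt (fun w => a w * yx w t) (v x t) x)
    (hyt : ∀ x ∈ Ioo x1 x2, ∀ t ∈ Ioo T1 T2, HasDerivAt (fun s => y x s) (v x t + F x t) t)
    (hF : Measurable (fun p : ℝ × ℝ => F p.1 p.2))
    (hFL : MemLp (fun p : ℝ × ℝ => F p.1 p.2) 2 volume)
    {α β : ℝ} (hend : ∀ x, x = x1 ∨ x = x2 →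
      (∫ s in ts..(ts + k), y x s) - (∫ ξ in x1..x, (1 / a ξ) * ∫ r in x1..ξ,
        (y r (ts + k) - y r ts - ∫ s in ts..(ts + k), F r s)) - α - β * (∫ ξ in x1..x, 1 / a ξ) ≤ 0) :
    ∀ x ∈ Icc x1 x2,
      (∫ s in ts..(ts + k), y x s) - (∫ ξ in x1..x, (1 / a ξ) * ∫ r in x1..ξ,
        (y r (ts + k) - y r ts - ∫ s in ts..(ts + k), F r s)) - α - β * (∫ ξ in x1..x, 1 / a ξ) ≤ 0 := by
  have hkle : ts ≤ ts + k := by linarith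
  have hγ : Continuous fun r => y r (ts + k) - y r ts := by
    exact (hy.comp (continuous_id.prodMk continuous_const)).sub
      (hy.comp (continuous_id.prodMk continuous_const))
  have hκ : ∀ A B : ℝ, IntervalIntegrable
      (fun r => y r (ts + k) - y r ts - ∫ s in ts..(ts + k), F r s) volume A B := fun A B =>
    (hγ.intervalIntegrable A B).sub (rect_inner hFL hkle A B)
  obtain ⟨q, hq⟩ : ∃ q : ℝ → ℝ, ∀ ξ, q ξ = ∫ r in x1..ξ,
        (y r (ts + k) - y r ts - ∫ s in ts..(ts + k), F r s) := ⟨_, fun _ => rfl⟩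
  have hqc : Continuous q := by
    rw [funext hq]; exact intervalIntegral.continuous_primitive hκ x1
  have hainv : Continuous fun ξ => 1 / a ξ := continuous_const.div hac fun ξ => (ha ξ).ne'
  have h_itg : Continuous fun ξ => 1 / a ξ * q ξ := hainv.mul hqc
  simp_rw [← hq] at hend ⊢
  refine core_max hx hk hT1 hT2 hac ha ha' hA hy hyx hvx hyt hF
    (ne_top_of_le_ne_top ENNReal.ofReal_ne_top (iter_sq_le hFL hF (Ioo x1 x2)))
    (w := fun x => ∫ ξ in x1..x, 1 / a ξ * q ξ) ?_ ?_ hend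
  · exact (intervalIntegral.continuous_primitive (fun A B => h_itg.intervalIntegrable A B) x1).continuousOn
  intro η hη
  obtain ⟨B, hB0, hB⟩ : ∃ B, 0 < B ∧ ∀ ξ ∈ Icc x1 x2, 1 / a ξ ≤ B := by
    obtain ⟨B, hB⟩ := isCompact_Icc.bddAbove_image (K := Icc x1 x2) hainv.continuousOn
    refine ⟨max B 1, by positivity, fun ξ hξ => (hB (mem_image_of_mem _ hξ)).trans (le_max_left _ _)⟩
  have hL : 0 < x2 - x1 := by linarith
  obtain ⟨η', hη', hη'2⟩ : ∃ η', 0 < η' ∧ B * (2 * η') * (x2 - x1) = η :=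
    ⟨η / (B * 2 * (x2 - x1)), by positivity, by field_simp⟩
  obtain ⟨lam, hlam, hlam2⟩ : ∃ lam, 0 < lam ∧ lam * ((x2 - x1) * (ts + k - ts)) = η' :=
    ⟨η' / ((x2 - x1) * k), by positivity, by
      have : ts + k - ts = k := by ring
      rw [this]; field_simp⟩
  obtain ⟨g, hgc, hgL, hge⟩ := l2_approx hFL (ε := min η (lam * η')) (by positivity)
  have hgm : Continuous fun p : ℝ × ℝ => g (p.1, p.2) := hgc
  have hgi : Continuous fun r => ∫ s in ts..(ts + k), g (r, s) :=
    intervalIntegral.continuous_parametric_intervalIntegral_of_continuous'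
      (f := fun r s => g (r, s)) hgm ts (ts + k)
  have hκf : Continuous fun r => y r (ts + k) - y r ts - ∫ s in ts..(ts + k), g (r, s) := hγ.sub hgi
  obtain ⟨p, hp⟩ : ∃ p : ℝ → ℝ, ∀ ξ, p ξ = ∫ r in x1..ξ,
        (y r (ts + k) - y r ts - ∫ s in ts..(ts + k), g (r, s)) := ⟨_, fun _ => rfl⟩
  have hpd : ∀ x, HasDerivAt p (y x (ts + k) - y x ts - ∫ s in ts..(ts + k), g (x, s)) x := by
    intro x
    have := intervalIntegral.integral_hasDerivAt_right (hκf.intervalIntegrable x1 x)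
      (hκf.stronglyMeasurableAtFilter _ _) hκf.continuousAt
    rwa [← funext hp] at this
  have hpc : Continuous p := continuous_iff_continuousAt.2 fun x => (hpd x).continuousAt
  have hpa : Continuous fun ξ => p ξ / a ξ := hpc.div hac fun ξ => (ha ξ).ne'
  refine ⟨fun x s => g (x, s), fun x => ∫ ξ in x1..x, p ξ / a ξ, p, hgm, ?_, hpd, ?_, ?_⟩
  · intro x
    exact intervalIntegral.integral_hasDerivAt_right (hpa.intervalIntegrable x1 x)
      (hpa.stronglyMeasurableAtFilter _ _) hpa.continuousAt
  · intro x hx'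
    have hd := hFL.sub hgL
    have hpq : ∀ ξ ∈ Icc x1 x2, |p ξ - q ξ| ≤ 2 * η' := by
      intro ξ hξ
      have e : q ξ - p ξ = - ∫ r in x1..ξ, ∫ s in ts..(ts + k), (F r s - g (r, s)) := by
        have e2 : ∫ r in x1..ξ, ∫ s in ts..(ts + k), (F r s - g (r, s)) =
            ∫ r in x1..ξ, ((∫ s in ts..(ts + k), F r s) - ∫ s in ts..(ts + k), g (r, s)) := by
          rw [intervalIntegral.integral_of_le hξ.1, intervalIntegral.integral_of_le hξ.1]
          refine integral_congr_ae ?_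
          filter_upwards [(rect_int hFL x1 ξ ts (ts + k)).prod_right_ae,
            (rect_int hgL x1 ξ ts (ts + k)).prod_right_ae] with r h1 h2
          rw [← intervalIntegral.integral_sub]
          · rwa [intervalIntegrable_iff_integrableOn_Ioc_of_le hkle]
          · rwa [intervalIntegrable_iff_integrableOn_Ioc_of_le hkle]
        rw [e2, hq, hp, ← intervalIntegral.integral_sub (hκ _ _) (hκf.intervalIntegrable _ _),
          ← intervalIntegral.integral_neg]
        exact intervalIntegral.integral_congr fun r _ => by ring
      rw [abs_sub_comm, e, abs_neg]
      have hD := rect_inner hd hkle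
      have m1 : |∫ r in x1..ξ, ∫ s in ts..(ts + k), (F r s - g (r, s))| ≤
          ∫ r in x1..ξ, |∫ s in ts..(ts + k), (F r s - g (r, s))| :=
        intervalIntegral.abs_integral_le_integral_abs hξ.1
      have m2 : ∫ r in x1..ξ, |∫ s in ts..(ts + k), (F r s - g (r, s))| ≤
          ∫ r in x1..x2, |∫ s in ts..(ts + k), (F r s - g (r, s))| :=
        intervalIntegral.integral_mono_interval le_rfl hξ.1 hξ.2
          (Filter.Eventually.of_forall fun r => abs_nonneg _) (hD x1 x2).abs
      have m3 := rect_bound hd hx.le hkle hlam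
      have m4 : (∫ p : ℝ × ℝ, (F p.1 p.2 - g p) ^ 2) / lam ≤ η' := by
        rw [div_le_iff₀ hlam, mul_comm]
        exact hge.trans (min_le_right _ _)
      rw [hlam2] at m3
      simp only [Pi.sub_apply] at m3
      linarith
    show |(∫ ξ in x1..x, p ξ / a ξ) - ∫ ξ in x1..x, 1 / a ξ * q ξ| ≤ η
    rw [← intervalIntegral.integral_sub (hpa.intervalIntegrable _ _) (h_itg.intervalIntegrable _ _)]
    have := intervalIntegral.norm_integral_le_of_norm_le_const (a := x1) (b := x)
      (f := fun ξ => p ξ / a ξ - 1 / a ξ * q ξ) (C := B * (2 * η')) (fun ξ hξ => by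
        rw [uIoc_of_le hx'.1] at hξ
        have hξ' : ξ ∈ Icc x1 x2 := ⟨hξ.1.le, hξ.2.trans hx'.2⟩
        have e : p ξ / a ξ - 1 / a ξ * q ξ = 1 / a ξ * (p ξ - q ξ) := by ring
        have h0 : 0 ≤ 1 / a ξ := by have := ha ξ; positivity
        rw [e, Real.norm_eq_abs, abs_mul, abs_of_nonneg h0]
        exact mul_le_mul (hB ξ hξ') (hpq ξ hξ') (abs_nonneg _) hB0.le)
    rw [Real.norm_eq_abs] at this
    refine this.trans ?_
    rw [← hη'2, abs_of_nonneg (by linarith [hx'.1])]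
    have : 0 ≤ B * (2 * η') := by positivity
    exact mul_le_mul_of_nonneg_left (by linarith [hx'.2]) this
  · refine (iter_sq_le (hFL.sub hgL) (hF.sub hgc.measurable) _).trans ?_
    exact ENNReal.ofReal_le_ofReal (hge.trans (min_le_left _ _))

set_option maxHeartbeats 1000000 in
lemma core_eq {x1 x2 T1 T2 ts k A : ℝ} (hx : x1 < x2) (hk : 0 < k)
    (hT1 : T1 < ts) (hT2 : ts + k < T2) {a a' : ℝ → ℝ} (hac : Continuous a) (ha : ∀ w, 0 < a w)
    (ha' : ∀ x ∈ Ioo x1 x2, HasDerivAt a (a' x) x) (hA : ∀ x ∈ Ioo x1 x2, |a' x| ≤ A)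
    {y yx v F : ℝ → ℝ → ℝ} (hy : Continuous (fun p : ℝ × ℝ => y p.1 p.2))
    (hyx : ∀ x ∈ Ioo x1 x2, ∀ t ∈ Ioo T1 T2, HasDerivAt (fun w => y w t) (yx x t) x)
    (hvx : ∀ x ∈ Ioo x1 x2, ∀ t ∈ Ioo T1 T2, HasDerivAt (fun w => a w * yx w t) (v x t) x)
    (hyt : ∀ x ∈ Ioo x1 x2, ∀ t ∈ Ioo T1 T2, HasDerivAt (fun s => y x s) (v x t + F x t) t)
    (hF : Measurable (fun p : ℝ × ℝ => F p.1 p.2))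
    (hFL : MemLp (fun p : ℝ × ℝ => F p.1 p.2) 2 volume) :
    ∃ β : ℝ, ∀ x ∈ Icc x1 x2,
      (∫ s in ts..(ts + k), y x s) - (∫ s in ts..(ts + k), y x1 s) =
       ∫ ξ in x1..x, (1 / a ξ) * (β + ∫ r in x1..ξ,
        (y r (ts + k) - y r ts - ∫ s in ts..(ts + k), F r s)) := by
  have hkle : ts ≤ ts + k := by linarith
  have hγ : Continuous fun r => y r (ts + k) - y r ts := by
    exact (hy.comp (continuous_id.prodMk continuous_const)).sub
      (hy.comp (continuous_id.prodMk continuous_const))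
  have hκ : ∀ A B : ℝ, IntervalIntegrable
      (fun r => y r (ts + k) - y r ts - ∫ s in ts..(ts + k), F r s) volume A B := fun A B =>
    (hγ.intervalIntegrable A B).sub (rect_inner hFL hkle A B)
  have hainv : Continuous fun ξ => 1 / a ξ := continuous_const.div hac fun ξ => (ha ξ).ne'
  have hqc : Continuous (fun ξ => ∫ r in x1..ξ,
        (y r (ts + k) - y r ts - ∫ s in ts..(ts + k), F r s)) :=
    intervalIntegral.continuous_primitive hκ x1
  have h_itg := hainv.fun_mul hqc
  have hYp : 0 < ∫ ξ in x1..x2, 1 / a ξ :=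
    intervalIntegral.intervalIntegral_pos_of_pos (hainv.intervalIntegrable _ _)
      (fun ξ => by have := ha ξ; positivity) hx
  obtain ⟨β, hβ⟩ : ∃ β, (∫ s in ts..(ts + k), y x2 s) - (∫ ξ in x1..x2, (1 / a ξ) * ∫ r in x1..ξ,
        (y r (ts + k) - y r ts - ∫ s in ts..(ts + k), F r s)) - (∫ s in ts..(ts + k), y x1 s)
        - β * (∫ ξ in x1..x2, 1 / a ξ) = 0 := ⟨((∫ s in ts..(ts + k), y x2 s) - (∫ ξ in x1..x2, (1 / a ξ) * ∫ r in x1..ξ,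
        (y r (ts + k) - y r ts - ∫ s in ts..(ts + k), F r s)) - (∫ s in ts..(ts + k), y x1 s)) / (∫ ξ in x1..x2, 1 / a ξ), by
          rw [div_mul_cancel₀ _ hYp.ne']; ring⟩
  have h1 := core_le hx hk hT1 hT2 hac ha ha' hA hy hyx hvx hyt hF hFL
    (α := ∫ s in ts..(ts + k), y x1 s) (β := β) (by
      rintro x (rfl | rfl)
      · simp
      · exact hβ.le)
  have hneg : ∀ r, -y r (ts + k) - -y r ts - -(∫ s in ts..(ts + k), F r s) =
      -(y r (ts + k) - y r ts - ∫ s in ts..(ts + k), F r s) := fun r => by ring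
  have h2 := core_le hx hk hT1 hT2 hac ha ha' hA (y := fun x t => - y x t)
    (yx := fun x t => - yx x t) (v := fun x t => - v x t) (F := fun x t => - F x t) hy.neg
    (fun x hx t ht => (hyx x hx t ht).neg)
    (fun x hx t ht => by
      have := (hvx x hx t ht).fun_neg
      simpa using this)
    (fun x hx t ht => by
      have := (hyt x hx t ht).fun_neg
      simpa [add_comm] using this) hF.neg hFL.neg
    (α := -∫ s in ts..(ts + k), y x1 s) (β := -β) (by
      simp only [intervalIntegral.integral_neg, hneg, mul_neg]
      rintro x (rfl | rfl)
      · simp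
      · linarith)
  simp only [intervalIntegral.integral_neg, hneg, mul_neg] at h2
  refine ⟨β, fun x hx' => ?_⟩
  have e : (∫ ξ in x1..x, (1 / a ξ) * (β + ∫ r in x1..ξ,
        (y r (ts + k) - y r ts - ∫ s in ts..(ts + k), F r s))) =
      β * (∫ ξ in x1..x, 1 / a ξ) + ∫ ξ in x1..x, (1 / a ξ) * ∫ r in x1..ξ,
        (y r (ts + k) - y r ts - ∫ s in ts..(ts + k), F r s) := by
    rw [← intervalIntegral.integral_const_mul, ← intervalIntegral.integral_add
      ((hainv.const_mul _).intervalIntegrable _ _) (h_itg.intervalIntegrable _ _)]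
    exact intervalIntegral.integral_congr fun r _ => by ring
  rw [e]
  have a1 := h1 x hx'
  have a2 := h2 x hx'
  linarith

lemma prim_ae_eq {x1 x2 : ℝ} (hx : x1 ≤ x2) {u w : ℝ → ℝ} (hu : IntervalIntegrable u volume x1 x2)
    (hw : IntervalIntegrable w volume x1 x2)
    (h : ∀ x ∈ Icc x1 x2, ∫ r in x1..x, u r = ∫ r in x1..x, w r) :
    ∀ᵐ x, x ∈ Ioo x1 x2 → u x = w x := by
  filter_upwards [hu.ae_hasDerivAt_integral, hw.ae_hasDerivAt_integral] with x h1 h2 hxx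
  rw [uIcc_of_le hx] at h1 h2
  have a1 := h1 (Ioo_subset_Icc_self hxx) x1 (left_mem_Icc.2 hx)
  have a2 := h2 (Ioo_subset_Icc_self hxx) x1 (left_mem_Icc.2 hx)
  refine a1.unique (a2.congr_of_eventuallyEq ?_)
  filter_upwards [Ioo_mem_nhds hxx.1 hxx.2] with r hr
  exact h r (Ioo_subset_Icc_self hr)

lemma ibp_prim {x1 x2 β : ℝ} (hx : x1 ≤ x2) {g g' κ : ℝ → ℝ} (hg : ContinuousOn g (Icc x1 x2))
    (hgd : ∀ x ∈ Ioo x1 x2, HasDerivAt g (g' x) x) (hg' : IntervalIntegrable g' volume x1 x2)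
    (h1 : g x1 = 0) (h2 : g x2 = 0) (hκ : IntervalIntegrable κ volume x1 x2) :
    ∫ x in x1..x2, g x * κ x = - ∫ x in x1..x2, g' x * (β + ∫ r in x1..x, κ r) := by
  have m1 : x1 ∈ uIcc x1 x2 := left_mem_uIcc
  have hG : ∀ x ∈ Icc x1 x2, ∫ r in x1..x, g' r = g x := by
    intro x hx'
    rw [intervalIntegral.integral_eq_sub_of_hasDerivAt_of_le hx'.1
      (hg.mono (Icc_subset_Icc le_rfl hx'.2)) (fun r hr => hgd r ⟨hr.1, hr.2.trans_le hx'.2⟩)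
      (hg'.mono_set (by rw [uIcc_of_le hx'.1, uIcc_of_le hx]; exact Icc_subset_Icc le_rfl hx'.2)), h1,
      sub_zero]
  have key := (hg'.absolutelyContinuousOnInterval_intervalIntegral m1).integral_mul_deriv_eq_deriv_mul
    (hκ.absolutelyContinuousOnInterval_intervalIntegral m1)
  rw [hG x2 (right_mem_Icc.2 hx), hG x1 (left_mem_Icc.2 hx), h1, h2] at key
  have e1 : ∫ x in x1..x2, (∫ r in x1..x, g' r) * deriv (fun x => ∫ r in x1..x, κ r) x =
      ∫ x in x1..x2, g x * κ x := by
    refine intervalIntegral.integral_congr_ae ?_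
    filter_upwards [hκ.ae_hasDerivAt_integral] with x hx1 hx2
    rw [(hx1 (uIoc_subset_uIcc hx2) x1 m1).deriv, hG x (by
      have := uIoc_subset_uIcc hx2; rwa [uIcc_of_le hx] at this)]
  have e2 : ∫ x in x1..x2, deriv (fun x => ∫ r in x1..x, g' r) x * (∫ r in x1..x, κ r) =
      ∫ x in x1..x2, g' x * (∫ r in x1..x, κ r) := by
    refine intervalIntegral.integral_congr_ae ?_
    filter_upwards [hg'.ae_hasDerivAt_integral] with x hx1 hx2
    rw [(hx1 (uIoc_subset_uIcc hx2) x1 m1).deriv]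
  rw [e1, e2] at key
  have hPc : ContinuousOn (fun x => ∫ r in x1..x, κ r) (uIcc x1 x2) :=
    (intervalIntegral.continuousOn_primitive_interval' hκ m1)
  simp_rw [mul_add]
  rw [intervalIntegral.integral_add (hg'.mul_const _) (hg'.mul_continuousOn hPc),
    intervalIntegral.integral_mul_const, hG x2 (right_mem_Icc.2 hx), h2, key]
  simp

set_option maxHeartbeats 1000000 in
lemma core_weak {x1 x2 T1 T2 ts k A : ℝ} (hx : x1 < x2) (hk : 0 < k)
    (hT1 : T1 < ts) (hT2 : ts + k < T2) {a a' : ℝ → ℝ} (hac : Continuous a) (ha : ∀ w, 0 < a w)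
    (ha' : ∀ x ∈ Ioo x1 x2, HasDerivAt a (a' x) x) (hA : ∀ x ∈ Ioo x1 x2, |a' x| ≤ A)
    {y yx v F : ℝ → ℝ → ℝ} (hy : Continuous (fun p : ℝ × ℝ => y p.1 p.2))
    (hyx : ∀ x ∈ Ioo x1 x2, ∀ t ∈ Ioo T1 T2, HasDerivAt (fun w => y w t) (yx x t) x)
    (hvx : ∀ x ∈ Ioo x1 x2, ∀ t ∈ Ioo T1 T2, HasDerivAt (fun w => a w * yx w t) (v x t) x)
    (hyt : ∀ x ∈ Ioo x1 x2, ∀ t ∈ Ioo T1 T2, HasDerivAt (fun s => y x s) (v x t + F x t) t)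
    (hF : Measurable (fun p : ℝ × ℝ => F p.1 p.2))
    (hFL : MemLp (fun p : ℝ × ℝ => F p.1 p.2) 2 volume)
    (hyxL : MemLp (fun p : ℝ × ℝ => yx p.1 p.2) 2 volume)
    {g g' : ℝ → ℝ} (hg : ContinuousOn g (Icc x1 x2))
    (hgd : ∀ x ∈ Ioo x1 x2, HasDerivAt g (g' x) x) (hg' : IntervalIntegrable g' volume x1 x2)
    (h1 : g x1 = 0) (h2 : g x2 = 0) :
    ∫ x in x1..x2, g x * (y x (ts + k) - y x ts) = (∫ x in x1..x2, g x * ∫ s in ts..(ts + k), F x s)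
      - ∫ x in x1..x2, g' x * (a x * ∫ s in ts..(ts + k), yx x s) := by
  have hkle : ts ≤ ts + k := by linarith
  have hγ : Continuous fun r => y r (ts + k) - y r ts := by
    exact (hy.comp (continuous_id.prodMk continuous_const)).sub
      (hy.comp (continuous_id.prodMk continuous_const))
  have hκ : ∀ A B : ℝ, IntervalIntegrable
      (fun r => y r (ts + k) - y r ts - ∫ s in ts..(ts + k), F r s) volume A B := fun A B =>
    (hγ.intervalIntegrable A B).sub (rect_inner hFL hkle A B)
  have hainv : Continuous fun ξ => 1 / a ξ := continuous_const.div hac fun ξ => (ha ξ).ne'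
  have hqc : Continuous (fun ξ => ∫ r in x1..ξ,
        (y r (ts + k) - y r ts - ∫ s in ts..(ts + k), F r s)) :=
    intervalIntegral.continuous_primitive hκ x1
  obtain ⟨β, hβ⟩ := core_eq hx hk hT1 hT2 hac ha ha' hA hy hyx hvx hyt hF hFL
  have hQ : ∀ x ∈ Icc x1 x2, ∫ ξ in x1..x, ∫ s in ts..(ts + k), yx ξ s =
      ∫ ξ in x1..x, (1 / a ξ) * (β + ∫ r in x1..ξ,
        (y r (ts + k) - y r ts - ∫ s in ts..(ts + k), F r s)) := by
    intro x hx'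
    rw [← hβ x hx']
    have hyc : ∀ x, Continuous fun s => y x s := fun x => hy.comp (continuous_const.prodMk continuous_id)
    rw [← intervalIntegral.integral_sub ((hyc x).intervalIntegrable _ _)
      ((hyc x1).intervalIntegrable _ _), intervalIntegral.integral_of_le hx'.1]
    simp_rw [intervalIntegral.integral_of_le hkle]
    have hri := rect_int hyxL x1 x ts (ts + k)
    rw [integral_integral_swap hri]
    refine integral_congr_ae ?_
    filter_upwards [hri.prod_left_ae, ae_restrict_mem measurableSet_Ioc] with s hs hs2
    rw [← intervalIntegral.integral_of_le hx'.1]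
    refine intervalIntegral.integral_eq_sub_of_hasDerivAt_of_le (f := fun w => y w s) hx'.1
      (hy.comp (continuous_id.prodMk continuous_const)).continuousOn
      (fun r hr => hyx r ⟨hr.1, hr.2.trans_le hx'.2⟩ s ⟨hT1.trans hs2.1, hs2.2.trans_lt hT2⟩) ?_
    rw [intervalIntegrable_iff_integrableOn_Ioc_of_le hx'.1]
    exact hs
  have hae := prim_ae_eq hx.le (rect_inner hyxL hkle x1 x2)
    ((hainv.mul (continuous_const.add hqc)).intervalIntegrable _ _) hQ
  have key := ibp_prim hx.le (β := β) hg hgd hg' h1 h2 (hκ x1 x2)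
  have e1 : ∫ x in x1..x2, g' x * (a x * ∫ s in ts..(ts + k), yx x s) =
      ∫ x in x1..x2, g' x * (β + ∫ r in x1..x,
        (y r (ts + k) - y r ts - ∫ s in ts..(ts + k), F r s)) := by
    refine intervalIntegral.integral_congr_ae ?_
    have hne : ∀ᵐ x : ℝ, x ≠ x2 := by
      simp [ae_iff]
    filter_upwards [hae, hne] with x hx1 hx2 hx3
    rw [uIoc_of_le hx.le] at hx3
    have := hx1 ⟨hx3.1, lt_of_le_of_ne hx3.2 hx2⟩
    rw [this, Pi.mul_apply]
    have := (ha x).ne'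
    field_simp
    rfl
  rw [e1]
  have hgu : ContinuousOn g (uIcc x1 x2) := by rwa [uIcc_of_le hx.le]
  have e2 : ∫ x in x1..x2, g x * (y x (ts + k) - y x ts - ∫ s in ts..(ts + k), F x s) =
      (∫ x in x1..x2, g x * (y x (ts + k) - y x ts)) -
        ∫ x in x1..x2, g x * ∫ s in ts..(ts + k), F x s := by
    rw [← intervalIntegral.integral_sub ((hγ.intervalIntegrable x1 x2).continuousOn_mul hgu)
      ((rect_inner hFL hkle x1 x2).continuousOn_mul hgu)]
    exact intervalIntegral.integral_congr fun r _ => by simp only; ring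
  rw [e2] at key
  linarith

lemma shift_cont {h f : ℝ × ℝ → ℝ} (hh : MemLp h 2 volume) (hf : MemLp f 2 volume) :
    Continuous fun σ : ℝ => ∫ p : ℝ × ℝ, h p * f (p.1, p.2 - σ) := by
  have hc : Continuous fun σ : ℝ => inner ℝ (hf.toLp f) (hh.toLp h) := continuous_const
  have hc2 : Continuous fun σ : ℝ =>
      inner ℝ ((DomAddAct.mk ((0, -σ) : ℝ × ℝ)) +ᵥ (hf.toLp f)) (hh.toLp h) := by
    refine Continuous.inner ?_ continuous_const
    have : Fact ((2:ENNReal) ≠ ⊤) := ⟨by simp⟩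
    have : Continuous fun σ : ℝ => DomAddAct.mk ((0, -σ) : ℝ × ℝ) :=
      DomAddAct.continuous_mk.comp (continuous_const.prodMk continuous_neg)
    exact this.vadd continuous_const
  refine hc2.congr fun σ => ?_
  rw [DomAddAct.mk_vadd_toLp, L2.inner_def]
  refine integral_congr_ae ?_
  filter_upwards [MemLp.coeFn_toLp hh, MemLp.coeFn_toLp
    (hf.comp_measurePreserving (measurePreserving_vadd ((0, -σ) : ℝ × ℝ) (volume : Measure (ℝ × ℝ))))] with p h1 h2
  have h2' := h2
  simp only [Function.comp_def] at h2'
  rw [h1, h2']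
  simp only [RCLike.inner_apply, conj_trivial, vadd_eq_add]
  congr 2
  ext <;> simp; ring

lemma shift_fubini {h f : ℝ × ℝ → ℝ} (hh : MemLp h 2 volume) (hf : MemLp f 2 volume)
    (hhm : Measurable h) (hfm : Measurable f) {k : ℝ} (hk : 0 ≤ k) :
    Integrable (fun p : ℝ × ℝ => h p * ∫ s in (p.2 - k)..p.2, f (p.1, s)) ∧
    ∫ σ in (0:ℝ)..k, (∫ p : ℝ × ℝ, h p * f (p.1, p.2 - σ)) =
      ∫ p : ℝ × ℝ, h p * ∫ s in (p.2 - k)..p.2, f (p.1, s) := by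
  have hmp : ∀ σ : ℝ, MeasurePreserving (fun p : ℝ × ℝ => (p.1, p.2 - σ)) := by
    intro σ
    have := measurePreserving_sub_right (volume : Measure (ℝ × ℝ)) ((0, σ) : ℝ × ℝ)
    refine this.congr (by fun_prop) ?_
    exact Filter.Eventually.of_forall fun p => by ext <;> simp
  have hfs : ∀ σ : ℝ, MemLp (fun p : ℝ × ℝ => f (p.1, p.2 - σ)) 2 volume := fun σ =>
    hf.comp_measurePreserving (hmp σ)
  have hI : Integrable (fun q : ℝ × (ℝ × ℝ) => h q.2 * f (q.2.1, q.2.2 - q.1))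
      ((volume.restrict (Ioc 0 k)).prod volume) := by
    have hms : AEStronglyMeasurable (fun q : ℝ × (ℝ × ℝ) => h q.2 * f (q.2.1, q.2.2 - q.1))
      ((volume.restrict (Ioc 0 k)).prod volume) := by
      apply Measurable.aestronglyMeasurable
      fun_prop
    rw [integrable_prod_iff hms]
    constructor
    · exact Filter.Eventually.of_forall fun σ => hh.integrable_mul (hfs σ)
    · refine Integrable.mono' (g := fun _ => (∫ p, h p ^ 2) + ∫ p, f p ^ 2)
        (integrable_const _) hms.norm.integral_prod_right' (Filter.Eventually.of_forall fun σ => ?_)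
      rw [Real.norm_of_nonneg (integral_nonneg fun p => norm_nonneg _)]
      have e : ∫ p : ℝ × ℝ, f p ^ 2 = ∫ p : ℝ × ℝ, f (p.1, p.2 - σ) ^ 2 := by
        have hemb : MeasurableEmbedding (fun p : ℝ × ℝ => (p.1, p.2 - σ)) := by
          have := (MeasurableEquiv.subRight ((0, σ) : ℝ × ℝ)).measurableEmbedding
          convert this using 1
          ext p
          · change p.1 = p.1 - 0
            simp
          · rfl
        exact ((hmp σ).integral_comp hemb (fun p => f p ^ 2)).symm
      rw [e, ← integral_add hh.integrable_sq (hfs σ).integrable_sq]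
      refine integral_mono_of_nonneg (Filter.Eventually.of_forall fun p => norm_nonneg _)
        (hh.integrable_sq.add (hfs σ).integrable_sq) (Filter.Eventually.of_forall fun p => ?_)
      simp only [norm_mul, Real.norm_eq_abs]
      nlinarith [sq_nonneg (|h p| - |f (p.1, p.2 - σ)|), sq_abs (h p), sq_abs (f (p.1, p.2 - σ)),
        sq_nonneg (h p), sq_nonneg (f (p.1, p.2 - σ))]
  have e : ∀ p : ℝ × ℝ, ∫ σ in Ioc 0 k, h p * f (p.1, p.2 - σ) =
      h p * ∫ s in (p.2 - k)..p.2, f (p.1, s) := by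
    intro p
    rw [integral_const_mul, ← intervalIntegral.integral_of_le hk,
      intervalIntegral.integral_comp_sub_left (fun s => f (p.1, s))]
    simp
  constructor
  · refine hI.integral_prod_right.congr (Filter.Eventually.of_forall fun p => e p)
  · rw [intervalIntegral.integral_of_le hk, integral_integral_swap hI]
    exact integral_congr_ae (Filter.Eventually.of_forall fun p => e p)

lemma memLp_cut {S : Set (ℝ × ℝ)} (hS : MeasurableSet S) {K : Set (ℝ × ℝ)} (hK : IsCompact K)
    (hSK : S ⊆ K) {u : ℝ × ℝ → ℝ} (hu : Continuous u) {f : ℝ × ℝ → ℝ} (hf : MemLp f 2 volume) :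
    MemLp (S.indicator fun p => u p * f p) 2 volume := by
  obtain ⟨C, hC⟩ := hK.exists_bound_of_continuousOn hu.continuousOn
  refine MemLp.of_le_mul (c := max C 0) hf
    ((hu.aestronglyMeasurable.mul hf.1).indicator hS) (Filter.Eventually.of_forall fun p => ?_)
  by_cases hp : p ∈ S
  · rw [indicator_of_mem hp, norm_mul]
    exact mul_le_mul_of_nonneg_right ((hC p (hSK hp)).trans (le_max_left _ _)) (norm_nonneg _)
  · rw [indicator_of_notMem hp, norm_zero]
    positivity

lemma nonpos_of_prim {e : ℝ → ℝ} (he : Continuous e) {k0 : ℝ} (hk0 : 0 < k0)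
    (h : ∀ k, 0 < k → k < k0 → ∫ σ in (0:ℝ)..k, e σ ≤ 0) : e 0 ≤ 0 := by
  by_contra hc
  push Not at hc
  have : ∀ᶠ σ in nhds (0:ℝ), 0 < e σ := he.continuousAt.eventually (lt_mem_nhds hc)
  obtain ⟨d, hd, hdd⟩ := Metric.eventually_nhds_iff.1 this
  have hm : 0 < min d k0 / 2 := by positivity
  have h1 := h (min d k0 / 2) hm (by linarith [min_le_right d k0])
  have h2 : 0 < ∫ σ in (0:ℝ)..(min d k0 / 2), e σ := by
    refine intervalIntegral.intervalIntegral_pos_of_pos_on (he.intervalIntegrable _ _) ?_ hm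
    intro x hx
    refine hdd ?_
    rw [Real.dist_eq, sub_zero, abs_of_pos hx.1]
    linarith [hx.2, min_le_left d k0]
  linarith

set_option maxHeartbeats 2000000 in
lemma local_energy {x1 x2 T1 T2 s1 s2 A : ℝ} (hx : x1 < x2)
    (hT1 : T1 < s1) (hs : s1 ≤ s2) (hT2 : s2 < T2) {a a' : ℝ → ℝ} (hac : Continuous a)
    (ha : ∀ w, 0 < a w)
    (ha' : ∀ x ∈ Ioo x1 x2, HasDerivAt a (a' x) x) (hA : ∀ x ∈ Ioo x1 x2, |a' x| ≤ A)
    {y yx v F : ℝ → ℝ → ℝ} (hy : Continuous (fun p : ℝ × ℝ => y p.1 p.2))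
    (hyx : ∀ x ∈ Ioo x1 x2, ∀ t ∈ Ioo T1 T2, HasDerivAt (fun w => y w t) (yx x t) x)
    (hvx : ∀ x ∈ Ioo x1 x2, ∀ t ∈ Ioo T1 T2, HasDerivAt (fun w => a w * yx w t) (v x t) x)
    (hyt : ∀ x ∈ Ioo x1 x2, ∀ t ∈ Ioo T1 T2, HasDerivAt (fun s => y x s) (v x t + F x t) t)
    (hF : Measurable (fun p : ℝ × ℝ => F p.1 p.2))
    (hFL : MemLp (fun p : ℝ × ℝ => F p.1 p.2) 2 volume)
    (hyxm : Measurable (fun p : ℝ × ℝ => yx p.1 p.2))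
    (hyxL : MemLp (fun p : ℝ × ℝ => yx p.1 p.2) 2 volume)
    {ψ ψ' Φ P R : ℝ → ℝ} (hψc : ContinuousOn ψ univ) (hψ'c : Continuous ψ')
    (hψd : ∀ x, HasDerivAt ψ (ψ' x) x) (hψ0 : ∀ x, 0 ≤ ψ x) (hψ1 : ψ x1 = 0) (hψ2 : ψ x2 = 0)
    (hΦc : Continuous Φ) (hPc : Continuous P) (hRc : Continuous R)
    (hPd : ∀ r, HasDerivAt P (R r) r) (hconv : ∀ u w, Φ u - Φ w ≤ P u * (u - w)) :
    (∫ x in x1..x2, ψ x * Φ (y x s2)) - (∫ x in x1..x2, ψ x * Φ (y x s1)) ≤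
      (∫ p in Ioc x1 x2 ×ˢ Ioc s1 s2, ψ p.1 * P (y p.1 p.2) * F p.1 p.2) -
      ∫ p in Ioc x1 x2 ×ˢ Ioc s1 s2, (ψ' p.1 * P (y p.1 p.2) +
        ψ p.1 * R (y p.1 p.2) * yx p.1 p.2) * a p.1 * yx p.1 p.2 := by
  have hψ : Continuous ψ := continuousOn_univ.1 hψc
  obtain ⟨S, hSd⟩ : ∃ S : Set (ℝ × ℝ), S = Ioc x1 x2 ×ˢ Ioc s1 s2 := ⟨_, rfl⟩
  have hSm : MeasurableSet S := hSd ▸ measurableSet_Ioc.prod measurableSet_Ioc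
  have hK : IsCompact (Icc x1 x2 ×ˢ Icc s1 s2) := isCompact_Icc.prod isCompact_Icc
  have hSK : S ⊆ Icc x1 x2 ×ˢ Icc s1 s2 := hSd ▸ prod_mono Ioc_subset_Icc_self Ioc_subset_Icc_self
  obtain ⟨f1, hf1⟩ : ∃ f1 : ℝ × ℝ → ℝ, ∀ p, f1 p = F p.1 p.2 := ⟨_, fun _ => rfl⟩
  obtain ⟨f2, hf2⟩ : ∃ f2 : ℝ × ℝ → ℝ, ∀ p, f2 p = yx p.1 p.2 := ⟨_, fun _ => rfl⟩
  obtain ⟨h1, hh1⟩ : ∃ h1 : ℝ × ℝ → ℝ, ∀ p, h1 p = S.indicator (fun p => ψ p.1 * P (y p.1 p.2)) p :=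
    ⟨_, fun _ => rfl⟩
  obtain ⟨h2, hh2⟩ : ∃ h2 : ℝ × ℝ → ℝ, ∀ p, h2 p = S.indicator (fun p => (ψ' p.1 * P (y p.1 p.2) +
        ψ p.1 * R (y p.1 p.2) * yx p.1 p.2) * a p.1) p := ⟨_, fun _ => rfl⟩
  have hu1 : Continuous fun p : ℝ × ℝ => ψ p.1 * P (y p.1 p.2) :=
    (hψ.comp continuous_fst).mul (hPc.comp hy)
  have hu2 : Continuous fun p : ℝ × ℝ => ψ' p.1 * P (y p.1 p.2) * a p.1 :=
    ((hψ'c.comp continuous_fst).mul (hPc.comp hy)).mul (hac.comp continuous_fst)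
  have hu3 : Continuous fun p : ℝ × ℝ => ψ p.1 * R (y p.1 p.2) * a p.1 :=
    ((hψ.comp continuous_fst).mul (hRc.comp hy)).mul (hac.comp continuous_fst)
  have hF1m : Measurable f1 := by rw [funext hf1]; exact hF
  have hF2m : Measurable f2 := by rw [funext hf2]; exact hyxm
  have hF1L : MemLp f1 2 volume := by rw [funext hf1]; exact hFL
  have hF2L : MemLp f2 2 volume := by rw [funext hf2]; exact hyxL
  have hone : MemLp (S.indicator fun _ => (1:ℝ)) 2 volume :=
    memLp_indicator_const 2 hSm 1 (Or.inr ((measure_mono hSK).trans_lt hK.measure_lt_top).ne)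
  have cut1 : ∀ u : ℝ × ℝ → ℝ, Continuous u → MemLp (S.indicator u) 2 volume := by
    intro u hu
    have := memLp_cut hSm hK hSK hu hone
    convert this using 1
    ext p
    by_cases hp : p ∈ S <;> simp [hp]
  have hh1L : MemLp h1 2 volume := by rw [funext hh1]; exact cut1 _ hu1
  have hh1m : Measurable h1 := by rw [funext hh1]; exact hu1.measurable.indicator hSm
  have hh2L : MemLp h2 2 volume := by
    have := (cut1 _ hu2).add (memLp_cut hSm hK hSK hu3 hF2L)
    convert this using 1
    ext p
    rw [hh2]
    by_cases hp : p ∈ S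
    · simp only [hp, indicator_of_mem, Pi.add_apply, hf2]; ring
    · simp [hp]
  have hh2m : Measurable h2 := by
    rw [funext hh2]
    refine Measurable.indicator ?_ hSm
    have : (fun p : ℝ × ℝ => (ψ' p.1 * P (y p.1 p.2) +
        ψ p.1 * R (y p.1 p.2) * yx p.1 p.2) * a p.1) = fun p => ψ' p.1 * P (y p.1 p.2) * a p.1 +
        ψ p.1 * R (y p.1 p.2) * a p.1 * yx p.1 p.2 := by ext p; ring
    rw [this]
    exact hu2.measurable.add (hu3.measurable.mul hyxm)
  have hE : Continuous fun t => ∫ x in x1..x2, ψ x * Φ (y x t) := by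
    refine intervalIntegral.continuous_parametric_intervalIntegral_of_continuous'
      (f := fun t x => ψ x * Φ (y x t)) ?_ x1 x2
    exact (hψ.comp continuous_snd).mul (hΦc.comp (hy.comp (continuous_snd.prodMk continuous_fst)))
  obtain ⟨E, hEd⟩ : ∃ E : ℝ → ℝ, ∀ t, E t = ∫ x in x1..x2, ψ x * Φ (y x t) := ⟨_, fun _ => rfl⟩
  rw [← funext hEd] at hE
  have hc1 := shift_cont hh1L hF1L
  have hc2 := shift_cont hh2L hF2L
  have key := nonpos_of_prim (e := fun σ => (E (s2 - σ) - E (s1 - σ)) -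
    ((∫ p : ℝ × ℝ, h1 p * f1 (p.1, p.2 - σ)) - ∫ p : ℝ × ℝ, h2 p * f2 (p.1, p.2 - σ)))
    (((hE.comp (continuous_const.sub continuous_id)).sub
      (hE.comp (continuous_const.sub continuous_id))).sub (hc1.sub hc2))
    (k0 := s1 - T1) (by linarith) ?_
  · simp only [sub_zero, hEd, Prod.mk.eta] at key
    have e1 : ∫ p, h1 p * f1 p = ∫ p in S, ψ p.1 * P (y p.1 p.2) * F p.1 p.2 := by
      rw [← integral_indicator hSm]
      congr 1
      ext p
      by_cases hp : p ∈ S <;> simp [hp, hh1, hf1]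
    have e2 : ∫ p, h2 p * f2 p = ∫ p in S, (ψ' p.1 * P (y p.1 p.2) +
        ψ p.1 * R (y p.1 p.2) * yx p.1 p.2) * a p.1 * yx p.1 p.2 := by
      rw [← integral_indicator hSm]
      congr 1
      ext p
      by_cases hp : p ∈ S <;> simp [hp, hh2, hf2]
    rw [e1, e2] at key
    rw [← hSd]
    linarith
  intro k hk hk2
  obtain ⟨hi1, hi1e⟩ := shift_fubini hh1L hF1L hh1m hF1m hk.le
  obtain ⟨hi2, hi2e⟩ := shift_fubini hh2L hF2L hh2m hF2m hk.le
  have hEs : ∀ r : ℝ, Continuous fun σ => E (r - σ) := fun r =>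
    hE.comp (continuous_const.sub continuous_id)
  rw [intervalIntegral.integral_sub (((hEs s2).fun_sub (hEs s1)).intervalIntegrable _ _)
      ((hc1.fun_sub hc2).intervalIntegrable _ _),
    intervalIntegral.integral_sub (hc1.intervalIntegrable _ _) (hc2.intervalIntegrable _ _), hi1e, hi2e,
    intervalIntegral.integral_sub ((hEs s2).intervalIntegrable _ _) ((hEs s1).intervalIntegrable _ _),
    ← integral_sub hi1 hi2]
  have hi3 : Integrable (fun p : ℝ × ℝ => h1 p * (∫ s in (p.2 - k)..p.2, f1 (p.1, s)) -
      h2 p * ∫ s in (p.2 - k)..p.2, f2 (p.1, s)) (volume.prod volume) := hi1.sub hi2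
  rw [Measure.volume_eq_prod, integral_prod_symm _ hi3]
  have eE : (∫ σ in (0:ℝ)..k, E (s2 - σ)) - ∫ σ in (0:ℝ)..k, E (s1 - σ) =
      ∫ t, (Ioc s1 s2).indicator (fun t => E t - E (t - k)) t := by
    rw [integral_indicator measurableSet_Ioc, ← intervalIntegral.integral_of_le hs,
      intervalIntegral.integral_sub (hE.intervalIntegrable _ _)
      ((show Continuous fun t => E (t - k) from hE.comp (continuous_id.sub continuous_const)).intervalIntegrable _ _),
      intervalIntegral.integral_comp_sub_left, intervalIntegral.integral_comp_sub_left,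
      intervalIntegral.integral_comp_sub_right]
    simp only [sub_zero]
    rw [← intervalIntegral.integral_add_adjacent_intervals (hE.intervalIntegrable s1 (s2 - k)) (hE.intervalIntegrable (s2 - k) s2),
      ← intervalIntegral.integral_add_adjacent_intervals (hE.intervalIntegrable (s1 - k) s1) (hE.intervalIntegrable s1 (s2 - k))]
    ring
  rw [eE, sub_nonpos]
  refine integral_mono_ae ?_ hi3.integral_prod_right ?_
  · rw [integrable_indicator_iff measurableSet_Ioc,
      ← intervalIntegrable_iff_integrableOn_Ioc_of_le hs]
    exact (hE.sub (hE.comp (continuous_id.sub continuous_const))).intervalIntegrable _ _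
  have hae : ∀ᵐ t : ℝ, t ∈ Ioc s1 s2 → IntegrableOn (fun x => yx x t) (Ioc x1 x2) := by
    rw [← ae_restrict_iff' measurableSet_Ioc]
    exact (rect_int hyxL x1 x2 s1 s2).prod_left_ae
  filter_upwards [hae, hi1.prod_left_ae, hi2.prod_left_ae] with t ht hsl1 hsl2
  by_cases hts : t ∈ Ioc s1 s2
  swap
  · have : ∀ x, (x, t) ∉ S := fun x hx => by rw [hSd] at hx; exact hts hx.2
    simp [hts, hh1, hh2, this]
  have hyxi := ht hts
  have hySl : Continuous fun x => y x t := hy.comp (continuous_id.prodMk continuous_const)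
  rw [indicator_of_mem hts]
  have hg' : IntervalIntegrable (fun x => ψ' x * P (y x t) + ψ x * R (y x t) * yx x t) volume x1 x2 := by
    refine ((hψ'c.mul (hPc.comp hySl)).intervalIntegrable _ _).add ?_
    refine IntervalIntegrable.continuousOn_mul ?_ (hψ.mul (hRc.comp hySl)).continuousOn
    rwa [intervalIntegrable_iff_integrableOn_Ioc_of_le hx.le]
  have hcore := core_weak (ts := t - k) (k := k) (T1 := T1) (T2 := T2) hx hk (by linarith [hts.1])
    (by linarith [hts.2]) hac ha ha' hA hy hyx hvx hyt hF hFL hyxL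
    (g := fun x => ψ x * P (y x t)) (g' := fun x => ψ' x * P (y x t) + ψ x * R (y x t) * yx x t)
    (hψ.mul (hPc.comp hySl)).continuousOn
    (fun x hx' => by
      have := (hψd x).mul ((hPd (y x t)).comp x (hyx x hx' t ⟨by linarith [hts.1], by linarith [hts.2]⟩))
      refine this.congr_deriv ?_
      simp only [Function.comp]; ring) hg' (by simp [hψ1]) (by simp [hψ2])
  rw [sub_add_cancel] at hcore
  have hl : E t - E (t - k) ≤ ∫ x in x1..x2, ψ x * P (y x t) * (y x t - y x (t - k)) := by
    have hySl2 : Continuous fun x => y x (t - k) := hy.comp (continuous_id.prodMk continuous_const)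
    have i1 : Continuous fun x => ψ x * Φ (y x t) := hψ.mul (hΦc.comp hySl)
    have i2 : Continuous fun x => ψ x * Φ (y x (t - k)) := hψ.mul (hΦc.comp hySl2)
    have i3 : Continuous fun x => ψ x * P (y x t) * (y x t - y x (t - k)) :=
      (hψ.mul (hPc.comp hySl)).mul (hySl.sub hySl2)
    rw [hEd, hEd, ← intervalIntegral.integral_sub (i1.intervalIntegrable _ _) (i2.intervalIntegrable _ _)]
    refine intervalIntegral.integral_mono_on hx.le ((i1.sub i2).intervalIntegrable _ _)
      (i3.intervalIntegrable _ _) fun x _ => ?_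
    have := mul_le_mul_of_nonneg_left (hconv (y x t) (y x (t - k))) (hψ0 x)
    linarith
  refine hl.trans ?_
  rw [hcore]
  have c1 : ∫ x in x1..x2, ψ x * P (y x t) * ∫ s in (t - k)..t, F x s =
      ∫ x, h1 (x, t) * ∫ s in (t - k)..t, f1 (x, s) := by
    rw [intervalIntegral.integral_of_le hx.le, ← integral_indicator measurableSet_Ioc]
    congr 1
    ext x
    by_cases hxx : x ∈ Ioc x1 x2
    · have : (x, t) ∈ S := by rw [hSd]; exact ⟨hxx, hts⟩
      simp [hxx, hh1, this, hf1]
    · have : (x, t) ∉ S := by rw [hSd]; exact fun h => hxx h.1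
      simp [hxx, hh1, this]
  have c2 : ∫ x in x1..x2, (ψ' x * P (y x t) + ψ x * R (y x t) * yx x t) * (a x * ∫ s in (t - k)..t, yx x s) =
      ∫ x, h2 (x, t) * ∫ s in (t - k)..t, f2 (x, s) := by
    rw [intervalIntegral.integral_of_le hx.le, ← integral_indicator measurableSet_Ioc]
    congr 1
    ext x
    by_cases hxx : x ∈ Ioc x1 x2
    · have : (x, t) ∈ S := by rw [hSd]; exact ⟨hxx, hts⟩
      simp [hxx, hh2, this, hf2]; ring
    · have : (x, t) ∉ S := by rw [hSd]; exact fun h => hxx h.1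
      simp [hxx, hh2, this]
  rw [c1, c2, ← integral_sub hsl1 hsl2]

lemma flux_nonpos {a u ux : ℝ → ℝ} {x0 v r : ℝ} (hr : 0 < r) (ha0 : ∀ x, 0 ≤ a x) (hax : a x0 = 0)
    (had : HasDerivAt a 0 x0) (hu : ∀ x ∈ Ioo (x0 - r) (x0 + r), HasDerivAt u (ux x) x)
    (hv : HasDerivAt (fun x => a x * ux x) v x0) : v ≤ 0 := by
  by_contra hc
  push Not at hc
  obtain ⟨B, hB⟩ : ∃ B, B = |ux x0| + 1 := ⟨_, rfl⟩
  have hBp : 0 < B := by rw [hB]; positivity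
  -- near x0: a x ≤ η (x-x0), g ≥ v/2 (x-x0)
  obtain ⟨η, hη, hηB⟩ : ∃ η, 0 < η ∧ v / 2 = η * (2 * B) := ⟨v / 2 / (2 * B), by positivity, by field_simp⟩
  have e1 : ∀ᶠ x in nhds x0, |a x| ≤ η * |x - x0| := by
    have := (hasDerivAt_iff_isLittleO.1 had).def hη
    filter_upwards [this] with x hx
    simpa [hax] using hx
  have e2 : ∀ᶠ x in nhds x0, |a x * ux x - (x - x0) * v| ≤ v / 2 * |x - x0| := by
    have := (hasDerivAt_iff_isLittleO.1 hv).def (show 0 < v / 2 by positivity)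
    filter_upwards [this] with x hx
    simpa [hax] using hx
  have e3 : ∀ᶠ x in nhds x0, |u x - u x0 - (x - x0) * ux x0| ≤ 1 * |x - x0| := by
    have := (hasDerivAt_iff_isLittleO.1 (hu x0 ⟨by linarith, by linarith⟩)).def one_pos
    filter_upwards [this] with x hx
    simpa using hx
  obtain ⟨d, hd, hdd⟩ := Metric.eventually_nhds_iff.1 (e1.and (e2.and e3))
  obtain ⟨d', hd', hd1, hd2⟩ : ∃ d', 0 < d' ∧ d' < d ∧ d' < r :=
    ⟨min d r / 2, by positivity, by linarith [min_le_left d r], by linarith [min_le_right d r]⟩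
  have hux : ∀ x, x0 < x → x ≤ x0 + d' → 2 * B ≤ ux x := by
    intro x h1 h2
    have hp : 0 < x - x0 := by linarith
    obtain ⟨m1, m2, -⟩ := hdd (y := x) (by rw [Real.dist_eq, abs_of_pos hp]; linarith)
    rw [abs_of_pos hp] at m1 m2
    rw [abs_of_nonneg (ha0 x)] at m1
    have m3 : v / 2 * (x - x0) ≤ a x * ux x := by
      have := (abs_le.1 m2).1
      linarith
    by_contra hcc
    push Not at hcc
    have : a x * ux x < v / 2 * (x - x0) := by
      rcases (ha0 x).eq_or_lt with h | h
      · rw [← h]; simp; positivity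
      · calc a x * ux x < a x * (2 * B) := mul_lt_mul_of_pos_left hcc h
          _ ≤ η * (x - x0) * (2 * B) := by gcongr
          _ = v / 2 * (x - x0) := by rw [hηB]; ring
    linarith
  obtain ⟨ξ, hξ, hξe⟩ := exists_hasDerivAt_eq_slope u ux (show x0 < x0 + d' by linarith)
    (fun x hx => (hu x ⟨by linarith [hx.1], by linarith [hx.2]⟩).continuousAt.continuousWithinAt)
    (fun x hx => hu x ⟨by linarith [hx.1], by linarith [hx.2]⟩)
  have := hux ξ hξ.1 hξ.2.le
  rw [hξe] at this
  obtain ⟨-, -, m3⟩ := hdd (y := x0 + d') (by simp [abs_of_pos hd', hd1])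
  have e : x0 + d' - x0 = d' := by ring
  rw [e] at this m3
  rw [abs_of_pos hd'] at m3
  rw [le_div_iff₀ hd'] at this
  have m4 := (abs_le.1 m3).2
  have : ux x0 ≤ |ux x0| := le_abs_self _
  nlinarith

lemma flux_zero {a u ux : ℝ → ℝ} {x0 v r : ℝ} (hr : 0 < r) (ha0 : ∀ x, 0 ≤ a x) (hax : a x0 = 0)
    {d : ℝ} (had : HasDerivAt a d x0) (hu : ∀ x ∈ Ioo (x0 - r) (x0 + r), HasDerivAt u (ux x) x)
    (hv : HasDerivAt (fun x => a x * ux x) v x0) : v = 0 := by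
  have hd : d = 0 := by
    refine IsLocalMin.hasDerivAt_eq_zero (Filter.Eventually.of_forall fun x => ?_) had
    rw [hax]; exact ha0 x
  subst hd
  refine le_antisymm (flux_nonpos hr ha0 hax had hu hv) ?_
  have := flux_nonpos (u := fun x => - u x) (ux := fun x => - ux x) (v := -v) hr ha0 hax had
    (fun x hx => (hu x hx).fun_neg) (by
      have := hv.fun_neg
      simpa using this)
  linarith

lemma comp_Ioo {U : Set ℝ} (hU : IsOpen U) (hUs : U ⊆ Ioo 0 1) {x : ℝ} (hx : x ∈ U) :
    ∃ p q, p < q ∧ connectedComponentIn U x = Ioo p q ∧ Ioo p q ⊆ U ∧ p ∉ U ∧ q ∉ U ∧ 0 ≤ p ∧ q ≤ 1 := by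
  set C := connectedComponentIn U x with hC
  have hCo : IsOpen C := hU.connectedComponentIn
  have hxC : x ∈ C := mem_connectedComponentIn hx
  have hCU : C ⊆ U := connectedComponentIn_subset U x
  have hCp : IsPreconnected C := isPreconnected_connectedComponentIn
  have hb : BddBelow C := ⟨0, fun r hr => (hUs (hCU hr)).1.le⟩
  have ha : BddAbove C := ⟨1, fun r hr => (hUs (hCU hr)).2.le⟩
  have hp : ∀ r ∈ C, sInf C < r := by
    intro r hr
    obtain ⟨e, he, hball⟩ := Metric.isOpen_iff.1 hCo r hr
    have : r - e / 2 ∈ C := hball (by simp [abs_of_pos he]; linarith)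
    linarith [csInf_le hb this]
  have hq : ∀ r ∈ C, r < sSup C := by
    intro r hr
    obtain ⟨e, he, hball⟩ := Metric.isOpen_iff.1 hCo r hr
    have : r + e / 2 ∈ C := hball (by simp [abs_of_pos he]; linarith)
    linarith [le_csSup ha this]
  have hCeq : C = Ioo (sInf C) (sSup C) := by
    apply Subset.antisymm
    · exact fun r hr => ⟨hp r hr, hq r hr⟩
    · exact IsConnected.Ioo_csInf_csSup_subset ⟨⟨x, hxC⟩, hCp⟩ hb ha
  refine ⟨sInf C, sSup C, (hp x hxC).trans (hq x hxC), hCeq, hCeq ▸ hCU, ?_, ?_, ?_, ?_⟩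
  · intro hpU
    have h1 : Ico (sInf C) (sSup C) ⊆ C := by
      refine isPreconnected_Ico.subset_connectedComponentIn ⟨(hp x hxC).le, hq x hxC⟩ ?_
      intro r hr
      rcases hr.1.eq_or_lt with h | h
      · rwa [← h]
      · exact hCU (hCeq ▸ ⟨h, hr.2⟩)
    exact lt_irrefl _ (hp _ (h1 ⟨le_rfl, (hp x hxC).trans (hq x hxC)⟩))
  · intro hqU
    have h1 : Ioc (sInf C) (sSup C) ⊆ C := by
      refine isPreconnected_Ioc.subset_connectedComponentIn ⟨(hp x hxC), (hq x hxC).le⟩ ?_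
      intro r hr
      rcases hr.2.eq_or_lt with h | h
      · rwa [h]
      · exact hCU (hCeq ▸ ⟨hr.1, h⟩)
    exact lt_irrefl _ (hq _ (h1 ⟨(hp x hxC).trans (hq x hxC), le_rfl⟩))
  · exact le_csInf ⟨x, hxC⟩ fun r hr => (hUs (hCU hr)).1.le
  · exact csSup_le ⟨x, hxC⟩ fun r hr => (hUs (hCU hr)).2.le

lemma sum_comp {U : Set ℝ} (hU : IsOpen U) (hUs : U ⊆ Ioo 0 1) {D : ℝ → ℝ} (hD : IntegrableOn D U)
    (h : ∀ p q, p < q → Ioo p q ⊆ U → p ∉ U → q ∉ U → 0 ≤ p → q ≤ 1 → ∫ x in Ioo p q, D x ≤ 0) :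
    ∫ x in U, D x ≤ 0 := by
  obtain ⟨S, hS⟩ : ∃ S : Set (Set ℝ), ∀ c, c ∈ S ↔ ∃ x ∈ U, connectedComponentIn U x = c :=
    ⟨(fun x => connectedComponentIn U x) '' U, fun c => Iff.rfl⟩
  have hdisj : S.PairwiseDisjoint id := by
    intro c hc c' hc' hne
    obtain ⟨x, hx, rfl⟩ := (hS c).1 hc
    obtain ⟨z, hz, rfl⟩ := (hS c').1 hc'
    simp only [id, Function.onFun]
    by_contra hcon
    obtain ⟨r, hr1, hr2⟩ := Set.not_disjoint_iff.1 hcon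
    exact hne ((connectedComponentIn_eq hr1).trans (connectedComponentIn_eq hr2).symm)
  have hcount : S.Countable := by
    refine hdisj.countable_of_isOpen ?_ ?_
    · intro c hc
      obtain ⟨x, hx, rfl⟩ := (hS c).1 hc
      exact hU.connectedComponentIn
    · intro c hc
      obtain ⟨x, hx, rfl⟩ := (hS c).1 hc
      exact ⟨x, mem_connectedComponentIn hx⟩
  have hUe : U = ⋃ c ∈ S, c := by
    apply Subset.antisymm
    · intro x hx
      exact mem_biUnion ((hS _).2 ⟨x, hx, rfl⟩) (mem_connectedComponentIn hx)
    · refine iUnion₂_subset ?_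
      intro c hc
      obtain ⟨x, hx, rfl⟩ := (hS c).1 hc
      exact connectedComponentIn_subset U x
  have hm : ∀ c ∈ S, MeasurableSet c := by
    intro c hc
    obtain ⟨x, hx, rfl⟩ := (hS c).1 hc
    exact hU.connectedComponentIn.measurableSet
  have hcs : Countable S := hcount.to_subtype
  have hUe2 : U = ⋃ c : S, (c : Set ℝ) := by
    rw [hUe, biUnion_eq_iUnion]
  have hpd : Pairwise (Function.onFun Disjoint fun c : S => (c : Set ℝ)) := by
    intro c d hcd
    have : (c : Set ℝ) ≠ d := fun h => hcd (Subtype.ext h)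
    exact hdisj c.2 d.2 this
  have hmm : ∀ c : S, MeasurableSet (c : Set ℝ) := fun c => hm c.1 c.2
  have hD2 : IntegrableOn D (⋃ c : S, (c : Set ℝ)) := hUe2 ▸ hD
  have hsum : ∫ x in U, D x = ∑' c : S, ∫ x in (c : Set ℝ), D x := by
    rw [← integral_iUnion hmm hpd hD2, ← hUe2]
  rw [hsum]
  refine tsum_nonpos ?_
  rintro ⟨c, hc⟩
  obtain ⟨x, hx, rfl⟩ := (hS c).1 hc
  obtain ⟨p, q, hpq, he, h1, h2, h3, h4, h5⟩ := comp_Ioo hU hUs hx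
  simp only [he]
  exact h p q hpq h1 h2 h3 h4 h5

/-- Cleaned-up data for the energy identity: globally continuous solution, globally measurable
source and derivative. -/
structure Dat (a a' : ℝ → ℝ) (T : ℝ) (y yx v F : ℝ → ℝ → ℝ) : Prop where
  ac : Continuous a
  a0 : ∀ x, 0 ≤ a x
  ad : ∀ x ∈ Ioo (0:ℝ) 1, HasDerivAt a (a' x) x
  a'c : ContinuousOn a' (Ioo 0 1)
  yc : Continuous (fun p : ℝ × ℝ => y p.1 p.2)
  hyx : ∀ x ∈ Ioo (0:ℝ) 1, ∀ t ∈ Ioo 0 T, HasDerivAt (fun w => y w t) (yx x t) x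
  hvx : ∀ x ∈ Ioo (0:ℝ) 1, ∀ t ∈ Ioo 0 T, HasDerivAt (fun w => a w * yx w t) (v x t) x
  hyt : ∀ x ∈ Ioo (0:ℝ) 1, ∀ t ∈ Ioo 0 T, HasDerivAt (fun s => y x s) (v x t + F x t) t
  Fm : Measurable (fun p : ℝ × ℝ => F p.1 p.2)
  FL : MemLp (fun p : ℝ × ℝ => F p.1 p.2) 2 volume
  yxm : Measurable (fun p : ℝ × ℝ => yx p.1 p.2)
  wL : MemLp (fun p : ℝ × ℝ => Real.sqrt (a p.1) * yx p.1 p.2) 2 volume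
  y0 : ∀ t, y 0 t = 0
  y1 : ∀ t, y 1 t = 0

/-- A convex truncation function with its first two derivatives, flat near zero. -/
structure Cvx (Φ P R : ℝ → ℝ) (δ : ℝ) : Prop where
  δ0 : 0 < δ
  Φd : ∀ r, HasDerivAt Φ (P r) r
  Pd : ∀ r, HasDerivAt P (R r) r
  Rc : Continuous R
  R0 : ∀ r, 0 ≤ R r
  conv : ∀ u w, Φ u - Φ w ≤ P u * (u - w)
  Pz : ∀ r, |r| ≤ δ → P r = 0

lemma Cvx.Φc {Φ P R : ℝ → ℝ} {δ : ℝ} (h : Cvx Φ P R δ) : Continuous Φ :=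
  continuous_iff_continuousAt.2 fun x => (h.Φd x).continuousAt

lemma Cvx.Pc {Φ P R : ℝ → ℝ} {δ : ℝ} (h : Cvx Φ P R δ) : Continuous P :=
  continuous_iff_continuousAt.2 fun x => (h.Pd x).continuousAt

section
variable {a a' : ℝ → ℝ} {T : ℝ} {y yx v F : ℝ → ℝ → ℝ} {Φ P R : ℝ → ℝ} {δ : ℝ}

lemma end_bound (h : Dat a a' T y yx v F) (hc : Cvx Φ P R δ) {s1 s2 p : ℝ}
    (hp : p = 0 ∨ p = 1 ∨ (p ∈ Ioo (0:ℝ) 1 ∧ a p = 0)) :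
    ∃ K r, 0 ≤ K ∧ 0 < r ∧ ∀ x t, |x - p| < r → t ∈ Icc s1 s2 →
      |P (y x t)| * Real.sqrt (a x) ≤ K * Real.sqrt |x - p| := by
  have bd : (∀ t, y p t = 0) → ∃ K r, 0 ≤ K ∧ 0 < r ∧ ∀ x t, |x - p| < r → t ∈ Icc s1 s2 →
      |P (y x t)| * Real.sqrt (a x) ≤ K * Real.sqrt |x - p| := by
    intro hy0
    have : ∀ᶠ x in nhds p, ∀ t ∈ Icc s1 s2, |y x t| ≤ δ := by
      refine isCompact_Icc.eventually_forall_of_forall_eventually fun t _ => ?_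
      have hcont : ContinuousAt (fun q : ℝ × ℝ => |y q.1 q.2|) (p, t) := h.yc.abs.continuousAt
      have h0 : |y (p, t).1 (p, t).2| < δ := by simpa [hy0] using hc.δ0
      filter_upwards [hcont.eventually (gt_mem_nhds h0)] with q hq using hq.le
    obtain ⟨r, hr, hrr⟩ := Metric.eventually_nhds_iff.1 this
    refine ⟨0, r, le_rfl, hr, fun x t hx ht => ?_⟩
    rw [hc.Pz _ (hrr (by rwa [Real.dist_eq]) t ht)]
    simp
  rcases hp with rfl | rfl | ⟨hp, hap⟩
  · exact bd h.y0
  · exact bd h.y1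
  have hbig : ∀ᶠ x in nhds p, |a x| ≤ (|a' p| + 1) * |x - p| := by
    have := (hasDerivAt_iff_isLittleO.1 (h.ad p hp)).def one_pos
    filter_upwards [this] with x hx
    simp only [hap, sub_zero, smul_eq_mul, Real.norm_eq_abs, one_mul] at hx
    have h1 : |a x| ≤ |a x - (x - p) * a' p| + |(x - p) * a' p| := by
      have := abs_add_le (a x - (x - p) * a' p) ((x - p) * a' p)
      simpa using this
    rw [abs_mul] at h1
    linarith
  obtain ⟨r, hr, hrr⟩ := Metric.eventually_nhds_iff.1 hbig
  obtain ⟨B, hB⟩ := ((isCompact_Icc (a := p - 1) (b := p + 1)).prod (isCompact_Icc (a := s1) (b := s2))).exists_bound_of_continuousOn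
    (hc.Pc.comp h.yc).continuousOn
  refine ⟨max B 0 * Real.sqrt (|a' p| + 1), min r 1, by positivity, by positivity, fun x t hx ht => ?_⟩
  have h1 := hrr (y := x) (by rw [Real.dist_eq]; exact hx.trans_le (min_le_left _ _))
  have hx1 := hx.trans_le (min_le_right _ _)
  rw [abs_lt] at hx1
  have h2 := hB (x, t) ⟨⟨by linarith, by linarith⟩, ht⟩
  simp only [Function.comp, Real.norm_eq_abs] at h2
  rw [mul_assoc, ← Real.sqrt_mul (by positivity)]
  exact mul_le_mul (h2.trans (le_max_left _ _)) (Real.sqrt_le_sqrt ((le_abs_self _).trans h1))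
    (Real.sqrt_nonneg _) (le_max_right _ _)

lemma contL2_int {u f : ℝ × ℝ → ℝ} (hu : Continuous u) (hf : MemLp f 2 volume) (x1 x2 s1 s2 : ℝ) :
    IntegrableOn (fun p => u p * f p) (Ioc x1 x2 ×ˢ Ioc s1 s2) := by
  have h1 : IntegrableOn f (Icc x1 x2 ×ˢ Icc s1 s2) := by
    have hK : IsCompact (Icc x1 x2 ×ˢ Icc s1 s2) := isCompact_Icc.prod isCompact_Icc
    have : IsFiniteMeasure (volume.restrict (Icc x1 x2 ×ˢ Icc s1 s2)) :=
      ⟨by simpa using hK.measure_lt_top⟩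
    exact (hf.restrict _).integrable one_le_two
  have h2 := IntegrableOn.continuousOn_mul hu.continuousOn h1 (isCompact_Icc.prod isCompact_Icc)
  exact h2.mono_set (prod_mono Ioc_subset_Icc_self Ioc_subset_Icc_self)

lemma contL1_int {u f : ℝ × ℝ → ℝ} (hu : Continuous u) (hf : Integrable f) (x1 x2 s1 s2 : ℝ) :
    IntegrableOn (fun p => u p * f p) (Ioc x1 x2 ×ˢ Ioc s1 s2) := by
  have h2 := IntegrableOn.continuousOn_mul hu.continuousOn hf.integrableOn
    (isCompact_Icc.prod (isCompact_Icc (a := s1) (b := s2)) : IsCompact (Icc x1 x2 ×ˢ Icc s1 s2))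
  exact h2.mono_set (prod_mono Ioc_subset_Icc_self Ioc_subset_Icc_self)

lemma Dat.wsq (h : Dat a a' T y yx v F) : Integrable fun p : ℝ × ℝ => a p.1 * yx p.1 p.2 ^ 2 := by
  refine h.wL.integrable_sq.congr (Filter.Eventually.of_forall fun p => ?_)
  simp only [mul_pow, Real.sq_sqrt (h.a0 p.1)]

lemma N_int (h : Dat a a' T y yx v F) (hc : Cvx Φ P R δ) {ψ : ℝ → ℝ} (hψ : Continuous ψ)
    (x1 x2 s1 s2 : ℝ) :
    IntegrableOn (fun p : ℝ × ℝ => ψ p.1 * (P (y p.1 p.2) * F p.1 p.2)) (Ioc x1 x2 ×ˢ Ioc s1 s2) ∧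
    IntegrableOn (fun p : ℝ × ℝ => ψ p.1 * (R (y p.1 p.2) * (a p.1 * yx p.1 p.2 ^ 2)))
      (Ioc x1 x2 ×ˢ Ioc s1 s2) := by
  constructor
  · have := contL2_int (u := fun p : ℝ × ℝ => ψ p.1 * P (y p.1 p.2))
      ((hψ.comp continuous_fst).mul (hc.Pc.comp h.yc)) h.FL x1 x2 s1 s2
    simpa only [mul_assoc] using this
  · have := contL1_int (u := fun p : ℝ × ℝ => ψ p.1 * R (y p.1 p.2))
      ((hψ.comp continuous_fst).mul (hc.Rc.comp h.yc)) h.wsq x1 x2 s1 s2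
    simpa only [mul_assoc] using this

set_option maxHeartbeats 1000000 in
lemma comp_eps (h : Dat a a' T y yx v F) (hc : Cvx Φ P R δ) {s1 s2 x1 x2 : ℝ} (hs1 : 0 < s1)
    (hs : s1 ≤ s2) (hs2 : s2 < T) (hx : x1 < x2) (hx1 : 0 < x1) (hx2 : x2 < 1)
    (hpos : ∀ x ∈ Icc x1 x2, 0 < a x) {ψ ψ' : ℝ → ℝ} (hψd : ∀ x, HasDerivAt ψ (ψ' x) x)
    (hψ'c : Continuous ψ') (hψ0 : ∀ x, 0 ≤ ψ x) (hψ1 : ψ x1 = 0) (hψ2 : ψ x2 = 0) :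
    ∫ x in Ioc x1 x2, ψ x * (Φ (y x s2) - Φ (y x s1) -
      ((∫ t in Ioc s1 s2, P (y x t) * F x t) - ∫ t in Ioc s1 s2, R (y x t) * (a x * yx x t ^ 2))) ≤
    - ∫ p in Ioc x1 x2 ×ˢ Ioc s1 s2, ψ' p.1 * P (y p.1 p.2) * a p.1 * yx p.1 p.2 := by
  have hψ : Continuous ψ := continuous_iff_continuousAt.2 fun x => (hψd x).continuousAt
  obtain ⟨b, hb⟩ : ∃ b : ℝ → ℝ, ∀ x, b x = a (max x1 (min x2 x)) := ⟨_, fun _ => rfl⟩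
  have hcl : ∀ x, max x1 (min x2 x) ∈ Icc x1 x2 := fun x =>
    ⟨le_max_left _ _, max_le hx.le (min_le_left _ _)⟩
  have hbe : ∀ x ∈ Icc x1 x2, b x = a x := fun x hx' => by
    rw [hb, min_eq_right hx'.2, max_eq_right hx'.1]
  have hbc : Continuous b := by
    rw [funext hb]; exact h.ac.comp (continuous_const.max (continuous_const.min continuous_id))
  have hbp : ∀ x, 0 < b x := fun x => by rw [hb]; exact hpos _ (hcl x)
  have hnh : ∀ x ∈ Ioo x1 x2, ∀ᶠ w in nhds x, w ∈ Ioo x1 x2 := fun x hx' => Ioo_mem_nhds hx'.1 hx'.2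
  have hIoo : Ioo x1 x2 ⊆ Ioo 0 1 := Ioo_subset_Ioo hx1.le hx2.le
  have hIcc : Icc x1 x2 ⊆ Ioo 0 1 := fun x hx' => ⟨hx1.trans_le hx'.1, hx'.2.trans_lt hx2⟩
  obtain ⟨A, hA⟩ := isCompact_Icc.exists_bound_of_continuousOn (h.a'c.mono hIcc)
  obtain ⟨c, hc0, hcc⟩ : ∃ c, 0 < c ∧ ∀ x ∈ Icc x1 x2, c ≤ Real.sqrt (a x) := by
    obtain ⟨z, hz, hzm⟩ := isCompact_Icc.exists_isMinOn (nonempty_Icc.2 hx.le)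
      (Real.continuous_sqrt.comp h.ac).continuousOn
    exact ⟨Real.sqrt (a z), Real.sqrt_pos.2 (hpos z hz), fun x hx' => hzm hx'⟩
  obtain ⟨ux, hux⟩ : ∃ ux : ℝ → ℝ → ℝ, ∀ x t, ux x t = (Icc x1 x2).indicator (fun x => yx x t) x :=
    ⟨_, fun _ _ => rfl⟩
  have huxe : ∀ x ∈ Icc x1 x2, ∀ t, ux x t = yx x t := fun x hx' t => by
    rw [hux, indicator_of_mem hx']
  have huxm : Measurable fun p : ℝ × ℝ => ux p.1 p.2 := by
    have : (fun p : ℝ × ℝ => ux p.1 p.2) =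
        (Prod.fst ⁻¹' (Icc x1 x2)).indicator (fun p : ℝ × ℝ => yx p.1 p.2) := by
      ext p
      rw [hux]
      by_cases hp : p.1 ∈ Icc x1 x2
      · rw [indicator_of_mem hp, indicator_of_mem (by exact hp)]
      · rw [indicator_of_notMem hp, indicator_of_notMem (by exact hp)]
    rw [this]
    exact h.yxm.indicator (measurable_fst measurableSet_Icc)
  have huxL : MemLp (fun p : ℝ × ℝ => ux p.1 p.2) 2 volume := by
    refine MemLp.of_le_mul (c := 1 / c) h.wL huxm.aestronglyMeasurable
      (Filter.Eventually.of_forall fun p => ?_)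
    by_cases hp : p.1 ∈ Icc x1 x2
    · rw [huxe _ hp, norm_mul, Real.norm_of_nonneg (Real.sqrt_nonneg _), ← mul_assoc]
      have : 1 ≤ 1 / c * Real.sqrt (a p.1) := by
        rw [one_div_mul_eq_div, le_div_iff₀ hc0, one_mul]; exact hcc _ hp
      exact le_mul_of_one_le_left (norm_nonneg _) this
    · rw [hux, indicator_of_notMem hp, norm_zero]; positivity
  have key := local_energy (T1 := 0) (T2 := T) hx hs1 hs hs2 hbc hbp (a' := a') (A := A)
    (fun x hx' => (h.ad x (hIoo hx')).congr_of_eventuallyEq (by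
      filter_upwards [hnh x hx'] with w hw using hbe w (Ioo_subset_Icc_self hw)))
    (fun x hx' => hA x (Ioo_subset_Icc_self hx')) h.yc (yx := ux) (v := v) (F := F)
    (fun x hx' t ht => by
      rw [huxe x (Ioo_subset_Icc_self hx')]; exact h.hyx x (hIoo hx') t ht)
    (fun x hx' t ht => (h.hvx x (hIoo hx') t ht).congr_of_eventuallyEq (by
      filter_upwards [hnh x hx'] with w hw
      rw [hbe w (Ioo_subset_Icc_self hw), huxe w (Ioo_subset_Icc_self hw)]))
    (fun x hx' t ht => h.hyt x (hIoo hx') t ht) h.Fm h.FL huxm huxL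
    hψ.continuousOn hψ'c hψd hψ0 hψ1 hψ2 hc.Φc hc.Pc hc.Rc hc.Pd hc.conv
  have hSm : MeasurableSet (Ioc x1 x2 ×ˢ Ioc s1 s2) := measurableSet_Ioc.prod measurableSet_Ioc
  obtain ⟨n1, n2⟩ := N_int h hc hψ x1 x2 s1 s2
  have n3 : IntegrableOn (fun p : ℝ × ℝ => ψ' p.1 * P (y p.1 p.2) * a p.1 * yx p.1 p.2)
      (Ioc x1 x2 ×ˢ Ioc s1 s2) := by
    have := contL2_int (u := fun p : ℝ × ℝ => ψ' p.1 * P (y p.1 p.2) * Real.sqrt (a p.1))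
      (((hψ'c.comp continuous_fst).mul (hc.Pc.comp h.yc)).mul
        (Real.continuous_sqrt.comp (h.ac.comp continuous_fst))) h.wL x1 x2 s1 s2
    refine this.congr (Filter.Eventually.of_forall fun p => ?_)
    have := Real.mul_self_sqrt (h.a0 p.1)
    linear_combination (ψ' p.1 * P (y p.1 p.2) * yx p.1 p.2) * this
  have r1 : ∫ p in Ioc x1 x2 ×ˢ Ioc s1 s2, (ψ' p.1 * P (y p.1 p.2) +
        ψ p.1 * R (y p.1 p.2) * ux p.1 p.2) * b p.1 * ux p.1 p.2 =
      (∫ p in Ioc x1 x2 ×ˢ Ioc s1 s2, ψ' p.1 * P (y p.1 p.2) * a p.1 * yx p.1 p.2) +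
      ∫ p in Ioc x1 x2 ×ˢ Ioc s1 s2, ψ p.1 * (R (y p.1 p.2) * (a p.1 * yx p.1 p.2 ^ 2)) := by
    rw [← integral_add n3 n2]
    refine setIntegral_congr_fun hSm fun p hp => ?_
    have := Ioc_subset_Icc_self hp.1
    rw [huxe _ this, hbe _ this]
    ring
  have fub : ∀ G : ℝ × ℝ → ℝ, IntegrableOn (fun p : ℝ × ℝ => ψ p.1 * G p) (Ioc x1 x2 ×ˢ Ioc s1 s2) →
      IntegrableOn (fun x => ψ x * ∫ t in Ioc s1 s2, G (x, t)) (Ioc x1 x2) ∧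
      ∫ p in Ioc x1 x2 ×ˢ Ioc s1 s2, ψ p.1 * G p =
        ∫ x in Ioc x1 x2, ψ x * ∫ t in Ioc s1 s2, G (x, t) := by
    intro G hG
    rw [IntegrableOn, Measure.volume_eq_prod, ← Measure.prod_restrict] at hG
    constructor
    · have := hG.integral_prod_left
      simp only [integral_const_mul] at this
      exact this
    · rw [Measure.volume_eq_prod, ← Measure.prod_restrict, integral_prod _ hG]
      simp only [integral_const_mul]
  obtain ⟨g1, g1e⟩ := fub (fun p => P (y p.1 p.2) * F p.1 p.2) n1
  obtain ⟨g2, g2e⟩ := fub (fun p => R (y p.1 p.2) * (a p.1 * yx p.1 p.2 ^ 2)) n2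
  simp only at g1 g1e g2 g2e
  have hyl : ∀ t, IntegrableOn (fun x => ψ x * Φ (y x t)) (Ioc x1 x2) := fun t => by
    have : Continuous fun x => ψ x * Φ (y x t) :=
      hψ.mul (hc.Φc.comp (h.yc.comp (continuous_id.prodMk continuous_const)))
    exact (this.intervalIntegrable x1 x2).1
  rw [intervalIntegral.integral_of_le hx.le, intervalIntegral.integral_of_le hx.le, r1, g2e] at key
  simp only [mul_assoc (ψ _) (P _)] at key
  rw [g1e] at key
  have e : ∫ x in Ioc x1 x2, ψ x * (Φ (y x s2) - Φ (y x s1) -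
      ((∫ t in Ioc s1 s2, P (y x t) * F x t) - ∫ t in Ioc s1 s2, R (y x t) * (a x * yx x t ^ 2))) =
      (∫ x in Ioc x1 x2, ψ x * Φ (y x s2)) - (∫ x in Ioc x1 x2, ψ x * Φ (y x s1)) -
      ((∫ x in Ioc x1 x2, ψ x * ∫ t in Ioc s1 s2, P (y x t) * F x t) -
       ∫ x in Ioc x1 x2, ψ x * ∫ t in Ioc s1 s2, R (y x t) * (a x * yx x t ^ 2)) := by
    have i12 : IntegrableOn (fun x => ψ x * Φ (y x s2) - ψ x * Φ (y x s1)) (Ioc x1 x2) :=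
      (hyl s2).sub (hyl s1)
    have i34 : IntegrableOn (fun x => ψ x * (∫ t in Ioc s1 s2, P (y x t) * F x t) -
        ψ x * ∫ t in Ioc s1 s2, R (y x t) * (a x * yx x t ^ 2)) (Ioc x1 x2) := g1.sub g2
    rw [← integral_sub (hyl s2) (hyl s1), ← integral_sub g1 g2, ← integral_sub i12 i34]
    refine integral_congr_ae (Filter.Eventually.of_forall fun x => ?_)
    simp only
    ring
  rw [e]
  linarith
end

lemma smooth_bd : ∃ B : ℝ, 0 ≤ B ∧ ∀ x, |deriv Real.smoothTransition x| ≤ B := by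
  have hcd : ContDiff ℝ 1 Real.smoothTransition := Real.smoothTransition.contDiff
  have hc : Continuous (deriv Real.smoothTransition) := hcd.continuous_deriv le_rfl
  obtain ⟨B, hB⟩ := (isCompact_Icc (a := (0:ℝ)) (b := 1)).exists_bound_of_continuousOn hc.continuousOn
  refine ⟨max B 0, le_max_right _ _, fun x => ?_⟩
  by_cases h0 : x < 0
  · have : Real.smoothTransition =ᶠ[nhds x] fun _ => 0 := by
      filter_upwards [gt_mem_nhds h0] with w hw using Real.smoothTransition.zero_of_nonpos hw.le
    rw [this.deriv_eq]; simp
  by_cases h1 : 1 < x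
  · have : Real.smoothTransition =ᶠ[nhds x] fun _ => 1 := by
      filter_upwards [lt_mem_nhds h1] with w hw using Real.smoothTransition.one_of_one_le hw.le
    rw [this.deriv_eq]; simp
  exact (hB x ⟨not_lt.1 h0, not_lt.1 h1⟩).trans (le_max_left _ _)

lemma cutoff (p q : ℝ) : ∃ B : ℝ, 0 ≤ B ∧ ∀ ε : ℝ, 0 < ε → ∃ ψ ψ' : ℝ → ℝ,
    (∀ x, HasDerivAt ψ (ψ' x) x) ∧ Continuous ψ' ∧ (∀ x, 0 ≤ ψ x) ∧ (∀ x, ψ x ≤ 1) ∧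
    (∀ x ≤ p + ε, ψ x = 0) ∧ (∀ x, q - ε ≤ x → ψ x = 0) ∧
    (∀ x, p + 2 * ε < x → x < q - 2 * ε → ψ x = 1 ∧ ψ' x = 0) ∧ ∀ x, |ψ' x| ≤ B / ε := by
  obtain ⟨B, hB0, hB⟩ := smooth_bd
  refine ⟨2 * B, by positivity, fun ε hε => ?_⟩
  have hcd : ContDiff ℝ 1 Real.smoothTransition := Real.smoothTransition.contDiff
  have hc : Continuous (deriv Real.smoothTransition) := hcd.continuous_deriv le_rfl
  have hS : ∀ x, HasDerivAt Real.smoothTransition (deriv Real.smoothTransition x) x := fun x =>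
    (hcd.differentiable one_ne_zero x).hasDerivAt
  have hd : ∀ x, HasDerivAt (fun x => Real.smoothTransition ((x - p) / ε - 1) *
      Real.smoothTransition ((q - x) / ε - 1))
      (deriv Real.smoothTransition ((x - p) / ε - 1) * (1 / ε) * Real.smoothTransition ((q - x) / ε - 1) +
        Real.smoothTransition ((x - p) / ε - 1) *
          (deriv Real.smoothTransition ((q - x) / ε - 1) * (-1 / ε))) x := by
    intro x
    have d1 : HasDerivAt (fun x => (x - p) / ε - 1) (1 / ε) x :=
      (((hasDerivAt_id x).sub_const p).div_const ε).sub_const 1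
    have d2 : HasDerivAt (fun x => (q - x) / ε - 1) (-1 / ε) x :=
      (((hasDerivAt_id x).const_sub q).div_const ε).sub_const 1
    exact ((hS _).comp x d1).mul ((hS _).comp x d2)
  refine ⟨_, _, hd, ?_, fun x => ?_, fun x => ?_, fun x hx => ?_, fun x hx => ?_,
    fun x hx1 hx2 => ?_, fun x => ?_⟩
  · have := Real.smoothTransition.continuous
    fun_prop
  · exact mul_nonneg (Real.smoothTransition.nonneg _) (Real.smoothTransition.nonneg _)
  · exact mul_le_one₀ (Real.smoothTransition.le_one _) (Real.smoothTransition.nonneg _)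
      (Real.smoothTransition.le_one _)
  · have : (x - p) / ε - 1 ≤ 0 := by
      rw [sub_nonpos, div_le_one hε]; linarith
    simp only [Real.smoothTransition.zero_of_nonpos this, zero_mul]
  · have : (q - x) / ε - 1 ≤ 0 := by
      rw [sub_nonpos, div_le_one hε]; linarith
    simp only [Real.smoothTransition.zero_of_nonpos this, mul_zero]
  · have h1 : ∀ w, p + 2 * ε < w → Real.smoothTransition ((w - p) / ε - 1) = 1 := fun w hw => by
      refine Real.smoothTransition.one_of_one_le ?_
      have : 2 ≤ (w - p) / ε := by rw [le_div_iff₀ hε]; linarith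
      linarith
    have h2 : ∀ w, w < q - 2 * ε → Real.smoothTransition ((q - w) / ε - 1) = 1 := fun w hw => by
      refine Real.smoothTransition.one_of_one_le ?_
      have : 2 ≤ (q - w) / ε := by rw [le_div_iff₀ hε]; linarith
      linarith
    refine ⟨by simp only [h1 x hx1, h2 x hx2, mul_one], ?_⟩
    refine (hd x).unique ?_
    refine (hasDerivAt_const x (1:ℝ)).congr_of_eventuallyEq ?_
    filter_upwards [Ioo_mem_nhds hx1 hx2] with w hw
    rw [h1 w hw.1, h2 w hw.2, mul_one]
  · have hε' : |1 / ε| = 1 / ε := abs_of_pos (by positivity)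
    have hε'' : |-1 / ε| = 1 / ε := by rw [neg_div, abs_neg, hε']
    refine (abs_add_le _ _).trans ?_
    simp only [abs_mul, hε', hε'']
    have n1 : |Real.smoothTransition ((x - p) / ε - 1)| ≤ 1 := by
      rw [abs_of_nonneg (Real.smoothTransition.nonneg _)]; exact Real.smoothTransition.le_one _
    have n2 : |Real.smoothTransition ((q - x) / ε - 1)| ≤ 1 := by
      rw [abs_of_nonneg (Real.smoothTransition.nonneg _)]; exact Real.smoothTransition.le_one _
    have b1 := hB ((x - p) / ε - 1)
    have b2 := hB ((q - x) / ε - 1)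
    have hp : 0 < 1 / ε := by positivity
    have m1 : |deriv Real.smoothTransition ((x - p) / ε - 1)| * (1 / ε) *
        |Real.smoothTransition ((q - x) / ε - 1)| ≤ B * (1 / ε) * 1 := by gcongr
    have m2 : |Real.smoothTransition ((x - p) / ε - 1)| *
        (|deriv Real.smoothTransition ((q - x) / ε - 1)| * (1 / ε)) ≤ 1 * (B * (1 / ε)) := by gcongr
    have : 2 * B / ε = B * (1 / ε) * 1 + 1 * (B * (1 / ε)) := by ring
    linarith

lemma young_eps {X r ε lam : ℝ} (hε : 0 < ε) (hl : 0 < lam) (hr : r ^ 2 = 2 * ε) :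
    X * r / ε ≤ lam / ε + X ^ 2 / (2 * lam) := by
  have : lam / ε + X ^ 2 / (2 * lam) - X * r / ε = 2 * (lam - X * r / 2) ^ 2 / (2 * lam * ε) := by
    have : ε = r ^ 2 / 2 := by linarith
    subst this
    have : r ≠ 0 := by rintro rfl; simp at hε
    field_simp
    ring
  have h2 : 0 ≤ 2 * (lam - X * r / 2) ^ 2 / (2 * lam * ε) := by positivity
  linarith

section
variable {a a' : ℝ → ℝ} {T : ℝ} {y yx v F : ℝ → ℝ → ℝ} {Φ P R : ℝ → ℝ} {δ : ℝ}

set_option maxHeartbeats 1000000 in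
lemma comp_step (h : Dat a a' T y yx v F) (hc : Cvx Φ P R δ) {s1 s2 p q : ℝ} (hs1 : 0 < s1)
    (hs : s1 ≤ s2) (hs2 : s2 < T) (hpq : p < q) (hp0 : 0 ≤ p) (hq1 : q ≤ 1)
    (hpos : ∀ x ∈ Ioo p q, 0 < a x)
    (hp : p = 0 ∨ p = 1 ∨ (p ∈ Ioo (0:ℝ) 1 ∧ a p = 0))
    (hq : q = 0 ∨ q = 1 ∨ (q ∈ Ioo (0:ℝ) 1 ∧ a q = 0)) {D : ℝ → ℝ}
    (hDe : ∀ x, D x = Φ (y x s2) - Φ (y x s1) -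
      ((∫ t in Ioc s1 s2, P (y x t) * F x t) - ∫ t in Ioc s1 s2, R (y x t) * (a x * yx x t ^ 2))) :
    ∃ C : ℝ, 0 ≤ C ∧ ∀ᶠ ε in nhdsWithin (0:ℝ) (Ioi 0), ∃ ψ : ℝ → ℝ, Continuous ψ ∧
      (∀ x, 0 ≤ ψ x) ∧ (∀ x, ψ x ≤ 1) ∧ (∀ x, p + 2 * ε < x → x < q - 2 * ε → ψ x = 1) ∧
      ∀ lam : ℝ, 0 < lam → ∫ x in Ioo p q, ψ x * D x ≤ 4 * lam * (s2 - s1) +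
        C / lam * ∫ z in Ioo p q ×ˢ Ioc s1 s2,
          (Icc p (p + 2 * ε) ∪ Icc (q - 2 * ε) q).indicator (fun _ => (1:ℝ)) z.1 *
            (a z.1 * yx z.1 z.2 ^ 2) := by
  obtain ⟨K1, r1, hK1, hr1, hb1⟩ := end_bound h hc (s1 := s1) (s2 := s2) hp
  obtain ⟨K2, r2, hK2, hr2, hb2⟩ := end_bound h hc (s1 := s1) (s2 := s2) hq
  obtain ⟨B, hB0, hB⟩ := cutoff p q
  obtain ⟨K, hK⟩ : ∃ K, K = max K1 K2 := ⟨_, rfl⟩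
  have hK0 : 0 ≤ K := hK ▸ hK1.trans (le_max_left _ _)
  refine ⟨(B * K) ^ 2 / 2, by positivity, ?_⟩
  have hm : 0 < min (min r1 r2) (q - p) / 4 := by
    have : 0 < q - p := by linarith
    positivity
  filter_upwards [Ioo_mem_nhdsGT hm] with ε hε
  have hε0 := hε.1
  have e1 : 4 * ε < r1 := by
    have := hε.2; have h1 := (min_le_left (min r1 r2) (q-p)).trans (min_le_left r1 r2); linarith
  have e2 : 4 * ε < r2 := by
    have := hε.2; have h1 := (min_le_left (min r1 r2) (q-p)).trans (min_le_right r1 r2); linarith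
  have e3 : 4 * ε < q - p := by
    have := hε.2; have h1 := (min_le_right (min r1 r2) (q-p)); linarith
  obtain ⟨ψ, ψ', hψd, hψ'c, hψ0, hψ1, hψp, hψq, hψm, hψ'⟩ := hB ε hε0
  have hψ : Continuous ψ := continuous_iff_continuousAt.2 fun x => (hψd x).continuousAt
  refine ⟨ψ, hψ, hψ0, hψ1, fun x h1 h2 => (hψm x h1 h2).1, fun lam hl => ?_⟩
  have key := comp_eps h hc hs1 hs hs2 (x1 := p + ε) (x2 := q - ε) (by linarith) (by linarith)
    (by linarith) (fun x hx => hpos x ⟨by linarith [hx.1], by linarith [hx.2]⟩) hψd hψ'c hψ0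
    (hψp _ le_rfl) (hψq _ le_rfl)
  simp only [← hDe] at key
  have hsub : Ioc (p + ε) (q - ε) ⊆ Ioo p q := fun x hx => ⟨by linarith [hx.1], by linarith [hx.2]⟩
  have hL : ∫ x in Ioo p q, ψ x * D x = ∫ x in Ioc (p + ε) (q - ε), ψ x * D x := by
    refine setIntegral_eq_of_subset_of_forall_sdiff_eq_zero measurableSet_Ioo hsub fun x hx => ?_
    by_cases hx1 : x ≤ p + ε
    · rw [hψp x hx1, zero_mul]
    · have : q - ε ≤ x := by
        by_contra hcon
        exact hx.2 ⟨not_le.1 hx1, (not_le.1 hcon).le⟩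
      rw [hψq x this, zero_mul]
  rw [hL]
  refine key.trans ?_
  rw [← integral_neg]
  have hN : MeasurableSet (Icc p (p + 2 * ε) ∪ Icc (q - 2 * ε) q) :=
    measurableSet_Icc.union measurableSet_Icc
  obtain ⟨ind, hind⟩ : ∃ ind : ℝ → ℝ, ind =
    (Icc p (p + 2 * ε) ∪ Icc (q - 2 * ε) q).indicator (fun _ => (1:ℝ)) := ⟨_, rfl⟩
  rw [← hind]
  have hindm : Measurable ind := by rw [hind]; exact measurable_const.indicator hN
  have hind0 : ∀ x, 0 ≤ ind x := fun x => by rw [hind]; exact indicator_nonneg (by simp) x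
  have hind1 : ∀ x, ind x ≤ 1 := fun x => by
    rw [hind]; exact indicator_le_self' (f := fun _ => (1:ℝ)) (by simp) x
  have hS : MeasurableSet (Ioo p q ×ˢ Ioc s1 s2) := measurableSet_Ioo.prod measurableSet_Ioc
  have i1 : IntegrableOn (fun z : ℝ × ℝ => (ind z.1 * (lam / ε)) * 1) (Ioo p q ×ˢ Ioc s1 s2) := by
    refine Measure.integrableOn_of_bounded (M := lam / ε) ?_ ?_ ?_
    · rw [Measure.volume_eq_prod, Measure.prod_prod]; simp [ENNReal.mul_eq_top]
    · exact (((hindm.comp measurable_fst).mul_const _).mul_const _).aestronglyMeasurable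
    · refine Filter.Eventually.of_forall fun z => ?_
      rw [Real.norm_of_nonneg (by have := hind0 z.1; positivity), mul_one]
      have : 0 < lam / ε := by positivity
      nlinarith [hind1 z.1]
  have i2 : IntegrableOn (fun z : ℝ × ℝ => ind z.1 * (a z.1 * yx z.1 z.2 ^ 2))
      (Ioo p q ×ˢ Ioc s1 s2) := by
    refine (h.wsq.bdd_mul (c := 1) (hindm.comp measurable_fst).aestronglyMeasurable ?_).integrableOn
    refine Filter.Eventually.of_forall fun z => ?_
    simp only [Function.comp]
    rw [Real.norm_of_nonneg (hind0 _)]; exact hind1 _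
  have i12 : IntegrableOn (fun z : ℝ × ℝ => ind z.1 * (lam / ε) * 1 +
      (B * K) ^ 2 / 2 / lam * (ind z.1 * (a z.1 * yx z.1 z.2 ^ 2))) (Ioo p q ×ˢ Ioc s1 s2) :=
    i1.add (i2.const_mul _)
  have b1 : ∫ z in Ioo p q ×ˢ Ioc s1 s2, (ind z.1 * (lam / ε)) * 1 ≤ 4 * lam * (s2 - s1) := by
    rw [Measure.volume_eq_prod, setIntegral_prod_mul (fun x => ind x * (lam / ε)) (fun _ => (1:ℝ)),
      integral_mul_const]
    have : ∫ x in Ioo p q, ind x ≤ 4 * ε := by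
      rw [hind, setIntegral_indicator hN, setIntegral_const, smul_eq_mul, mul_one]
      calc volume.real (Ioo p q ∩ (Icc p (p + 2 * ε) ∪ Icc (q - 2 * ε) q))
          ≤ volume.real (Icc p (p + 2 * ε) ∪ Icc (q - 2 * ε) q) :=
            measureReal_mono inter_subset_right
              ((measure_union_lt_top measure_Icc_lt_top measure_Icc_lt_top).ne)
        _ ≤ _ := measureReal_union_le _ _
        _ = 4 * ε := by
            rw [Real.volume_real_Icc_of_le (by linarith), Real.volume_real_Icc_of_le (by linarith)]
            ring
    rw [setIntegral_const, smul_eq_mul, mul_one, Real.volume_real_Ioc_of_le hs]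
    have e : 4 * lam * (s2 - s1) = (4 * ε) * (lam / ε) * (s2 - s1) := by field_simp
    rw [e]
    have : 0 ≤ s2 - s1 := by linarith
    gcongr
  calc _ ≤ ∫ z in Ioc (p + ε) (q - ε) ×ˢ Ioc s1 s2, (ind z.1 * (lam / ε) * 1 +
      (B * K) ^ 2 / 2 / lam * (ind z.1 * (a z.1 * yx z.1 z.2 ^ 2))) := by
        refine (Real.le_norm_self _).trans (norm_integral_le_of_norm_le
          (i12.mono_set (prod_mono hsub subset_rfl)) ?_)
        refine (ae_restrict_iff' (measurableSet_Ioc.prod measurableSet_Ioc)).2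
          (Filter.Eventually.of_forall fun z hz => ?_)
        rw [norm_neg, Real.norm_eq_abs]
        have hz1 := hsub hz.1
        have ha := h.a0 z.1
        have hsq := Real.mul_self_sqrt ha
        by_cases hzN : z.1 ∈ Icc p (p + 2 * ε) ∪ Icc (q - 2 * ε) q
        · have hi : ind z.1 = 1 := by rw [hind, indicator_of_mem hzN]
          have hPb : |P (y z.1 z.2)| * Real.sqrt (a z.1) ≤ K * Real.sqrt (2 * ε) := by
            rcases hzN with hzN | hzN
            · have hd : |z.1 - p| ≤ 2 * ε := by
                rw [abs_le]; constructor <;> linarith [hzN.1, hzN.2]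
              refine (hb1 z.1 z.2 (by linarith) (Ioc_subset_Icc_self hz.2)).trans ?_
              have := Real.sqrt_le_sqrt hd
              have hk : K1 ≤ K := hK ▸ le_max_left _ _
              gcongr
            · have hd : |z.1 - q| ≤ 2 * ε := by
                rw [abs_le]; constructor <;> linarith [hzN.1, hzN.2]
              refine (hb2 z.1 z.2 (by linarith) (Ioc_subset_Icc_self hz.2)).trans ?_
              have := Real.sqrt_le_sqrt hd
              have hk : K2 ≤ K := hK ▸ le_max_right _ _
              gcongr
          have hy := young_eps (X := B * K * (Real.sqrt (a z.1) * |yx z.1 z.2|))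
            (r := Real.sqrt (2 * ε)) hε0 hl (Real.sq_sqrt (by positivity))
          have hXs : (B * K * (Real.sqrt (a z.1) * |yx z.1 z.2|)) ^ 2 =
              (B * K) ^ 2 * (a z.1 * yx z.1 z.2 ^ 2) := by
            rw [mul_pow, mul_pow (Real.sqrt _), sq_abs, Real.sq_sqrt ha]
          rw [hXs] at hy
          rw [hi]
          have e4 : |ψ' z.1 * P (y z.1 z.2) * a z.1 * yx z.1 z.2| =
              |ψ' z.1| * (|P (y z.1 z.2)| * Real.sqrt (a z.1)) *
                (Real.sqrt (a z.1) * |yx z.1 z.2|) := by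
            simp only [abs_mul, abs_of_nonneg ha]
            linear_combination (-(|ψ' z.1| * |P (y z.1 z.2)| * |yx z.1 z.2|)) * hsq
          rw [e4]
          calc _ ≤ B / ε * (K * Real.sqrt (2 * ε)) * (Real.sqrt (a z.1) * |yx z.1 z.2|) := by
                have := hψ' z.1
                gcongr
            _ = B * K * (Real.sqrt (a z.1) * |yx z.1 z.2|) * Real.sqrt (2 * ε) / ε := by ring
            _ ≤ _ := hy
            _ = _ := by field_simp
        · have : p + 2 * ε < z.1 ∧ z.1 < q - 2 * ε := by
            constructor
            · by_contra hcon
              exact hzN (Or.inl ⟨hz1.1.le, not_lt.1 hcon⟩)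
            · by_contra hcon
              exact hzN (Or.inr ⟨not_lt.1 hcon, hz1.2.le⟩)
          rw [(hψm _ this.1 this.2).2]
          have := hind0 z.1
          simp only [zero_mul, abs_zero]
          positivity
    _ ≤ ∫ z in Ioo p q ×ˢ Ioc s1 s2, (ind z.1 * (lam / ε) * 1 +
      (B * K) ^ 2 / 2 / lam * (ind z.1 * (a z.1 * yx z.1 z.2 ^ 2))) := by
        refine setIntegral_mono_set i12 ?_ (prod_mono hsub subset_rfl).eventuallyLE
        refine Filter.Eventually.of_forall fun z => ?_
        have := hind0 z.1
        have := h.a0 z.1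
        simp only [Pi.zero_apply]
        positivity
    _ ≤ _ := by
        rw [integral_add i1 (i2.const_mul _), integral_const_mul]
        linarith

lemma D_int (h : Dat a a' T y yx v F) (hc : Cvx Φ P R δ) {s1 s2 : ℝ} {D : ℝ → ℝ}
    (hDe : ∀ x, D x = Φ (y x s2) - Φ (y x s1) -
      ((∫ t in Ioc s1 s2, P (y x t) * F x t) - ∫ t in Ioc s1 s2, R (y x t) * (a x * yx x t ^ 2))) :
    IntegrableOn D (Ioo 0 1) := by
  obtain ⟨n1, n2⟩ := N_int h hc (ψ := fun _ => 1) continuous_const 0 1 s1 s2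
  simp only [one_mul] at n1 n2
  rw [IntegrableOn, Measure.volume_eq_prod, ← Measure.prod_restrict] at n1 n2
  have hyl : ∀ t, IntegrableOn (fun x => Φ (y x t)) (Ioc 0 1) := fun t => by
    have : Continuous fun x => Φ (y x t) :=
      hc.Φc.comp (h.yc.comp (continuous_id.prodMk continuous_const))
    exact (this.intervalIntegrable 0 1).1
  have := ((hyl s2).sub (hyl s1)).sub (n1.integral_prod_left.sub n2.integral_prod_left)
  rw [funext hDe]
  exact IntegrableOn.mono_set this Ioo_subset_Ioc_self

set_option maxHeartbeats 1000000 in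
lemma comp_le (h : Dat a a' T y yx v F) (hc : Cvx Φ P R δ) {s1 s2 p q : ℝ} (hs1 : 0 < s1)
    (hs : s1 ≤ s2) (hs2 : s2 < T) (hpq : p < q) (hp0 : 0 ≤ p) (hq1 : q ≤ 1)
    (hpos : ∀ x ∈ Ioo p q, 0 < a x)
    (hp : p = 0 ∨ p = 1 ∨ (p ∈ Ioo (0:ℝ) 1 ∧ a p = 0))
    (hq : q = 0 ∨ q = 1 ∨ (q ∈ Ioo (0:ℝ) 1 ∧ a q = 0)) {D : ℝ → ℝ}
    (hDe : ∀ x, D x = Φ (y x s2) - Φ (y x s1) -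
      ((∫ t in Ioc s1 s2, P (y x t) * F x t) - ∫ t in Ioc s1 s2, R (y x t) * (a x * yx x t ^ 2))) :
    ∫ x in Ioo p q, D x ≤ 0 := by
  have hD : IntegrableOn D (Ioo p q) := (D_int h hc hDe).mono_set (Ioo_subset_Ioo hp0 hq1)
  obtain ⟨C, hC0, hC⟩ := comp_step h hc hs1 hs hs2 hpq hp0 hq1 hpos hp hq hDe
  have hev : ∀ x ∈ Ioo p q, ∀ᶠ ε in nhdsWithin (0:ℝ) (Ioi 0), p + 2 * ε < x ∧ x < q - 2 * ε := by
    intro x hx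
    have hm : 0 < min (x - p) (q - x) / 2 := by
      have := sub_pos.2 hx.1; have := sub_pos.2 hx.2; positivity
    filter_upwards [Ioo_mem_nhdsGT hm] with ε hε
    have := hε.2; have h1 := min_le_left (x - p) (q - x); have h2 := min_le_right (x - p) (q - x)
    constructor <;> linarith
  obtain ⟨ψ, hψ⟩ := Classical.skolem.1 (fun ε : ℝ => show ∃ ψ : ℝ → ℝ, (∃ ψ : ℝ → ℝ, Continuous ψ ∧
      (∀ x, 0 ≤ ψ x) ∧ (∀ x, ψ x ≤ 1) ∧ (∀ x, p + 2 * ε < x → x < q - 2 * ε → ψ x = 1) ∧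
      ∀ lam : ℝ, 0 < lam → ∫ x in Ioo p q, ψ x * D x ≤ 4 * lam * (s2 - s1) +
        C / lam * ∫ z in Ioo p q ×ˢ Ioc s1 s2,
          (Icc p (p + 2 * ε) ∪ Icc (q - 2 * ε) q).indicator (fun _ => (1:ℝ)) z.1 *
            (a z.1 * yx z.1 z.2 ^ 2)) → _ from by
        by_cases hh : ∃ ψ : ℝ → ℝ, Continuous ψ ∧
          (∀ x, 0 ≤ ψ x) ∧ (∀ x, ψ x ≤ 1) ∧ (∀ x, p + 2 * ε < x → x < q - 2 * ε → ψ x = 1) ∧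
          ∀ lam : ℝ, 0 < lam → ∫ x in Ioo p q, ψ x * D x ≤ 4 * lam * (s2 - s1) +
            C / lam * ∫ z in Ioo p q ×ˢ Ioc s1 s2,
              (Icc p (p + 2 * ε) ∪ Icc (q - 2 * ε) q).indicator (fun _ => (1:ℝ)) z.1 *
                (a z.1 * yx z.1 z.2 ^ 2)
        · obtain ⟨ψ, hψ⟩ := hh
          exact ⟨ψ, fun _ => hψ⟩
        · exact ⟨0, fun hcon => absurd hcon hh⟩)
  have hC' := hC.mono fun ε hε => hψ ε hε
  have lim1 : Filter.Tendsto (fun ε => ∫ x in Ioo p q, ψ ε x * D x) (nhdsWithin 0 (Ioi 0))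
      (nhds (∫ x in Ioo p q, D x)) := by
    refine tendsto_integral_filter_of_dominated_convergence (fun x => ‖D x‖) ?_ ?_ hD.norm ?_
    · filter_upwards [hC'] with ε hε
      exact hε.1.aestronglyMeasurable.mul hD.aestronglyMeasurable
    · filter_upwards [hC'] with ε hε
      refine Filter.Eventually.of_forall fun x => ?_
      rw [norm_mul, Real.norm_of_nonneg (hε.2.1 x)]
      exact mul_le_of_le_one_left (norm_nonneg _) (hε.2.2.1 x)
    · refine (ae_restrict_iff' measurableSet_Ioo).2 (Filter.Eventually.of_forall fun x hx => ?_)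
      refine Filter.Tendsto.congr' (f₁ := fun _ => D x) ?_ tendsto_const_nhds
      filter_upwards [hC', hev x hx] with ε hε hh
      rw [hε.2.2.2.1 x hh.1 hh.2, one_mul]
  have lim2 : Filter.Tendsto (fun ε => ∫ z in Ioo p q ×ˢ Ioc s1 s2,
          (Icc p (p + 2 * ε) ∪ Icc (q - 2 * ε) q).indicator (fun _ => (1:ℝ)) z.1 *
            (a z.1 * yx z.1 z.2 ^ 2)) (nhdsWithin 0 (Ioi 0)) (nhds 0) := by
    have h0 : (0:ℝ) = ∫ z in Ioo p q ×ˢ Ioc s1 s2, (0:ℝ) := by simp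
    rw [show nhds (0:ℝ) = nhds (∫ z in Ioo p q ×ˢ Ioc s1 s2, (0:ℝ)) from by rw [← h0]]
    clear h0
    refine tendsto_integral_filter_of_dominated_convergence
      (fun z => ‖a z.1 * yx z.1 z.2 ^ 2‖) ?_ ?_ h.wsq.norm.integrableOn ?_
    · refine Filter.Eventually.of_forall fun ε => ?_
      have : Measurable ((Icc p (p + 2 * ε) ∪ Icc (q - 2 * ε) q).indicator (fun _ => (1:ℝ))) :=
        measurable_const.indicator (measurableSet_Icc.union measurableSet_Icc)
      exact (this.comp measurable_fst).aestronglyMeasurable.mul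
        h.wsq.aestronglyMeasurable.restrict
    · refine Filter.Eventually.of_forall fun ε => Filter.Eventually.of_forall fun z => ?_
      rw [norm_mul, Real.norm_of_nonneg (indicator_nonneg (by simp) _)]
      refine mul_le_of_le_one_left (norm_nonneg _) ?_
      exact indicator_le_self' (f := fun _ => (1:ℝ)) (by simp) _
    · refine (ae_restrict_iff' (measurableSet_Ioo.prod measurableSet_Ioc)).2
        (Filter.Eventually.of_forall fun z hz => ?_)
      refine Filter.Tendsto.congr' (f₁ := fun _ => (0:ℝ)) ?_ tendsto_const_nhds
      filter_upwards [hev z.1 hz.1] with ε hh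
      rw [indicator_of_notMem, zero_mul]
      rintro (hx | hx)
      · linarith [hx.2]
      · linarith [hx.1]
  have fin : ∀ lam : ℝ, 0 < lam → ∫ x in Ioo p q, D x ≤ 4 * lam * (s2 - s1) := by
    intro lam hl
    have l2 := (lim2.const_mul (C / lam)).const_add (4 * lam * (s2 - s1))
    rw [mul_zero, add_zero] at l2
    exact le_of_tendsto_of_tendsto lim1 l2 (hC'.mono fun ε hε => hε.2.2.2.2 lam hl)
  have l3 : Filter.Tendsto (fun lam : ℝ => 4 * lam * (s2 - s1)) (nhdsWithin 0 (Ioi 0)) (nhds 0) := by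
    have : Continuous fun lam : ℝ => 4 * lam * (s2 - s1) := by fun_prop
    have := (this.tendsto 0).mono_left (nhdsWithin_le_nhds (s := Ioi (0:ℝ)))
    simpa using this
  exact ge_of_tendsto l3 (by filter_upwards [self_mem_nhdsWithin] with lam hl using fin lam hl)

end

section
variable {a a' : ℝ → ℝ} {T : ℝ} {y yx v F : ℝ → ℝ → ℝ} {Φ P R : ℝ → ℝ} {δ : ℝ}

lemma Z_zero (h : Dat a a' T y yx v F) (hc : Cvx Φ P R δ) {s1 s2 : ℝ} (hs1 : 0 < s1)
    (hs : s1 ≤ s2) (hs2 : s2 < T) {D : ℝ → ℝ}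
    (hDe : ∀ x, D x = Φ (y x s2) - Φ (y x s1) -
      ((∫ t in Ioc s1 s2, P (y x t) * F x t) - ∫ t in Ioc s1 s2, R (y x t) * (a x * yx x t ^ 2))) :
    ∀ᵐ x, x ∈ Ioo (0:ℝ) 1 → a x = 0 → D x = 0 := by
  obtain ⟨n1, n2⟩ := N_int h hc (ψ := fun _ => 1) continuous_const 0 1 s1 s2
  simp only [one_mul] at n1 
  rw [IntegrableOn, Measure.volume_eq_prod, ← Measure.prod_restrict] at n1 
  have n3 := n1.prod_right_ae
  rw [ae_restrict_iff' measurableSet_Ioc] at n3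
  filter_upwards [n3] with x hx hx01 hax
  have hI : IntervalIntegrable (fun t => P (y x t) * F x t) volume s1 s2 :=
    (intervalIntegrable_iff_integrableOn_Ioc_of_le hs).2 (hx (Ioo_subset_Ioc_self hx01))
  have hv : ∀ t ∈ Ioo 0 T, v x t = 0 := fun t ht => by
    have hr : 0 < min x (1 - x) := lt_min hx01.1 (sub_pos.2 hx01.2)
    refine flux_zero hr h.a0 hax (h.ad x hx01) (u := fun w => y w t) (ux := fun w => yx w t)
      (fun w hw => h.hyx w ⟨?_, ?_⟩ t ht) (h.hvx x hx01 t ht)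
    · have := min_le_left x (1 - x); linarith [hw.1]
    · have := min_le_right x (1 - x); linarith [hw.2]
  have hftc : ∫ t in s1..s2, P (y x t) * F x t = Φ (y x s2) - Φ (y x s1) := by
    refine intervalIntegral.integral_eq_sub_of_hasDerivAt (f := fun t => Φ (y x t)) (fun t ht => ?_) hI
    rw [uIcc_of_le hs] at ht
    have ht' : t ∈ Ioo 0 T := ⟨hs1.trans_le ht.1, ht.2.trans_lt hs2⟩
    have := h.hyt x hx01 t ht'
    rw [hv t ht', zero_add] at this
    exact (hc.Φd _).comp t this
  rw [hDe, hax]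
  rw [intervalIntegral.integral_of_le hs] at hftc
  simp [hftc]

lemma D_le (h : Dat a a' T y yx v F) (hc : Cvx Φ P R δ) {s1 s2 : ℝ} (hs1 : 0 < s1)
    (hs : s1 ≤ s2) (hs2 : s2 < T) {D : ℝ → ℝ}
    (hDe : ∀ x, D x = Φ (y x s2) - Φ (y x s1) -
      ((∫ t in Ioc s1 s2, P (y x t) * F x t) - ∫ t in Ioc s1 s2, R (y x t) * (a x * yx x t ^ 2))) :
    ∫ x in Ioo (0:ℝ) 1, D x ≤ 0 := by
  have hD := D_int h hc hDe
  obtain ⟨U, hU⟩ : ∃ U : Set ℝ, U = Ioo 0 1 ∩ {x | 0 < a x} := ⟨_, rfl⟩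
  have hUo : IsOpen U := hU ▸ isOpen_Ioo.inter (isOpen_lt continuous_const h.ac)
  have hUs : U ⊆ Ioo 0 1 := hU ▸ inter_subset_left
  have h1 : ∫ x in U, D x ≤ 0 := by
    refine sum_comp hUo hUs (hD.mono_set hUs) fun p q hpq hs' hp hq hp0 hq1 => ?_
    refine comp_le h hc hs1 hs hs2 hpq hp0 hq1 (fun x hx => ?_) ?_ ?_ hDe
    · have := hs' hx; rw [hU] at this; exact this.2
    · rcases hp0.eq_or_lt with h0 | h0
      · exact Or.inl h0.symm
      · refine Or.inr (Or.inr ⟨⟨h0, hpq.trans_le hq1⟩, ?_⟩)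
        by_contra hne
        exact hp (hU ▸ ⟨⟨h0, hpq.trans_le hq1⟩, (h.a0 p).lt_of_ne (Ne.symm hne)⟩)
    · rcases hq1.eq_or_lt with h0 | h0
      · exact Or.inr (Or.inl h0)
      · refine Or.inr (Or.inr ⟨⟨hp0.trans_lt hpq, h0⟩, ?_⟩)
        by_contra hne
        exact hq (hU ▸ ⟨⟨hp0.trans_lt hpq, h0⟩, (h.a0 q).lt_of_ne (Ne.symm hne)⟩)
  have h2 : ∫ x in Ioo (0:ℝ) 1, D x = ∫ x in U, D x := by
    refine setIntegral_eq_of_subset_of_ae_sdiff_eq_zero measurableSet_Ioo.nullMeasurableSet hUs ?_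
    filter_upwards [Z_zero h hc hs1 hs hs2 hDe] with x hx hxd
    refine hx hxd.1 ?_
    by_contra hne
    exact hxd.2 (hU ▸ ⟨hxd.1, (h.a0 x).lt_of_ne (Ne.symm hne)⟩)
  rw [h2]; exact h1

/-- Energy inequality for a convex truncation. -/
lemma cvx_energy (h : Dat a a' T y yx v F) (hc : Cvx Φ P R δ) {s1 s2 : ℝ} (hs1 : 0 < s1)
    (hs : s1 ≤ s2) (hs2 : s2 < T) :
    (∫ x in Ioo (0:ℝ) 1, Φ (y x s2)) - (∫ x in Ioo (0:ℝ) 1, Φ (y x s1)) +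
      ∫ p in Ioo (0:ℝ) 1 ×ˢ Ioo s1 s2, R (y p.1 p.2) * (a p.1 * yx p.1 p.2 ^ 2) ≤
    ∫ p in Ioo (0:ℝ) 1 ×ˢ Ioo s1 s2, P (y p.1 p.2) * F p.1 p.2 := by
  have key := D_le h hc hs1 hs hs2 (fun x => rfl)
  obtain ⟨n1, n2⟩ := N_int h hc (ψ := fun _ => 1) continuous_const 0 1 s1 s2
  simp only [one_mul] at n1 n2
  rw [IntegrableOn, Measure.volume_eq_prod, ← Measure.prod_restrict, restrict_Ioo_eq_restrict_Ioc.symm] at n1 n2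
  have hyl : ∀ t, IntegrableOn (fun x => Φ (y x t)) (Ioo 0 1) := fun t => by
    have : Continuous fun x => Φ (y x t) :=
      hc.Φc.comp (h.yc.comp (continuous_id.prodMk continuous_const))
    exact (this.intervalIntegrable 0 1).1.mono_set Ioo_subset_Ioc_self
  have m1 := n1.integral_prod_left
  have m2 := n2.integral_prod_left
  rw [Measure.volume_eq_prod, ← Measure.prod_restrict, restrict_Ioo_eq_restrict_Ioc (a := s1), integral_prod _ n1, integral_prod _ n2]
  have i12 : IntegrableOn (fun x => Φ (y x s2) - Φ (y x s1)) (Ioo 0 1) := (hyl s2).sub (hyl s1)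
  have i34 : IntegrableOn (fun x => (∫ t in Ioc s1 s2, P (y x t) * F x t) -
        ∫ t in Ioc s1 s2, R (y x t) * (a x * yx x t ^ 2)) (Ioo 0 1) := m1.sub m2
  rw [integral_sub i12 i34, integral_sub (hyl s2) (hyl s1), integral_sub m1 m2] at key
  linarith

end

noncomputable def Rf (δ r : ℝ) : ℝ := min 1 (max 0 (|r| / δ - 1))
noncomputable def Pf (δ r : ℝ) : ℝ := ∫ u in (0:ℝ)..r, Rf δ u
noncomputable def Phf (δ r : ℝ) : ℝ := ∫ u in (0:ℝ)..r, Pf δ u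

lemma Rf_cont (δ : ℝ) : Continuous (Rf δ) := by
  unfold Rf; fun_prop

lemma Rf_nonneg (δ r : ℝ) : 0 ≤ Rf δ r := le_min zero_le_one (le_max_left _ _)
lemma Rf_le (δ r : ℝ) : Rf δ r ≤ 1 := min_le_left _ _

lemma Pf_deriv (δ r : ℝ) : HasDerivAt (Pf δ) (Rf δ r) r :=
  ((Rf_cont δ).integral_hasStrictDerivAt 0 r).hasDerivAt

lemma Pf_cont (δ : ℝ) : Continuous (Pf δ) :=
  continuous_iff_continuousAt.2 fun x => (Pf_deriv δ x).continuousAt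

lemma Phf_deriv (δ r : ℝ) : HasDerivAt (Phf δ) (Pf δ r) r :=
  ((Pf_cont δ).integral_hasStrictDerivAt 0 r).hasDerivAt

lemma Pf_mono (δ : ℝ) : Monotone (Pf δ) :=
  monotone_of_hasDerivAt_nonneg (fun x => Pf_deriv δ x) (fun x => Rf_nonneg δ x)

lemma Pf_abs (δ r : ℝ) : |Pf δ r| ≤ |r| := by
  have := intervalIntegral.norm_integral_le_of_norm_le_const (a := 0) (b := r) (f := Rf δ) (C := 1)
    (fun x _ => by rw [Real.norm_of_nonneg (Rf_nonneg _ _)]; exact Rf_le _ _)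
  simp only [sub_zero, one_mul] at this
  exact this

lemma Phf_abs (δ r : ℝ) : |Phf δ r| ≤ r ^ 2 := by
  have := intervalIntegral.norm_integral_le_of_norm_le_const (a := 0) (b := r) (f := Pf δ) (C := |r|)
    (fun x hx => by
      refine (Pf_abs δ x).trans ?_
      rcases le_total 0 r with h | h
      · rw [uIoc_of_le h] at hx
        rw [abs_of_pos hx.1, abs_of_nonneg h]; exact hx.2
      · rw [uIoc_of_ge h] at hx
        rw [abs_of_nonpos hx.2, abs_of_nonpos h]; linarith [hx.1])
  rw [sub_zero, ← sq, sq_abs] at this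
  exact this

lemma cvx_f {δ : ℝ} (hδ : 0 < δ) : Cvx (Phf δ) (Pf δ) (Rf δ) δ where
  δ0 := hδ
  Φd := Phf_deriv δ
  Pd := Pf_deriv δ
  Rc := Rf_cont δ
  R0 := Rf_nonneg δ
  conv := by
    intro u w
    have hc : Continuous (Phf δ) :=
      continuous_iff_continuousAt.2 fun x => (Phf_deriv δ x).continuousAt
    rcases lt_trichotomy w u with h | h | h
    · obtain ⟨c, hc1, hc2⟩ := exists_hasDerivAt_eq_slope (Phf δ) (Pf δ) h hc.continuousOn
        (fun x _ => Phf_deriv δ x)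
      have h1 := Pf_mono δ hc1.2.le
      rw [hc2, div_le_iff₀ (by linarith)] at h1
      exact h1
    · simp [h]
    · obtain ⟨c, hc1, hc2⟩ := exists_hasDerivAt_eq_slope (Phf δ) (Pf δ) h hc.continuousOn
        (fun x _ => Phf_deriv δ x)
      have h1 := Pf_mono δ hc1.1.le
      rw [hc2, le_div_iff₀ (by linarith)] at h1
      linarith
  Pz := by
    intro r hr
    have h0 : ∀ u, |u| ≤ δ → Rf δ u = 0 := fun u hu => by
      have : |u| / δ - 1 ≤ 0 := by rw [sub_nonpos, div_le_one hδ]; exact hu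
      rw [Rf, max_eq_left this, min_eq_right zero_le_one]
    rw [Pf, intervalIntegral.integral_congr (g := fun _ => 0), intervalIntegral.integral_zero]
    intro u hu
    refine h0 u (le_trans ?_ hr)
    rcases le_total 0 r with h | h
    · rw [uIcc_of_le h] at hu
      rw [abs_of_nonneg hu.1, abs_of_nonneg h]; exact hu.2
    · rw [uIcc_of_ge h] at hu
      rw [abs_of_nonpos hu.2, abs_of_nonpos h]; linarith [hu.1]

lemma Rf_lim {r : ℝ} (hr : r ≠ 0) :
    Filter.Tendsto (fun δ => Rf δ r) (nhdsWithin 0 (Ioi 0)) (nhds 1) := by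
  refine Filter.Tendsto.congr' (f₁ := fun _ => (1:ℝ)) ?_ tendsto_const_nhds
  filter_upwards [Ioo_mem_nhdsGT (show 0 < |r| / 2 by positivity)] with δ hδ
  have : 2 ≤ |r| / δ := by rw [le_div_iff₀ hδ.1]; linarith [hδ.2]
  rw [Rf, max_eq_right (by linarith), min_eq_left (by linarith)]

lemma Pf_lim (r : ℝ) : Filter.Tendsto (fun δ => Pf δ r) (nhdsWithin 0 (Ioi 0)) (nhds r) := by
  have h1 : Filter.Tendsto (fun δ => ∫ u in (0:ℝ)..r, Rf δ u) (nhdsWithin 0 (Ioi 0))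
      (nhds (∫ u in (0:ℝ)..r, (1:ℝ))) := by
    refine intervalIntegral.tendsto_integral_filter_of_dominated_convergence (fun _ => 1)
      (Filter.Eventually.of_forall fun δ => (Rf_cont δ).aestronglyMeasurable)
      (Filter.Eventually.of_forall fun δ => Filter.Eventually.of_forall fun x _ => ?_)
      intervalIntegrable_const ?_
    · rw [Real.norm_of_nonneg (Rf_nonneg _ _)]; exact Rf_le _ _
    · have : ∀ᵐ x : ℝ, x ≠ 0 := by simp [ae_iff]
      filter_upwards [this] with x hx _ using Rf_lim hx
  simp only [intervalIntegral.integral_const, sub_zero, smul_eq_mul, mul_one] at h1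
  exact h1

lemma Phf_lim (r : ℝ) : Filter.Tendsto (fun δ => Phf δ r) (nhdsWithin 0 (Ioi 0)) (nhds (r ^ 2 / 2)) := by
  have h1 : Filter.Tendsto (fun δ => ∫ u in (0:ℝ)..r, Pf δ u) (nhdsWithin 0 (Ioi 0))
      (nhds (∫ u in (0:ℝ)..r, u)) := by
    refine intervalIntegral.tendsto_integral_filter_of_dominated_convergence (fun u => |u|)
      (Filter.Eventually.of_forall fun δ => (Pf_cont δ).aestronglyMeasurable)
      (Filter.Eventually.of_forall fun δ => Filter.Eventually.of_forall fun x _ => Pf_abs δ x)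
      (continuous_abs.intervalIntegrable _ _) (Filter.Eventually.of_forall fun x _ => Pf_lim x)
  rw [integral_id, zero_pow two_ne_zero, sub_zero] at h1
  exact h1

lemma lev_null {u ux : ℝ → ℝ} {s : Set ℝ} (h : ∀ x ∈ s, HasDerivAt u (ux x) x) :
    {x | x ∈ s ∧ u x = 0 ∧ ux x ≠ 0}.Countable := by
  refine (countable_setOfPred_isolated_right_within (s := {x | x ∈ s ∧ u x = 0 ∧ ux x ≠ 0})).mono ?_
  intro x hx
  refine ⟨hx, ?_⟩
  have h1 := (h x hx.1).eventually_ne (c := 0) hx.2.2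
  rw [eventually_nhdsWithin_iff] at h1
  rw [← Filter.empty_mem_iff_bot]
  filter_upwards [self_mem_nhdsWithin, mem_nhdsWithin_of_mem_nhds h1] with w hw hw2
  have hw3 : x < w := hw.2
  exact hw2 hw3.ne' hw.1.2.1

section
variable {a a' : ℝ → ℝ} {T : ℝ} {y yx v F : ℝ → ℝ → ℝ}

lemma lev_ae (h : Dat a a' T y yx v F) {s1 s2 : ℝ} (hs1 : 0 < s1) (hs2 : s2 < T) :
    ∀ᵐ p ∂(volume.restrict (Ioo (0:ℝ) 1 ×ˢ Ioo s1 s2)), y p.1 p.2 = 0 → yx p.1 p.2 = 0 := by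
  rw [ae_restrict_iff' (measurableSet_Ioo.prod measurableSet_Ioo), ae_iff]
  have hm : MeasurableSet {p : ℝ × ℝ | p ∈ Ioo (0:ℝ) 1 ×ˢ Ioo s1 s2 ∧ (y p.1 p.2 = 0 ∧ yx p.1 p.2 ≠ 0)} := by
    refine (measurableSet_Ioo.prod measurableSet_Ioo).inter (MeasurableSet.inter ?_ ?_)
    · exact h.yc.measurable (measurableSet_singleton 0)
    · exact (h.yxm (measurableSet_singleton 0)).compl
  have he : {p : ℝ × ℝ | ¬ (p ∈ Ioo (0:ℝ) 1 ×ˢ Ioo s1 s2 → y p.1 p.2 = 0 → yx p.1 p.2 = 0)} =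
      {p : ℝ × ℝ | p ∈ Ioo (0:ℝ) 1 ×ˢ Ioo s1 s2 ∧ (y p.1 p.2 = 0 ∧ yx p.1 p.2 ≠ 0)} := by
    ext p; simp only [mem_ofPred_eq, Classical.not_imp, ne_eq]
  rw [he, Measure.volume_eq_prod, Measure.prod_apply_symm hm, lintegral_eq_zero_iff
    (measurable_measure_prodMk_right hm)]
  refine Filter.Eventually.of_forall fun t => ?_
  by_cases ht : t ∈ Ioo s1 s2
  · have hc := lev_null (s := Ioo (0:ℝ) 1) (u := fun x => y x t) (ux := fun x => yx x t)
      (fun x hx => h.hyx x hx t ⟨hs1.trans ht.1, ht.2.trans hs2⟩)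
    refine measure_mono_null ?_ (hc.measure_zero volume)
    rintro x ⟨hx1, hx2⟩
    exact ⟨hx1.1, hx2⟩
  · have : (fun x => (x, t)) ⁻¹' {p : ℝ × ℝ | p ∈ Ioo (0:ℝ) 1 ×ˢ Ioo s1 s2 ∧
        (y p.1 p.2 = 0 ∧ yx p.1 p.2 ≠ 0)} = ∅ := by
      rw [eq_empty_iff_forall_notMem]
      rintro x ⟨hx1, _⟩
      exact ht hx1.2
    simp only [this, measure_empty, Pi.zero_apply]

lemma yF_int (h : Dat a a' T y yx v F) (s1 s2 : ℝ) :
    IntegrableOn (fun p : ℝ × ℝ => y p.1 p.2 * F p.1 p.2) (Ioo 0 1 ×ˢ Ioo s1 s2) :=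
  (contL2_int h.yc h.FL 0 1 s1 s2).mono_set (prod_mono Ioo_subset_Ioc_self Ioo_subset_Ioc_self)

lemma ysq_int (h : Dat a a' T y yx v F) (t : ℝ) : IntegrableOn (fun x => y x t ^ 2) (Ioo 0 1) := by
  have : Continuous fun x => y x t ^ 2 :=
    (h.yc.comp (continuous_id.prodMk continuous_const)).pow 2
  exact (this.intervalIntegrable 0 1).1.mono_set Ioo_subset_Ioc_self

lemma energy_pos (h : Dat a a' T y yx v F) {s1 s2 : ℝ} (hs1 : 0 < s1)
    (hs : s1 ≤ s2) (hs2 : s2 < T) :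
    (∫ x in Ioo (0:ℝ) 1, y x s2 ^ 2 / 2) - (∫ x in Ioo (0:ℝ) 1, y x s1 ^ 2 / 2) +
      ∫ p in Ioo (0:ℝ) 1 ×ˢ Ioo s1 s2, a p.1 * yx p.1 p.2 ^ 2 ≤
    ∫ p in Ioo (0:ℝ) 1 ×ˢ Ioo s1 s2, y p.1 p.2 * F p.1 p.2 := by
  have l1 : ∀ t, Filter.Tendsto (fun δ => ∫ x in Ioo (0:ℝ) 1, Phf δ (y x t)) (nhdsWithin 0 (Ioi 0))
      (nhds (∫ x in Ioo (0:ℝ) 1, y x t ^ 2 / 2)) := fun t => by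
    refine tendsto_integral_filter_of_dominated_convergence (fun x => y x t ^ 2) ?_ ?_ (ysq_int h t) ?_
    · filter_upwards [self_mem_nhdsWithin] with δ hδ
      exact ((cvx_f hδ).Φc.comp (h.yc.comp (continuous_id.prodMk continuous_const))).aestronglyMeasurable
    · exact Filter.Eventually.of_forall fun δ => Filter.Eventually.of_forall fun x => Phf_abs _ _
    · exact Filter.Eventually.of_forall fun x => Phf_lim _
  have l2 : Filter.Tendsto (fun δ => ∫ p in Ioo (0:ℝ) 1 ×ˢ Ioo s1 s2,
      Rf δ (y p.1 p.2) * (a p.1 * yx p.1 p.2 ^ 2)) (nhdsWithin 0 (Ioi 0))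
      (nhds (∫ p in Ioo (0:ℝ) 1 ×ˢ Ioo s1 s2, a p.1 * yx p.1 p.2 ^ 2)) := by
    refine tendsto_integral_filter_of_dominated_convergence (fun p => ‖a p.1 * yx p.1 p.2 ^ 2‖)
      (Filter.Eventually.of_forall fun δ => ?_)
      (Filter.Eventually.of_forall fun δ => Filter.Eventually.of_forall fun p => ?_)
      h.wsq.norm.integrableOn ?_
    · exact ((Rf_cont δ).comp h.yc).aestronglyMeasurable.mul h.wsq.aestronglyMeasurable.restrict
    · rw [norm_mul, Real.norm_of_nonneg (Rf_nonneg _ _)]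
      exact mul_le_of_le_one_left (norm_nonneg _) (Rf_le _ _)
    · filter_upwards [lev_ae h hs1 hs2] with p hp
      by_cases h0 : y p.1 p.2 = 0
      · simp only [hp h0, ne_eq, OfNat.ofNat_ne_zero, not_false_eq_true, zero_pow, mul_zero]
        exact tendsto_const_nhds
      · have := (Rf_lim h0).mul_const (a p.1 * yx p.1 p.2 ^ 2)
        rwa [one_mul] at this
  have l3 : Filter.Tendsto (fun δ => ∫ p in Ioo (0:ℝ) 1 ×ˢ Ioo s1 s2,
      Pf δ (y p.1 p.2) * F p.1 p.2) (nhdsWithin 0 (Ioi 0))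
      (nhds (∫ p in Ioo (0:ℝ) 1 ×ˢ Ioo s1 s2, y p.1 p.2 * F p.1 p.2)) := by
    refine tendsto_integral_filter_of_dominated_convergence (fun p => ‖y p.1 p.2 * F p.1 p.2‖)
      (Filter.Eventually.of_forall fun δ => ?_)
      (Filter.Eventually.of_forall fun δ => Filter.Eventually.of_forall fun p => ?_)
      (yF_int h s1 s2).norm (Filter.Eventually.of_forall fun p => (Pf_lim _).mul_const _)
    · exact ((Pf_cont δ).comp h.yc).aestronglyMeasurable.mul h.Fm.aestronglyMeasurable
    · rw [norm_mul, norm_mul]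
      exact mul_le_mul_of_nonneg_right (Pf_abs _ _) (norm_nonneg _)
  exact le_of_tendsto_of_tendsto (((l1 s2).sub (l1 s1)).add l2) l3 (by
    filter_upwards [self_mem_nhdsWithin] with δ hδ using cvx_energy h (cvx_f hδ) hs1 hs hs2)

lemma lim_rect {f : ℝ × ℝ → ℝ} {s2 : ℝ} (hf : IntegrableOn f (Ioo (0:ℝ) 1 ×ˢ Ioo 0 s2)) :
    Filter.Tendsto (fun s => ∫ p in Ioo (0:ℝ) 1 ×ˢ Ioo s s2, f p) (nhdsWithin 0 (Ioi 0))
      (nhds (∫ p in Ioo (0:ℝ) 1 ×ˢ Ioo 0 s2, f p)) := by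
  have hS : ∀ s, MeasurableSet (Ioo (0:ℝ) 1 ×ˢ Ioo s s2) := fun s =>
    measurableSet_Ioo.prod measurableSet_Ioo
  have hL : Filter.Tendsto (fun s => ∫ p in Ioo (0:ℝ) 1 ×ˢ Ioo 0 s2, (Ioo (0:ℝ) 1 ×ˢ Ioo s s2).indicator f p)
      (nhdsWithin 0 (Ioi 0)) (nhds (∫ p in Ioo (0:ℝ) 1 ×ˢ Ioo 0 s2, f p)) := by
    refine tendsto_integral_filter_of_dominated_convergence (fun p => ‖f p‖)
      (Filter.Eventually.of_forall fun s => hf.aestronglyMeasurable.indicator (hS s))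
      (Filter.Eventually.of_forall fun s => Filter.Eventually.of_forall fun p =>
        norm_indicator_le_norm_self _ _) hf.norm ?_
    refine (ae_restrict_iff' (hS 0)).2 (Filter.Eventually.of_forall fun p hp => ?_)
    refine Filter.Tendsto.congr' (f₁ := fun _ => f p) ?_ tendsto_const_nhds
    filter_upwards [Ioo_mem_nhdsGT hp.2.1] with s hs
    have hm : p ∈ Ioo (0:ℝ) 1 ×ˢ Ioo s s2 := ⟨hp.1, hs.2, hp.2.2⟩
    rw [indicator_of_mem hm]
  refine hL.congr' ?_
  filter_upwards [self_mem_nhdsWithin] with s hs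
  rw [setIntegral_indicator (hS s), inter_eq_self_of_subset_right]
  exact prod_mono subset_rfl (Ioo_subset_Ioo_left (le_of_lt hs))

/-- Energy inequality for cleaned data, starting from time zero. -/
lemma energy_zero (h : Dat a a' T y yx v F) {s2 : ℝ} (hs : 0 ≤ s2) (hs2 : s2 < T) :
    (∫ x in Ioo (0:ℝ) 1, y x s2 ^ 2 / 2) +
      ∫ p in Ioo (0:ℝ) 1 ×ˢ Ioo 0 s2, a p.1 * yx p.1 p.2 ^ 2 ≤
    (∫ x in Ioo (0:ℝ) 1, y x 0 ^ 2 / 2) +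
      ∫ p in Ioo (0:ℝ) 1 ×ˢ Ioo 0 s2, y p.1 p.2 * F p.1 p.2 := by
  rcases hs.eq_or_lt with rfl | hs
  · simp
  have hcont : Continuous fun s => ∫ x in Ioo (0:ℝ) 1, y x s ^ 2 / 2 := by
    have : Continuous fun s => ∫ x in (0:ℝ)..1, y x s ^ 2 / 2 := by
      refine intervalIntegral.continuous_parametric_intervalIntegral_of_continuous' 
        (f := fun s x => y x s ^ 2 / 2) ?_ 0 1
      exact ((h.yc.comp continuous_swap).pow 2).div_const 2
    simpa only [intervalIntegral.integral_of_le zero_le_one, restrict_Ioo_eq_restrict_Ioc] using this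
  have l1 := (hcont.tendsto 0).mono_left (nhdsWithin_le_nhds (s := Ioi (0:ℝ)))
  have l2 := lim_rect (s2 := s2) h.wsq.integrableOn
  have l3 := lim_rect (yF_int h 0 s2)
  have := le_of_tendsto_of_tendsto ((l1.const_sub (∫ x in Ioo (0:ℝ) 1, y x s2 ^ 2 / 2)).add l2) l3 (by
    filter_upwards [Ioo_mem_nhdsGT hs] with s1 hs1 using energy_pos h hs1.1 hs1.2.le hs2)
  linarith
end

lemma meas_dx {g g' : ℝ × ℝ → ℝ} {s : Set (ℝ × ℝ)} (hs : MeasurableSet s) (hg : Measurable g)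
    (h : ∀ p ∈ s, HasDerivAt (fun w => g (w, p.2)) (g' p) p.1) (h0 : ∀ p ∉ s, g' p = 0) :
    Measurable g' := by
  have hu : Filter.Tendsto (fun n : ℕ => 1 / ((n:ℝ) + 1)) Filter.atTop (nhdsWithin 0 {0}ᶜ) :=
    tendsto_nhdsWithin_iff.2 ⟨tendsto_one_div_add_atTop_nhds_zero_nat,
      Filter.Eventually.of_forall fun n => by
        have : (1:ℝ) / ((n:ℝ) + 1) ≠ 0 := by positivity
        simpa using this⟩
  refine measurable_of_tendsto_metrizable (f := fun (n : ℕ) p => s.indicator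
    (fun p : ℝ × ℝ => (1 / ((n:ℝ) + 1))⁻¹ * (g (p.1 + 1 / ((n:ℝ) + 1), p.2) - g p)) p) (fun n => ?_) ?_
  · refine Measurable.indicator ?_ hs
    refine Measurable.const_mul ?_ _
    exact (hg.comp ((measurable_fst.add_const _).prodMk measurable_snd)).sub hg
  · rw [tendsto_pi_nhds]
    intro p
    by_cases hp : p ∈ s
    · simp only [indicator_of_mem hp]
      have := ((h p hp).tendsto_slope_zero).comp hu
      simpa only [Function.comp_def, smul_eq_mul] using this
    · simp only [indicator_of_notMem hp, h0 p hp]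
      exact tendsto_const_nhds

lemma meas_dt {g g' : ℝ × ℝ → ℝ} {s : Set (ℝ × ℝ)} (hs : MeasurableSet s) (hg : Measurable g)
    (h : ∀ p ∈ s, HasDerivAt (fun w => g (p.1, w)) (g' p) p.2) (h0 : ∀ p ∉ s, g' p = 0) :
    Measurable g' := by
  have := meas_dx (g := g ∘ Prod.swap) (g' := g' ∘ Prod.swap) (s := Prod.swap ⁻¹' s)
    (measurable_swap hs) (hg.comp measurable_swap) (fun p hp => h _ hp) (fun p hp => h0 _ hp)
  simpa [Function.comp_def] using this.comp measurable_swap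

/-- Time rescaling. -/
lemma time_change {b : ℝ → ℝ} (hb : Continuous b) {m : ℝ} (hm : 0 < m) (hbm : ∀ t, m ≤ b t) :
    ∃ θ : ℝ ≃o ℝ, θ 0 = 0 ∧ (∀ t, HasDerivAt θ (b t) t) ∧ Continuous θ.symm ∧
      ∀ σ, HasDerivAt θ.symm (b (θ.symm σ))⁻¹ σ := by
  obtain ⟨f, hf⟩ : ∃ f : ℝ → ℝ, ∀ t, f t = ∫ u in (0:ℝ)..t, b u := ⟨_, fun _ => rfl⟩
  have hd : ∀ t, HasDerivAt f (b t) t := fun t => by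
    rw [funext hf]; exact (hb.integral_hasStrictDerivAt 0 t).hasDerivAt
  have hfc : Continuous f := continuous_iff_continuousAt.2 fun t => (hd t).continuousAt
  have hmono : StrictMono f := strictMono_of_hasDerivAt_pos hd fun t => hm.trans_le (hbm t)
  have hmm : Monotone fun t => f t - m * t := by
    refine monotone_of_hasDerivAt_nonneg (f' := fun t => b t - m * 1)
      (fun t => (hd t).sub ((hasDerivAt_id t).const_mul m)) (fun t => ?_)
    have := hbm t
    simp only [Pi.zero_apply]; linarith
  have h0 : f 0 = 0 := by rw [hf]; simp
  have hsurj : Function.Surjective f := by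
    refine hfc.surjective ?_ ?_
    · refine Filter.tendsto_atTop_mono' _ ?_ (Filter.tendsto_id.const_mul_atTop hm)
      filter_upwards [Filter.eventually_ge_atTop 0] with t ht
      have := hmm ht; simp only [h0] at this; simp only [id]; linarith
    · refine Filter.tendsto_atBot_mono' _ ?_ (Filter.tendsto_id.const_mul_atBot hm)
      filter_upwards [Filter.eventually_le_atBot 0] with t ht
      have := hmm ht; simp only [h0] at this; simp only [id]; linarith
  obtain ⟨θ, hθ⟩ : ∃ θ : ℝ ≃o ℝ, (θ : ℝ → ℝ) = f := ⟨hmono.orderIsoOfSurjective f hsurj, rfl⟩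
  refine ⟨θ, by rw [hθ, h0], fun t => by rw [hθ]; exact hd t, θ.symm.continuous, fun σ => ?_⟩
  refine HasDerivAt.of_local_left_inverse (f := θ) θ.symm.continuous.continuousAt (by rw [hθ]; exact hd _)
    (hm.trans_le (hbm _)).ne' (Filter.Eventually.of_forall fun σ => θ.apply_symm_apply σ)

/-- Change of variables `(x,t) ↦ (x, θ t)`. -/
lemma cov {b : ℝ → ℝ} (hb : ∀ t, 0 < b t) (θ : ℝ ≃o ℝ) (h0 : θ 0 = 0)
    (hd : ∀ t, HasDerivAt θ (b t) t) (g : ℝ × ℝ → ℝ) (S : ℝ) :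
    (∫ p in Ioo (0:ℝ) 1 ×ˢ Ioo 0 (θ S), g p = ∫ p in Ioo (0:ℝ) 1 ×ˢ Ioo 0 S, b p.2 * g (p.1, θ p.2)) ∧
    (IntegrableOn g (Ioo (0:ℝ) 1 ×ˢ Ioo 0 (θ S)) ↔
      IntegrableOn (fun p => b p.2 * g (p.1, θ p.2)) (Ioo (0:ℝ) 1 ×ˢ Ioo 0 S)) := by
  obtain ⟨f, hf⟩ : ∃ f : ℝ × ℝ → ℝ × ℝ, f = Prod.map id θ := ⟨_, rfl⟩
  obtain ⟨f', hf'⟩ : ∃ f' : ℝ × ℝ → (ℝ × ℝ →L[ℝ] ℝ × ℝ), ∀ p, f' p =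
    (ContinuousLinearMap.id ℝ ℝ).prodMap (b p.2 • ContinuousLinearMap.id ℝ ℝ) := ⟨_, fun _ => rfl⟩
  have him : f '' (Ioo (0:ℝ) 1 ×ˢ Ioo 0 S) = Ioo (0:ℝ) 1 ×ˢ Ioo 0 (θ S) := by
    rw [hf, prodMap_image_prod, image_id, OrderIso.image_Ioo, h0]
  have hdet : ∀ p, |(f' p).det| = b p.2 := fun p => by
    rw [hf', ContinuousLinearMap.det, ContinuousLinearMap.coe_prodMap, LinearMap.det_prodMap]
    simp [abs_of_pos (hb p.2)]
  have hS : MeasurableSet (Ioo (0:ℝ) 1 ×ˢ Ioo 0 S) := measurableSet_Ioo.prod measurableSet_Ioo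
  have hfd : ∀ p ∈ Ioo (0:ℝ) 1 ×ˢ Ioo 0 S, HasFDerivWithinAt f (f' p) (Ioo (0:ℝ) 1 ×ˢ Ioo 0 S) p := by
    intro p _
    rw [hf, hf']
    refine HasFDerivAt.hasFDerivWithinAt ?_
    refine HasFDerivAt.prodMap p (hasFDerivAt_id p.1) ?_
    have := (hd p.2).hasFDerivAt
    have e : b p.2 • ContinuousLinearMap.id ℝ ℝ = ContinuousLinearMap.toSpanSingleton ℝ (b p.2) := by
      ext; simp
    rw [e]
    exact this
  have hinj : InjOn f (Ioo (0:ℝ) 1 ×ˢ Ioo 0 S) := by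
    rw [hf]
    exact (Function.injective_id.prodMap θ.injective).injOn
  have e1 := integral_image_eq_integral_abs_det_fderiv_smul volume hS hfd hinj g
  have e2 := integrableOn_image_iff_integrableOn_abs_det_fderiv_smul volume hS hfd hinj g
  rw [him] at e1 e2
  simp only [hdet, smul_eq_mul, hf, Prod.map, id] at e1 e2
  exact ⟨e1, e2⟩

set_option maxHeartbeats 2000000 in
/-- Energy inequality for raw data on a closed rectangle, with a time-dependent diffusion. -/
lemma raw_energy {a a' : ℝ → ℝ} (ha_cont : ContinuousOn a (Icc 0 1))
    (ha_nonneg : ∀ x ∈ Icc (0:ℝ) 1, 0 ≤ a x)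
    (ha_deriv : ∀ x ∈ Ioc (0:ℝ) 1, HasDerivAt a (a' x) x)
    (ha'_cont : ContinuousOn a' (Ioc 0 1)) {S m : ℝ} (hS : 0 < S) (hm : 0 < m) {b : ℝ → ℝ}
    (hbc : ContinuousOn b (Icc 0 S)) (hbm : ∀ t ∈ Icc 0 S, m ≤ b t) {y yx v F : ℝ → ℝ → ℝ}
    (hyc : ContinuousOn (fun p : ℝ × ℝ => y p.1 p.2) (Icc 0 1 ×ˢ Icc 0 S))
    (hyx : ∀ x ∈ Ioo (0:ℝ) 1, ∀ t ∈ Ioo 0 S, HasDerivAt (fun w => y w t) (yx x t) x)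
    (hvx : ∀ x ∈ Ioo (0:ℝ) 1, ∀ t ∈ Ioo 0 S, HasDerivAt (fun w => a w * yx w t) (v x t) x)
    (hyt : ∀ x ∈ Ioo (0:ℝ) 1, ∀ t ∈ Ioo 0 S, HasDerivAt (fun u => y x u) (b t * v x t + F x t) t)
    (hy0 : ∀ t ∈ Icc 0 S, y 0 t = 0) (hy1 : ∀ t ∈ Icc 0 S, y 1 t = 0)
    (hw : IntegrableOn (fun p : ℝ × ℝ => a p.1 * yx p.1 p.2 ^ 2) (Ioo 0 1 ×ˢ Ioo 0 S))
    {H : ℝ × ℝ → ℝ} (hH : IntegrableOn H (Ioo 0 1 ×ˢ Ioo 0 S))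
    (hFH : ∀ p ∈ Ioo (0:ℝ) 1 ×ˢ Ioo 0 S, F p.1 p.2 ^ 2 ≤ H p) {t : ℝ} (ht : t ∈ Ico 0 S) :
    (∫ x in Ioo (0:ℝ) 1, y x t ^ 2 / 2) +
      ∫ p in Ioo (0:ℝ) 1 ×ˢ Ioo 0 t, b p.2 * (a p.1 * yx p.1 p.2 ^ 2) ≤
    (∫ x in Ioo (0:ℝ) 1, y x 0 ^ 2 / 2) +
      ∫ p in Ioo (0:ℝ) 1 ×ˢ Ioo 0 t, y p.1 p.2 * F p.1 p.2 := by
  classical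
  -- clamps
  obtain ⟨cS, hcS⟩ : ∃ cS : ℝ → ℝ, ∀ t, cS t = max 0 (min S t) := ⟨_, fun _ => rfl⟩
  obtain ⟨c1, hc1⟩ : ∃ c1 : ℝ → ℝ, ∀ t, c1 t = max 0 (min 1 t) := ⟨_, fun _ => rfl⟩
  have hcSm : ∀ t, cS t ∈ Icc 0 S := fun t => by
    rw [hcS]; exact ⟨le_max_left _ _, max_le hS.le (min_le_left _ _)⟩
  have hc1m : ∀ t, c1 t ∈ Icc (0:ℝ) 1 := fun t => by
    rw [hc1]; exact ⟨le_max_left _ _, max_le zero_le_one (min_le_left _ _)⟩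
  have hcSe : ∀ t ∈ Icc 0 S, cS t = t := fun t ht => by
    rw [hcS, min_eq_right ht.2, max_eq_right ht.1]
  have hc1e : ∀ t ∈ Icc (0:ℝ) 1, c1 t = t := fun t ht => by
    rw [hc1, min_eq_right ht.2, max_eq_right ht.1]
  have hcSc : Continuous cS := by
    rw [funext hcS]; exact continuous_const.max (continuous_const.min continuous_id)
  have hc1c : Continuous c1 := by
    rw [funext hc1]; exact continuous_const.max (continuous_const.min continuous_id)
  obtain ⟨B, hB⟩ : ∃ B : ℝ → ℝ, ∀ t, B t = b (cS t) := ⟨_, fun _ => rfl⟩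
  have hBc : Continuous B := by rw [funext hB]; exact hbc.comp_continuous hcSc hcSm
  have hBm : ∀ t, m ≤ B t := fun t => by rw [hB]; exact hbm _ (hcSm t)
  have hBp : ∀ t, 0 < B t := fun t => hm.trans_le (hBm t)
  have hBe : ∀ t ∈ Icc 0 S, B t = b t := fun t ht => by rw [hB, hcSe t ht]
  obtain ⟨M, hM⟩ := isCompact_Icc.exists_bound_of_continuousOn hbc
  have hBM : ∀ t, ‖B t‖ ≤ M := fun t => by rw [hB]; exact hM _ (hcSm t)
  obtain ⟨θ, hθ0, hθd, hρc, hρd⟩ := time_change hBc hm hBm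
  obtain ⟨ρ, hρ⟩ : ∃ ρ : ℝ → ℝ, ρ = θ.symm := ⟨_, rfl⟩
  rw [← hρ] at hρc
  have hρθ : ∀ t, ρ (θ t) = t := fun t => by rw [hρ]; exact θ.symm_apply_apply t
  have hρm : ∀ σ ∈ Ioo 0 (θ S), ρ σ ∈ Ioo 0 S := fun σ hσ => by
    rw [hρ]
    constructor
    · rw [θ.lt_symm_apply, hθ0]; exact hσ.1
    · rw [θ.symm_apply_lt]; exact hσ.2
  obtain ⟨A, hA⟩ : ∃ A : ℝ → ℝ, ∀ x, A x = a (c1 x) := ⟨_, fun _ => rfl⟩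
  have hAe : ∀ x ∈ Icc (0:ℝ) 1, A x = a x := fun x hx => by rw [hA, hc1e x hx]
  have hAc : Continuous A := by rw [funext hA]; exact ha_cont.comp_continuous hc1c hc1m
  have hA0 : ∀ x, 0 ≤ A x := fun x => by rw [hA]; exact ha_nonneg _ (hc1m x)
  obtain ⟨Y, hY⟩ : ∃ Y : ℝ → ℝ → ℝ, ∀ x σ, Y x σ = y (c1 x) (cS (ρ σ)) := ⟨_, fun _ _ => rfl⟩
  have hYc : Continuous fun p : ℝ × ℝ => Y p.1 p.2 := by
    simp only [hY]
    exact hyc.comp_continuous ((hc1c.comp continuous_fst).prodMk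
      (hcSc.comp (hρc.comp continuous_snd))) (fun p => ⟨hc1m _, hcSm _⟩)
  have hYe : ∀ x ∈ Icc (0:ℝ) 1, ∀ t ∈ Icc 0 S, Y x (θ t) = y x t := fun x hx t ht => by
    rw [hY, hρθ, hc1e x hx, hcSe t ht]
  obtain ⟨R, hR⟩ : ∃ R : Set (ℝ × ℝ), R = Ioo (0:ℝ) 1 ×ˢ Ioo 0 (θ S) := ⟨_, rfl⟩
  have hRm : MeasurableSet R := hR ▸ measurableSet_Ioo.prod measurableSet_Ioo
  obtain ⟨Yx, hYx⟩ : ∃ Yx : ℝ → ℝ → ℝ, ∀ x σ, Yx x σ = if (x, σ) ∈ R then yx x (ρ σ) else 0 :=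
    ⟨_, fun _ _ => rfl⟩
  obtain ⟨V, hV⟩ : ∃ V : ℝ → ℝ → ℝ, ∀ x σ, V x σ = if (x, σ) ∈ R then v x (ρ σ) else 0 :=
    ⟨_, fun _ _ => rfl⟩
  obtain ⟨G, hG⟩ : ∃ G : ℝ → ℝ → ℝ, ∀ x σ, G x σ =
    if (x, σ) ∈ R then (B (ρ σ))⁻¹ * F x (ρ σ) else 0 := ⟨_, fun _ _ => rfl⟩
  have hmem : ∀ {x σ}, x ∈ Ioo (0:ℝ) 1 → σ ∈ Ioo 0 (θ S) → (x, σ) ∈ R := fun hx hσ => hR ▸ ⟨hx, hσ⟩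
  -- pointwise derivative facts
  have dYx : ∀ x ∈ Ioo (0:ℝ) 1, ∀ σ ∈ Ioo 0 (θ S), HasDerivAt (fun w => Y w σ) (Yx x σ) x := by
    intro x hx σ hσ
    rw [hYx, if_pos (hmem hx hσ)]
    refine (hyx x hx _ (hρm σ hσ)).congr_of_eventuallyEq ?_
    filter_upwards [Ioo_mem_nhds hx.1 hx.2] with w hw
    rw [hY, hc1e w (Ioo_subset_Icc_self hw), hcSe _ (Ioo_subset_Icc_self (hρm σ hσ))]
  have dV : ∀ x ∈ Ioo (0:ℝ) 1, ∀ σ ∈ Ioo 0 (θ S),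
      HasDerivAt (fun w => A w * Yx w σ) (V x σ) x := by
    intro x hx σ hσ
    rw [hV, if_pos (hmem hx hσ)]
    refine (hvx x hx _ (hρm σ hσ)).congr_of_eventuallyEq ?_
    filter_upwards [Ioo_mem_nhds hx.1 hx.2] with w hw
    rw [hAe w (Ioo_subset_Icc_self hw), hYx, if_pos (hmem hw hσ)]
  have dt : ∀ x ∈ Ioo (0:ℝ) 1, ∀ σ ∈ Ioo 0 (θ S),
      HasDerivAt (fun s => Y x s) (V x σ + G x σ) σ := by
    intro x hx σ hσ
    have h1 := hyt x hx _ (hρm σ hσ)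
    rw [hρ] at h1
    have h2 := h1.comp σ (hρd σ)
    rw [← hρ] at h2
    have e : (b (ρ σ) * v x (ρ σ) + F x (ρ σ)) * (B (ρ σ))⁻¹ = V x σ + G x σ := by
      rw [hV, hG, if_pos (hmem hx hσ), if_pos (hmem hx hσ),
        hBe _ (Ioo_subset_Icc_self (hρm σ hσ))]
      have : b (ρ σ) ≠ 0 := by
        rw [← hBe _ (Ioo_subset_Icc_self (hρm σ hσ))]; exact (hBp _).ne'
      field_simp
    rw [e] at h2
    refine h2.congr_of_eventuallyEq ?_
    filter_upwards [Ioo_mem_nhds hσ.1 hσ.2] with w hw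
    rw [hY, hc1e x (Ioo_subset_Icc_self hx), hcSe _ (Ioo_subset_Icc_self (hρm w hw))]
    rfl
  -- measurability
  have mYx : Measurable fun p : ℝ × ℝ => Yx p.1 p.2 := by
    refine meas_dx hRm hYc.measurable (fun p hp => ?_) (fun p hp => ?_)
    · rw [hR] at hp; exact dYx _ hp.1 _ hp.2
    · rw [hYx, if_neg hp]
  have mV : Measurable fun p : ℝ × ℝ => V p.1 p.2 := by
    refine meas_dx (g := fun p : ℝ × ℝ => A p.1 * Yx p.1 p.2) hRm
      ((hAc.measurable.comp measurable_fst).mul mYx) (fun p hp => ?_) (fun p hp => ?_)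
    · rw [hR] at hp; exact dV _ hp.1 _ hp.2
    · rw [hV, if_neg hp]
  have mVG : Measurable fun p : ℝ × ℝ => V p.1 p.2 + G p.1 p.2 := by
    refine meas_dt hRm hYc.measurable (fun p hp => ?_) (fun p hp => ?_)
    · rw [hR] at hp; exact dt _ hp.1 _ hp.2
    · rw [hV, if_neg hp, hG, if_neg hp, add_zero]
  have mG : Measurable fun p : ℝ × ℝ => G p.1 p.2 := by
    have : (fun p : ℝ × ℝ => G p.1 p.2) = fun p : ℝ × ℝ => (V p.1 p.2 + G p.1 p.2) - V p.1 p.2 := by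
      ext p; ring
    rw [this]; exact mVG.sub mV
  have hmemθ : ∀ p : ℝ × ℝ, p ∈ Ioo (0:ℝ) 1 ×ˢ Ioo 0 S → (p.1, θ p.2) ∈ R := fun p hp => by
    refine hmem hp.1 ⟨?_, θ.lt_iff_lt.2 hp.2.2⟩
    rw [← hθ0]; exact θ.lt_iff_lt.2 hp.2.1
  have hsR : MeasurableSet (Ioo (0:ℝ) 1 ×ˢ Ioo 0 S) := measurableSet_Ioo.prod measurableSet_Ioo
  have wL : MemLp (fun p : ℝ × ℝ => Real.sqrt (A p.1) * Yx p.1 p.2) 2 volume := by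
    have mw : Measurable (fun p : ℝ × ℝ => Real.sqrt (A p.1) * Yx p.1 p.2) :=
      ((Real.continuous_sqrt.comp hAc).measurable.comp measurable_fst).mul mYx
    rw [memLp_two_iff_integrable_sq mw.aestronglyMeasurable]
    have hi : IntegrableOn (fun p : ℝ × ℝ => (Real.sqrt (A p.1) * Yx p.1 p.2) ^ 2) R := by
      rw [hR, (cov hBp θ hθ0 hθd _ S).2]
      have h1 : IntegrableOn (fun p : ℝ × ℝ => B p.2 * (a p.1 * yx p.1 p.2 ^ 2))
          (Ioo 0 1 ×ˢ Ioo 0 S) := Integrable.bdd_mul hw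
            (hBc.comp continuous_snd).aestronglyMeasurable (Filter.Eventually.of_forall fun p => hBM _)
      refine h1.congr_fun (fun p hp => ?_) hsR
      simp only
      rw [hYx, if_pos (hmemθ p hp), hρθ, mul_pow, Real.sq_sqrt (hA0 _),
        hAe _ (Ioo_subset_Icc_self hp.1)]
    refine (integrableOn_iff_integrable_of_support_subset ?_).1 hi
    intro p hp
    by_contra hcon
    refine hp ?_
    simp only
    rw [hYx, if_neg hcon]; simp
  have FL : MemLp (fun p : ℝ × ℝ => G p.1 p.2) 2 volume := by
    rw [memLp_two_iff_integrable_sq mG.aestronglyMeasurable]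
    have hH' : IntegrableOn (fun p : ℝ × ℝ => m⁻¹ ^ 2 * H (p.1, ρ p.2)) R := by
      refine Integrable.const_mul ?_ _
      rw [← IntegrableOn, hR, (cov hBp θ hθ0 hθd _ S).2]
      simp only [hρθ]
      exact Integrable.bdd_mul hH
            (hBc.comp continuous_snd).aestronglyMeasurable (Filter.Eventually.of_forall fun p => hBM _)
    have hi : IntegrableOn (fun p : ℝ × ℝ => G p.1 p.2 ^ 2) R := by
      refine Integrable.mono' hH' (mG.pow_const 2).aestronglyMeasurable ?_
      refine (ae_restrict_iff' hRm).2 (Filter.Eventually.of_forall fun p hp => ?_)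
      rw [Real.norm_of_nonneg (sq_nonneg _), hG, if_pos hp, mul_pow]
      rw [hR] at hp
      have h1 := hFH (p.1, ρ p.2) ⟨hp.1, hρm _ hp.2⟩
      have h2 : (B (ρ p.2))⁻¹ ≤ m⁻¹ := inv_anti₀ hm (hBm _)
      have h3 := (inv_pos.2 (hBp (ρ p.2))).le
      simp only at h1
      gcongr
    refine (integrableOn_iff_integrable_of_support_subset ?_).1 hi
    intro p hp
    by_contra hcon
    refine hp ?_
    simp only
    rw [hG, if_neg hcon]; simp
  have hdat : Dat A a' (θ S) Y Yx V G :=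
    { ac := hAc
      a0 := hA0
      ad := fun x hx => (ha_deriv x (Ioo_subset_Ioc_self hx)).congr_of_eventuallyEq (by
        filter_upwards [Ioo_mem_nhds hx.1 hx.2] with w hw using hAe w (Ioo_subset_Icc_self hw))
      a'c := ha'_cont.mono Ioo_subset_Ioc_self
      yc := hYc
      hyx := dYx
      hvx := dV
      hyt := dt
      Fm := mG
      FL := FL
      yxm := mYx
      wL := wL
      y0 := fun σ => by rw [hY, hc1e 0 (by simp)]; exact hy0 _ (hcSm _)
      y1 := fun σ => by rw [hY, hc1e 1 (by simp)]; exact hy1 _ (hcSm _) }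
  have key := energy_zero hdat (s2 := θ t) (by rw [← hθ0]; exact θ.le_iff_le.2 ht.1)
    (θ.lt_iff_lt.2 ht.2)
  rw [(cov hBp θ hθ0 hθd _ t).1, (cov hBp θ hθ0 hθd _ t).1] at key
  have e1 : ∀ s ∈ Icc 0 S, ∫ x in Ioo (0:ℝ) 1, Y x (θ s) ^ 2 / 2 = ∫ x in Ioo (0:ℝ) 1, y x s ^ 2 / 2 :=
    fun s hs => setIntegral_congr_fun measurableSet_Ioo fun x hx => by
      rw [hYe x (Ioo_subset_Icc_self hx) s hs]
  have e10 := e1 0 ⟨le_rfl, hS.le⟩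
  rw [hθ0] at e10
  rw [e1 t (Ico_subset_Icc_self ht), e10] at key
  have hsub : ∀ p ∈ Ioo (0:ℝ) 1 ×ˢ Ioo 0 t, p ∈ Ioo (0:ℝ) 1 ×ˢ Ioo 0 S := fun p hp =>
    ⟨hp.1, hp.2.1, hp.2.2.trans ht.2⟩
  have hst : MeasurableSet (Ioo (0:ℝ) 1 ×ˢ Ioo 0 t) := measurableSet_Ioo.prod measurableSet_Ioo
  have e2 : ∫ p in Ioo (0:ℝ) 1 ×ˢ Ioo 0 t, B p.2 * (A p.1 * Yx p.1 (θ p.2) ^ 2) =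
      ∫ p in Ioo (0:ℝ) 1 ×ˢ Ioo 0 t, b p.2 * (a p.1 * yx p.1 p.2 ^ 2) := by
    refine setIntegral_congr_fun hst fun p hp => ?_
    have hp' := hsub p hp
    rw [hYx, if_pos (hmemθ p hp'), hρθ, hAe _ (Ioo_subset_Icc_self hp'.1),
      hBe _ (Ioo_subset_Icc_self hp'.2)]
  have e3 : ∫ p in Ioo (0:ℝ) 1 ×ˢ Ioo 0 t, B p.2 * (Y p.1 (θ p.2) * G p.1 (θ p.2)) =
      ∫ p in Ioo (0:ℝ) 1 ×ˢ Ioo 0 t, y p.1 p.2 * F p.1 p.2 := by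
    refine setIntegral_congr_fun hst fun p hp => ?_
    have hp' := hsub p hp
    have := (hBp p.2).ne'
    rw [hG, if_pos (hmemθ p hp'), hρθ, hYe _ (Ioo_subset_Icc_self hp'.1) _ (Ioo_subset_Icc_self hp'.2)]
    field_simp
  simp only at key
  rw [e2, e3] at key
  exact key

/-- The pointwise bound of the source term paired with the solution. -/
lemma core_pointwise {m Λ c₁ c₂ c₃ r0 r1 r2 rh rh' f G c d q z : ℝ} (hm : 0 < m) (hΛ : 0 < Λ)
    (h0 : 0 < r0) (h1 : 0 < r1) (hW1 : rh ^ 2 = r0 * r1)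
    (hW2 : rh ^ 2 ≤ c₁ * r0 ^ 2) (hW3 : r1 ≤ c₂ * r2) (hW4 : |rh * rh'| ≤ c₃ * r0 ^ 2)
    (hc : |c| ≤ Λ) (hd : |d| ≤ Λ) :
    rh * z * (rh * (f + G + d * q - c * z) + rh' * z) ≤
      (1 + c₁ * (Λ ^ 2 / (2 * m)) + Λ * c₁ + c₃) * (r0 ^ 2 * z ^ 2) + 1 / 2 * (r1 ^ 2 * f ^ 2) +
      c₂ ^ 2 / 2 * (r2 ^ 2 * G ^ 2) + m / 2 * (rh ^ 2 * q ^ 2) := by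
  have e : rh * z * (rh * (f + G + d * q - c * z) + rh' * z) =
      rh ^ 2 * z * f + rh ^ 2 * z * G + rh ^ 2 * (d * (q * z)) - rh ^ 2 * (c * z ^ 2) +
        rh * rh' * z ^ 2 := by ring
  have b1 : rh ^ 2 * z * f ≤ 1 / 2 * (r0 ^ 2 * z ^ 2) + 1 / 2 * (r1 ^ 2 * f ^ 2) := by
    rw [hW1]; nlinarith [sq_nonneg (r0 * z - r1 * f)]
  have b2 : rh ^ 2 * z * G ≤ 1 / 2 * (r0 ^ 2 * z ^ 2) + c₂ ^ 2 / 2 * (r2 ^ 2 * G ^ 2) := by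
    have h3 : r1 ^ 2 ≤ (c₂ * r2) ^ 2 := pow_le_pow_left₀ h1.le hW3 2
    have h4 := mul_le_mul_of_nonneg_right h3 (sq_nonneg G)
    rw [hW1]; nlinarith [sq_nonneg (r0 * z - r1 * G)]
  have b3 : rh ^ 2 * (d * (q * z)) ≤
      m / 2 * (rh ^ 2 * q ^ 2) + c₁ * (Λ ^ 2 / (2 * m)) * (r0 ^ 2 * z ^ 2) := by
    have h5 : d * (q * z) ≤ m / 2 * q ^ 2 + Λ ^ 2 / (2 * m) * z ^ 2 := by
      have h6 : d ^ 2 ≤ Λ ^ 2 := sq_le_sq' (abs_le.1 hd).1 (abs_le.1 hd).2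
      have h7 : m / 2 * q ^ 2 + d ^ 2 / (2 * m) * z ^ 2 - d * (q * z) =
          (m * q - d * z) ^ 2 / (2 * m) := by field_simp; ring
      have h8 : 0 ≤ (m * q - d * z) ^ 2 / (2 * m) := by positivity
      have h9 : d ^ 2 / (2 * m) * z ^ 2 ≤ Λ ^ 2 / (2 * m) * z ^ 2 := by gcongr
      linarith
    have h10 := mul_le_mul_of_nonneg_left h5 (sq_nonneg rh)
    have h11 : 0 ≤ Λ ^ 2 / (2 * m) * z ^ 2 := by positivity
    have h12 := mul_le_mul_of_nonneg_right hW2 h11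
    nlinarith
  have b4 : -(rh ^ 2 * (c * z ^ 2)) ≤ Λ * c₁ * (r0 ^ 2 * z ^ 2) := by
    have h5 : -(c * z ^ 2) ≤ Λ * z ^ 2 := by
      nlinarith [mul_le_mul_of_nonneg_right (neg_le.1 (abs_le.1 hc).1) (sq_nonneg z)]
    have h10 := mul_le_mul_of_nonneg_left h5 (sq_nonneg rh)
    have h11 : 0 ≤ Λ * z ^ 2 := by positivity
    have h12 := mul_le_mul_of_nonneg_right hW2 h11
    nlinarith
  have b5 : rh * rh' * z ^ 2 ≤ c₃ * (r0 ^ 2 * z ^ 2) := by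
    have := mul_le_mul_of_nonneg_right ((le_abs_self _).trans hW4) (sq_nonneg z)
    linarith
  rw [e]; linarith

/-- The pointwise square bound of the source term. -/
lemma core_sq {Λ c₂ c₃ L r0 r1 r2 rh rh' f G c d q z : ℝ}
    (h0 : 0 < r0) (h1 : 0 < r1) (hh : 0 < rh) (hW1 : rh ^ 2 = r0 * r1)
    (hW3 : r1 ≤ c₂ * r2) (hW4 : |rh * rh'| ≤ c₃ * r0 ^ 2) (hL : r0 ≤ L * r1)
    (hc : |c| ≤ Λ) (hd : |d| ≤ Λ) :
    (rh * (f + G + d * q - c * z) + rh' * z) ^ 2 ≤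
      5 * (L * (r1 ^ 2 * f ^ 2) + L * c₂ ^ 2 * (r2 ^ 2 * G ^ 2) + Λ ^ 2 * (rh ^ 2 * q ^ 2) +
        (Λ ^ 2 + c₃ ^ 2 * L) * (r0 ^ 2 * z ^ 2) + Λ ^ 2 * (rh ^ 2 * z ^ 2)) := by
  have hLp : 0 < L := by
    by_contra hcon
    nlinarith
  have e : (rh * (f + G + d * q - c * z) + rh' * z) ^ 2 ≤
      5 * (rh ^ 2 * f ^ 2 + rh ^ 2 * G ^ 2 + d ^ 2 * (rh ^ 2 * q ^ 2) + c ^ 2 * (rh ^ 2 * z ^ 2)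
        + rh' ^ 2 * z ^ 2) := by
    have key : ∀ A B C D E : ℝ, (A + B + C - D + E) ^ 2 ≤
        5 * (A ^ 2 + B ^ 2 + C ^ 2 + D ^ 2 + E ^ 2) := fun A B C D E => by
      nlinarith [sq_nonneg (A - B), sq_nonneg (A - C), sq_nonneg (A + D), sq_nonneg (A - E),
        sq_nonneg (B - C), sq_nonneg (B + D), sq_nonneg (B - E), sq_nonneg (C + D),
        sq_nonneg (C - E), sq_nonneg (D + E)]
    have := key (rh * f) (rh * G) (rh * (d * q)) (rh * (c * z)) (rh' * z)
    calc _ = (rh * f + rh * G + rh * (d * q) - rh * (c * z) + rh' * z) ^ 2 := by ring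
      _ ≤ _ := this
      _ = _ := by ring
  have hd2 : d ^ 2 ≤ Λ ^ 2 := sq_le_sq' (abs_le.1 hd).1 (abs_le.1 hd).2
  have hc2 : c ^ 2 ≤ Λ ^ 2 := sq_le_sq' (abs_le.1 hc).1 (abs_le.1 hc).2
  have h2 : rh ^ 2 ≤ L * r1 ^ 2 := by rw [hW1]; nlinarith
  have h3 : r1 ^ 2 ≤ (c₂ * r2) ^ 2 := pow_le_pow_left₀ h1.le hW3 2
  have h4 : rh ^ 2 ≤ L * c₂ ^ 2 * r2 ^ 2 := by
    have := mul_le_mul_of_nonneg_left h3 hLp.le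
    nlinarith
  have h5 : r0 ^ 2 ≤ L * rh ^ 2 := by rw [hW1]; nlinarith
  have h6 : rh' ^ 2 ≤ c₃ ^ 2 * L * r0 ^ 2 := by
    have h7 : (rh * rh') ^ 2 ≤ (c₃ * r0 ^ 2) ^ 2 := sq_le_sq.2 (hW4.trans (le_abs_self _))
    have h8 : (c₃ * r0 ^ 2) ^ 2 ≤ rh ^ 2 * (c₃ ^ 2 * L * r0 ^ 2) := by
      have : 0 ≤ c₃ ^ 2 * r0 ^ 2 := by positivity
      nlinarith [mul_le_mul_of_nonneg_left h5 this]
    have h9 : 0 < rh ^ 2 := by positivity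
    by_contra hcon
    push Not at hcon
    nlinarith [mul_lt_mul_of_pos_left hcon h9]
  have g1 := mul_le_mul_of_nonneg_right h2 (sq_nonneg f)
  have g2 := mul_le_mul_of_nonneg_right h4 (sq_nonneg G)
  have g3 := mul_le_mul_of_nonneg_right hd2 (by positivity : 0 ≤ rh ^ 2 * q ^ 2)
  have g4 := mul_le_mul_of_nonneg_right hc2 (by positivity : 0 ≤ rh ^ 2 * z ^ 2)
  have g5 := mul_le_mul_of_nonneg_right h6 (sq_nonneg z)
  have g6 : 0 ≤ Λ ^ 2 * (r0 ^ 2 * z ^ 2) := by positivity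
  linarith

/-- Upper bound of an integral by a nonnegative integrable majorant, no measurability needed. -/
lemma integral_le_of_le_nonneg {X : Type*} [MeasurableSpace X] {μ : Measure X} {f g : X → ℝ}
    (hg : Integrable g μ) (h0 : 0 ≤ᵐ[μ] g) (hfg : f ≤ᵐ[μ] g) : ∫ x, f x ∂μ ≤ ∫ x, g x ∂μ := by
  by_cases hf : Integrable f μ
  · exact integral_mono_ae hf hg hfg
  · rw [integral_undef hf]; exact integral_nonneg_of_ae h0

set_option maxHeartbeats 2000000 in
/-- The weighted energy estimate up to a time `t < T`, for abstract weights. -/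
lemma core_step {T : ℝ} {a a' : ℝ → ℝ} (ha_cont : ContinuousOn a (Icc 0 1))
    (ha_nonneg : ∀ x ∈ Icc (0:ℝ) 1, 0 ≤ a x)
    (ha_deriv : ∀ x ∈ Ioc (0:ℝ) 1, HasDerivAt a (a' x) x)
    (ha'_cont : ContinuousOn a' (Ioc 0 1)) {m M Λ c₁ c₂ c₃ : ℝ} (hm : 0 < m) (hΛ : 0 < Λ)
    (hc₁ : 0 ≤ c₁) (hc₃ : 0 ≤ c₃)
    {r0 r1 r2 rh rh' : ℝ → ℝ} (p0 : ∀ t, t ∈ Ico 0 T → 0 < r0 t) (p1 : ∀ t, t ∈ Ico 0 T → 0 < r1 t)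
    (ph : ∀ t, t ∈ Ico 0 T → 0 < rh t)
    (hrd : ∀ t, t ∈ Ico 0 T → HasDerivAt rh (rh' t) t)
    (hW1 : ∀ t, t ∈ Ico 0 T → rh t ^ 2 = r0 t * r1 t)
    (hW2 : ∀ t, t ∈ Ico 0 T → rh t ^ 2 ≤ c₁ * r0 t ^ 2)
    (hW3 : ∀ t, t ∈ Ico 0 T → r1 t ≤ c₂ * r2 t)
    (hW4 : ∀ t, t ∈ Ico 0 T → |rh t * rh' t| ≤ c₃ * r0 t ^ 2)
    (hW5 : ∀ S, S < T → ∃ L, ∀ t, t ∈ Icc 0 S → r0 t ≤ L * r1 t)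
    {b : ℝ → ℝ} {c d z zx zt azxx f G : ℝ → ℝ → ℝ}
    (hbc : ContinuousOn b (Icc 0 T)) (hbm : ∀ t ∈ Icc (0:ℝ) T, m ≤ b t ∧ b t ≤ M)
    (hcd : ∀ x t, |c x t| ≤ Λ ∧ |d x t| ≤ Λ)
    (hzc : ContinuousOn (fun p : ℝ × ℝ => z p.1 p.2) (Icc 0 1 ×ˢ Icc 0 T))
    (hzx : ∀ x ∈ Ioo (0:ℝ) 1, ∀ t ∈ Ico (0:ℝ) T, HasDerivAt (fun w => z w t) (zx x t) x)
    (hazx : ∀ x ∈ Ioo (0:ℝ) 1, ∀ t ∈ Ioo (0:ℝ) T,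
          HasDerivAt (fun w => a w * zx w t) (azxx x t) x)
    (hzt : ∀ x ∈ Ioo (0:ℝ) 1, ∀ t ∈ Ioo (0:ℝ) T, HasDerivAt (fun u => z x u) (zt x t) t)
    (hpde : ∀ x ∈ Ioo (0:ℝ) 1, ∀ t ∈ Ioo (0:ℝ) T,
          zt x t - b t * azxx x t - d x t * Real.sqrt (a x) * zx x t + c x t * z x t
            = f x t + G x t)
    (hbd : ∀ t ∈ Icc (0:ℝ) T, z 0 t = 0 ∧ z 1 t = 0)
    (iw : IntegrableOn (fun p : ℝ × ℝ => rh p.2 ^ 2 * a p.1 * zx p.1 p.2 ^ 2) (Ioo 0 1 ×ˢ Ioo 0 T))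
    (iz : IntegrableOn (fun p : ℝ × ℝ => r0 p.2 ^ 2 * z p.1 p.2 ^ 2) (Ioo 0 1 ×ˢ Ioo 0 T))
    (if' : IntegrableOn (fun p : ℝ × ℝ => r1 p.2 ^ 2 * f p.1 p.2 ^ 2) (Ioo 0 1 ×ˢ Ioo 0 T))
    (iG : IntegrableOn (fun p : ℝ × ℝ => r2 p.2 ^ 2 * G p.1 p.2 ^ 2) (Ioo 0 1 ×ˢ Ioo 0 T))
    {t : ℝ} (ht : t ∈ Ico 0 T) :
    rh t ^ 2 / 2 * (∫ x in Ioo (0:ℝ) 1, z x t ^ 2) +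
      m / 2 * (∫ p in Ioo (0:ℝ) 1 ×ˢ Ioo (0:ℝ) t, rh p.2 ^ 2 * a p.1 * zx p.1 p.2 ^ 2) ≤
    rh 0 ^ 2 / 2 * (∫ x in Ioo (0:ℝ) 1, z x 0 ^ 2) +
      ((1 + c₁ * (Λ ^ 2 / (2 * m)) + Λ * c₁ + c₃) *
          (∫ p in Ioo (0:ℝ) 1 ×ˢ Ioo (0:ℝ) T, r0 p.2 ^ 2 * z p.1 p.2 ^ 2) +
        1 / 2 * (∫ p in Ioo (0:ℝ) 1 ×ˢ Ioo (0:ℝ) T, r1 p.2 ^ 2 * f p.1 p.2 ^ 2) +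
        c₂ ^ 2 / 2 * (∫ p in Ioo (0:ℝ) 1 ×ˢ Ioo (0:ℝ) T, r2 p.2 ^ 2 * G p.1 p.2 ^ 2)) := by
  obtain ⟨S, htS, hST⟩ := exists_between ht.2
  have hS : 0 < S := ht.1.trans_lt htS
  obtain ⟨L, hL⟩ := hW5 S hST
  have hSI : ∀ u, u ∈ Icc 0 S → u ∈ Ico 0 T := fun u hu => ⟨hu.1, hu.2.trans_lt hST⟩
  have hSo : ∀ u, u ∈ Ioo 0 S → u ∈ Ioo 0 T := fun u hu => ⟨hu.1, hu.2.trans hST⟩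
  have hrc : ContinuousOn rh (Icc 0 S) := fun u hu =>
    (hrd u (hSI u hu)).continuousAt.continuousWithinAt
  have sST : Ioo (0:ℝ) 1 ×ˢ Ioo 0 S ⊆ Ioo (0:ℝ) 1 ×ˢ Ioo 0 T := fun p hp => ⟨hp.1, hSo _ hp.2⟩
  have stT : Ioo (0:ℝ) 1 ×ˢ Ioo 0 t ⊆ Ioo (0:ℝ) 1 ×ˢ Ioo 0 T := fun p hp =>
    ⟨hp.1, hp.2.1, hp.2.2.trans ht.2⟩
  have mS : MeasurableSet (Ioo (0:ℝ) 1 ×ˢ Ioo 0 S) := measurableSet_Ioo.prod measurableSet_Ioo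
  have mt : MeasurableSet (Ioo (0:ℝ) 1 ×ˢ Ioo 0 t) := measurableSet_Ioo.prod measurableSet_Ioo
  have mT : MeasurableSet (Ioo (0:ℝ) 1 ×ˢ Ioo 0 T) := measurableSet_Ioo.prod measurableSet_Ioo
  -- the integrable majorant of the squared source
  have iz2 : IntegrableOn (fun p : ℝ × ℝ => rh p.2 ^ 2 * z p.1 p.2 ^ 2) (Ioo 0 1 ×ˢ Ioo 0 S) := by
    have hcont : ContinuousOn (fun p : ℝ × ℝ => rh p.2 ^ 2 * z p.1 p.2 ^ 2)
        (Icc 0 1 ×ˢ Icc 0 S) := by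
      refine ((hrc.comp continuousOn_snd fun p hp => hp.2).pow 2).mul ((hzc.mono ?_).pow 2)
      exact fun p hp => ⟨hp.1, hp.2.1, hp.2.2.trans hST.le⟩
    exact (hcont.integrableOn_compact (isCompact_Icc.prod isCompact_Icc)).mono_set
      (prod_mono Ioo_subset_Icc_self Ioo_subset_Icc_self)
  have hHi : IntegrableOn (fun p : ℝ × ℝ => 5 * (L * (r1 p.2 ^ 2 * f p.1 p.2 ^ 2) +
      L * c₂ ^ 2 * (r2 p.2 ^ 2 * G p.1 p.2 ^ 2) +
      Λ ^ 2 * (rh p.2 ^ 2 * a p.1 * zx p.1 p.2 ^ 2) +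
        (Λ ^ 2 + c₃ ^ 2 * L) * (r0 p.2 ^ 2 * z p.1 p.2 ^ 2) +
        Λ ^ 2 * (rh p.2 ^ 2 * z p.1 p.2 ^ 2))) (Ioo 0 1 ×ˢ Ioo 0 S) :=
    Integrable.const_mul (((((if'.mono_set sST).const_mul _).add ((iG.mono_set sST).const_mul _)).add
      ((iw.mono_set sST).const_mul _)).add ((iz.mono_set sST).const_mul _) |>.add
      (iz2.const_mul _)) _
  have hq : ∀ x ∈ Ioo (0:ℝ) 1, ∀ u, rh u ^ 2 * a x * zx x u ^ 2 =
      rh u ^ 2 * (Real.sqrt (a x) * zx x u) ^ 2 := fun x hx u => by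
    rw [mul_pow, Real.sq_sqrt (ha_nonneg x (Ioo_subset_Icc_self hx))]; ring
  have key := raw_energy ha_cont ha_nonneg ha_deriv ha'_cont hS hm
    (hbc.mono (Icc_subset_Icc_right hST.le)) (fun u hu => (hbm u ⟨hu.1, hu.2.trans hST.le⟩).1)
    (y := fun x u => rh u * z x u) (yx := fun x u => rh u * zx x u) (v := fun x u => rh u * azxx x u)
    (F := fun x u => rh u * (f x u + G x u + d x u * (Real.sqrt (a x) * zx x u) - c x u * z x u) +
      rh' u * z x u) ?_ ?_ ?_ ?_ ?_ ?_ ?_ hHi ?_ ⟨ht.1, htS⟩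
  · have e1 : ∀ u, ∫ x in Ioo (0:ℝ) 1, (rh u * z x u) ^ 2 / 2 =
        rh u ^ 2 / 2 * ∫ x in Ioo (0:ℝ) 1, z x u ^ 2 := fun u => by
      rw [← integral_const_mul]; congr 1; ext x; ring
    rw [e1, e1] at key
    -- lower bound of the diffusion term
    have iwt := iw.mono_set stT
    have ibw : IntegrableOn (fun p : ℝ × ℝ => b p.2 * (rh p.2 ^ 2 * a p.1 * zx p.1 p.2 ^ 2))
        (Ioo 0 1 ×ˢ Ioo 0 t) := by
      have hbcc : ContinuousOn (fun p : ℝ × ℝ => b p.2) (Ioo 0 1 ×ˢ Ioo 0 t) :=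
        hbc.comp continuousOn_snd fun p hp => ⟨hp.2.1.le, (hp.2.2.trans ht.2).le⟩
      refine Integrable.bdd_mul (c := M) iwt (hbcc.aestronglyMeasurable mt) ?_
      refine (ae_restrict_iff' mt).2 (Filter.Eventually.of_forall fun p hp => ?_)
      have := hbm p.2 ⟨hp.2.1.le, (hp.2.2.trans ht.2).le⟩
      rw [Real.norm_of_nonneg (hm.le.trans this.1)]; exact this.2
    have low : m * (∫ p in Ioo (0:ℝ) 1 ×ˢ Ioo (0:ℝ) t, rh p.2 ^ 2 * a p.1 * zx p.1 p.2 ^ 2) ≤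
        ∫ p in Ioo (0:ℝ) 1 ×ˢ Ioo 0 t, b p.2 * (a p.1 * (rh p.2 * zx p.1 p.2) ^ 2) := by
      have e2 : ∀ p : ℝ × ℝ, b p.2 * (a p.1 * (rh p.2 * zx p.1 p.2) ^ 2) =
          b p.2 * (rh p.2 ^ 2 * a p.1 * zx p.1 p.2 ^ 2) := fun p => by ring
      simp only [e2]
      rw [← integral_const_mul]
      refine setIntegral_mono_on (iwt.const_mul _) ibw mt fun p hp => ?_
      have := hbm p.2 ⟨hp.2.1.le, (hp.2.2.trans ht.2).le⟩
      rw [hq p.1 hp.1]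
      exact mul_le_mul_of_nonneg_right this.1 (by positivity)
    -- upper bound of the source term
    have I1 : IntegrableOn (fun p : ℝ × ℝ => (1 + c₁ * (Λ ^ 2 / (2 * m)) + Λ * c₁ + c₃) *
        (r0 p.2 ^ 2 * z p.1 p.2 ^ 2)) (Ioo 0 1 ×ˢ Ioo 0 t) := (iz.mono_set stT).const_mul _
    have I2 : IntegrableOn (fun p : ℝ × ℝ => 1 / 2 * (r1 p.2 ^ 2 * f p.1 p.2 ^ 2))
        (Ioo 0 1 ×ˢ Ioo 0 t) := (if'.mono_set stT).const_mul _
    have I3 : IntegrableOn (fun p : ℝ × ℝ => c₂ ^ 2 / 2 * (r2 p.2 ^ 2 * G p.1 p.2 ^ 2))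
        (Ioo 0 1 ×ˢ Ioo 0 t) := (iG.mono_set stT).const_mul _
    have I4 : IntegrableOn (fun p : ℝ × ℝ => m / 2 * (rh p.2 ^ 2 * a p.1 * zx p.1 p.2 ^ 2))
        (Ioo 0 1 ×ˢ Ioo 0 t) := iwt.const_mul _
    have I12 : IntegrableOn (fun p : ℝ × ℝ => (1 + c₁ * (Λ ^ 2 / (2 * m)) + Λ * c₁ + c₃) *
        (r0 p.2 ^ 2 * z p.1 p.2 ^ 2) + 1 / 2 * (r1 p.2 ^ 2 * f p.1 p.2 ^ 2))
        (Ioo 0 1 ×ˢ Ioo 0 t) := I1.add I2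
    have I123 : IntegrableOn (fun p : ℝ × ℝ => (1 + c₁ * (Λ ^ 2 / (2 * m)) + Λ * c₁ + c₃) *
        (r0 p.2 ^ 2 * z p.1 p.2 ^ 2) + 1 / 2 * (r1 p.2 ^ 2 * f p.1 p.2 ^ 2) +
        c₂ ^ 2 / 2 * (r2 p.2 ^ 2 * G p.1 p.2 ^ 2))
        (Ioo 0 1 ×ˢ Ioo 0 t) := I12.add I3
    have I1234 : IntegrableOn (fun p : ℝ × ℝ => (1 + c₁ * (Λ ^ 2 / (2 * m)) + Λ * c₁ + c₃) *
        (r0 p.2 ^ 2 * z p.1 p.2 ^ 2) + 1 / 2 * (r1 p.2 ^ 2 * f p.1 p.2 ^ 2) +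
        c₂ ^ 2 / 2 * (r2 p.2 ^ 2 * G p.1 p.2 ^ 2) +
        m / 2 * (rh p.2 ^ 2 * a p.1 * zx p.1 p.2 ^ 2))
        (Ioo 0 1 ×ˢ Ioo 0 t) := I123.add I4
    have up : (∫ p in Ioo (0:ℝ) 1 ×ˢ Ioo 0 t, rh p.2 * z p.1 p.2 *
        (rh p.2 * (f p.1 p.2 + G p.1 p.2 + d p.1 p.2 * (Real.sqrt (a p.1) * zx p.1 p.2) -
          c p.1 p.2 * z p.1 p.2) + rh' p.2 * z p.1 p.2)) ≤
        ∫ p in Ioo (0:ℝ) 1 ×ˢ Ioo 0 t, ((1 + c₁ * (Λ ^ 2 / (2 * m)) + Λ * c₁ + c₃) *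
        (r0 p.2 ^ 2 * z p.1 p.2 ^ 2) + 1 / 2 * (r1 p.2 ^ 2 * f p.1 p.2 ^ 2) +
        c₂ ^ 2 / 2 * (r2 p.2 ^ 2 * G p.1 p.2 ^ 2) +
        m / 2 * (rh p.2 ^ 2 * a p.1 * zx p.1 p.2 ^ 2)) := by
      refine integral_le_of_le_nonneg I1234 ?_ ?_
      · refine (ae_restrict_iff' mt).2 (Filter.Eventually.of_forall fun p hp => ?_)
        simp only [Pi.zero_apply]
        rw [hq p.1 hp.1]
        positivity
      · refine (ae_restrict_iff' mt).2 (Filter.Eventually.of_forall fun p hp => ?_)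
        have hu : p.2 ∈ Ico 0 T := ⟨hp.2.1.le, hp.2.2.trans ht.2⟩
        simp only
        rw [hq p.1 hp.1]
        exact core_pointwise hm hΛ (p0 _ hu) (p1 _ hu) (hW1 _ hu) (hW2 _ hu) (hW3 _ hu) (hW4 _ hu)
          (hcd _ _).1 (hcd _ _).2
    rw [integral_add I123 I4, integral_add I12 I3, integral_add I1 I2, integral_const_mul,
      integral_const_mul, integral_const_mul, integral_const_mul] at up
    have q1 : (∫ p in Ioo (0:ℝ) 1 ×ˢ Ioo (0:ℝ) t, r0 p.2 ^ 2 * z p.1 p.2 ^ 2) ≤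
        ∫ p in Ioo (0:ℝ) 1 ×ˢ Ioo (0:ℝ) T, r0 p.2 ^ 2 * z p.1 p.2 ^ 2 :=
      setIntegral_mono_set iz (Filter.Eventually.of_forall fun p => by
        simp only [Pi.zero_apply]; positivity) stT.eventuallyLE
    have q2 : (∫ p in Ioo (0:ℝ) 1 ×ˢ Ioo (0:ℝ) t, r1 p.2 ^ 2 * f p.1 p.2 ^ 2) ≤
        ∫ p in Ioo (0:ℝ) 1 ×ˢ Ioo (0:ℝ) T, r1 p.2 ^ 2 * f p.1 p.2 ^ 2 :=
      setIntegral_mono_set if' (Filter.Eventually.of_forall fun p => by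
        simp only [Pi.zero_apply]; positivity) stT.eventuallyLE
    have q3 : (∫ p in Ioo (0:ℝ) 1 ×ˢ Ioo (0:ℝ) t, r2 p.2 ^ 2 * G p.1 p.2 ^ 2) ≤
        ∫ p in Ioo (0:ℝ) 1 ×ˢ Ioo (0:ℝ) T, r2 p.2 ^ 2 * G p.1 p.2 ^ 2 :=
      setIntegral_mono_set iG (Filter.Eventually.of_forall fun p => by
        simp only [Pi.zero_apply]; positivity) stT.eventuallyLE
    have q1' := mul_le_mul_of_nonneg_left q1
      (by positivity : 0 ≤ 1 + c₁ * (Λ ^ 2 / (2 * m)) + Λ * c₁ + c₃)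
    have q3' := mul_le_mul_of_nonneg_left q3 (by positivity : 0 ≤ c₂ ^ 2 / 2)
    linarith
  · refine (hrc.comp continuousOn_snd fun p hp => hp.2).mul (hzc.mono ?_)
    exact fun p hp => ⟨hp.1, hp.2.1, hp.2.2.trans hST.le⟩
  · intro x hx u hu
    exact (hzx x hx u (Ioo_subset_Ico_self (hSo u hu))).const_mul _
  · intro x hx u hu
    have := (hazx x hx u (hSo u hu)).const_mul (rh u)
    refine this.congr_of_eventuallyEq (Filter.Eventually.of_forall fun w => ?_)
    simp only; ring
  · intro x hx u hu
    have hu' := hSo u hu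
    have := (hrd u (Ioo_subset_Ico_self hu')).mul (hzt x hx u hu')
    refine this.congr_deriv ?_
    have hp := hpde x hx u hu'
    have : zt x u = b u * azxx x u + (f x u + G x u + d x u * (Real.sqrt (a x) * zx x u) -
      c x u * z x u) := by linarith
    rw [this]; ring
  · intro u hu
    rw [(hbd u ⟨hu.1, hu.2.trans hST.le⟩).1, mul_zero]
  · intro u hu
    rw [(hbd u ⟨hu.1, hu.2.trans hST.le⟩).2, mul_zero]
  · refine (iw.mono_set sST).congr_fun (fun p _ => ?_) mS
    simp only; ring
  · intro p hp
    have hu : p.2 ∈ Icc 0 S := Ioo_subset_Icc_self hp.2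
    have hu' := hSI _ hu
    rw [hq p.1 hp.1]
    exact core_sq (p0 _ hu') (p1 _ hu') (ph _ hu') (hW1 _ hu') (hW3 _ hu') (hW4 _ hu') (hL _ hu)
      (hcd _ _).1 (hcd _ _).2

/-- Passage to the final time in a space-time integral. -/
lemma lim_right {T : ℝ} (hT : 0 < T) {f : ℝ × ℝ → ℝ} (hf : IntegrableOn f (Ioo 0 1 ×ˢ Ioo 0 T))
    {B : ℝ} (hB : ∀ t, t ∈ Ico 0 T → ∫ p in Ioo (0:ℝ) 1 ×ˢ Ioo 0 t, f p ≤ B) :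
    ∫ p in Ioo (0:ℝ) 1 ×ˢ Ioo 0 T, f p ≤ B := by
  obtain ⟨u, hum, hul, hlim⟩ := exists_seq_strictMono_tendsto' hT
  have hU : ⋃ n, Ioo (0:ℝ) 1 ×ˢ Ioo 0 (u n) = Ioo (0:ℝ) 1 ×ˢ Ioo 0 T := by
    ext p
    simp only [mem_iUnion]
    constructor
    · rintro ⟨n, hp⟩
      exact ⟨hp.1, hp.2.1, hp.2.2.trans (hul n).2⟩
    · intro hp
      obtain ⟨n, hn⟩ := (hlim.eventually (lt_mem_nhds hp.2.2)).exists
      exact ⟨n, hp.1, hp.2.1, hn⟩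
  have := tendsto_setIntegral_of_monotone (μ := volume) (f := f)
    (s := fun n => Ioo (0:ℝ) 1 ×ˢ Ioo 0 (u n))
    (fun n => measurableSet_Ioo.prod measurableSet_Ioo)
    (fun i j hij => prod_mono le_rfl (Ioo_subset_Ioo_right (hum.monotone hij))) (by rw [hU]; exact hf)
  rw [hU] at this
  exact le_of_tendsto' this fun n => hB _ ⟨(hul n).1.le, (hul n).2⟩

/-- Integral form of restricting the control to a subinterval. -/
lemma control_restrict {α β T : ℝ} (h0 : 0 < α) (h1 : β < 1) {r : ℝ → ℝ} {h : ℝ → ℝ → ℝ}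
    (hi : IntegrableOn (fun p : ℝ × ℝ => r p.2 ^ 2 * h p.1 p.2 ^ 2) (Ioo α β ×ˢ Ioo 0 T)) :
    IntegrableOn (fun p : ℝ × ℝ => r p.2 ^ 2 * (if p.1 ∈ Ioo α β then h p.1 p.2 else 0) ^ 2)
      (Ioo 0 1 ×ˢ Ioo 0 T) ∧
    ∫ p in Ioo (0:ℝ) 1 ×ˢ Ioo 0 T, r p.2 ^ 2 * (if p.1 ∈ Ioo α β then h p.1 p.2 else 0) ^ 2 =
      ∫ p in Ioo α β ×ˢ Ioo 0 T, r p.2 ^ 2 * h p.1 p.2 ^ 2 := by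
  have mU : MeasurableSet (Ioo α β ×ˢ Ioo 0 T) := measurableSet_Ioo.prod measurableSet_Ioo
  have mT : MeasurableSet (Ioo (0:ℝ) 1 ×ˢ Ioo 0 T) := measurableSet_Ioo.prod measurableSet_Ioo
  have e : EqOn ((Ioo α β ×ˢ Ioo 0 T).indicator fun p : ℝ × ℝ => r p.2 ^ 2 * h p.1 p.2 ^ 2)
      (fun p : ℝ × ℝ => r p.2 ^ 2 * (if p.1 ∈ Ioo α β then h p.1 p.2 else 0) ^ 2)
      (Ioo 0 1 ×ˢ Ioo 0 T) := by
    intro p hp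
    by_cases hq : p.1 ∈ Ioo α β
    · simp only [if_pos hq]
      rw [indicator_of_mem (show p ∈ Ioo α β ×ˢ Ioo 0 T from ⟨hq, hp.2⟩)]
    · simp only [if_neg hq]
      rw [indicator_of_notMem (fun hc => hq hc.1)]; simp
  have hsub : Ioo α β ×ˢ Ioo 0 T ⊆ Ioo (0:ℝ) 1 ×ˢ Ioo 0 T :=
    prod_mono (Ioo_subset_Ioo h0.le h1.le) le_rfl
  constructor
  · exact ((integrable_indicator_iff mU).2 hi).integrableOn.congr_fun e mT
  · rw [← setIntegral_congr_fun mT e, setIntegral_indicator mU, inter_eq_right.2 hsub]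

/-- The relations between the Carleman weights. -/
lemma weights {T s K₁ K₂ τ₀ ζ₀ C₃ : ℝ} (hs : 0 < s) (hK₁ : K₁ < 0) (hK₂ : 0 < K₂)
    (hτ₀ : 0 < τ₀) (hζ₀ : 1 ≤ ζ₀) (hC₃ : 0 < C₃) {τ τ' : ℝ → ℝ}
    (hτ_deriv : ∀ t ∈ Ico (0:ℝ) T, HasDerivAt τ (τ' t) t)
    (hτ_lb : ∀ t ∈ Ico (0:ℝ) T, τ₀ ≤ τ t)
    (hτ_grow : ∀ t ∈ Ico (0:ℝ) T, |τ' t| ≤ C₃ * τ t ^ ((5:ℝ)/4)) :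
    ∃ (c₁ c₂ c₃ : ℝ) (rh' : ℝ → ℝ), 0 ≤ c₁ ∧ 0 ≤ c₃ ∧
      (∀ t, t ∈ Ico 0 T → 0 < rho0 s K₁ τ t) ∧ (∀ t, t ∈ Ico 0 T → 0 < rho1 s K₁ K₂ τ t) ∧
      (∀ t, t ∈ Ico 0 T → 0 < rhoHat s K₁ K₂ τ t) ∧
      (∀ t, t ∈ Ico 0 T → HasDerivAt (rhoHat s K₁ K₂ τ) (rh' t) t) ∧
      (∀ t, t ∈ Ico 0 T → rhoHat s K₁ K₂ τ t ^ 2 = rho0 s K₁ τ t * rho1 s K₁ K₂ τ t) ∧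
      (∀ t, t ∈ Ico 0 T → rhoHat s K₁ K₂ τ t ^ 2 ≤ c₁ * rho0 s K₁ τ t ^ 2) ∧
      (∀ t, t ∈ Ico 0 T → rho1 s K₁ K₂ τ t ≤ c₂ * rho2 s K₁ K₂ ζ₀ τ t) ∧
      (∀ t, t ∈ Ico 0 T → |rhoHat s K₁ K₂ τ t * rh' t| ≤ c₃ * rho0 s K₁ τ t ^ 2) ∧
      (∀ S, S < T → ∃ L, ∀ t, t ∈ Icc 0 S → rho0 s K₁ τ t ≤ L * rho1 s K₁ K₂ τ t) := by
  have hτp : ∀ t, t ∈ Ico 0 T → 0 < τ t := fun t ht => hτ₀.trans_le (hτ_lb t ht)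
  have hZ : ∀ t, t ∈ Ico 0 T → 0 < K₂ * τ t := fun t ht => mul_pos hK₂ (hτp t ht)
  have hZ0 : ∀ t, t ∈ Ico 0 T → K₂ * τ₀ ≤ K₂ * τ t := fun t ht =>
    mul_le_mul_of_nonneg_left (hτ_lb t ht) hK₂.le
  have hz0 : 0 < K₂ * τ₀ := mul_pos hK₂ hτ₀
  have hsq : ∀ t, t ∈ Ico 0 T → ((K₂ * τ t) ^ (-(3:ℝ)/4)) ^ 2 = (K₂ * τ t) ^ (-(3:ℝ)/2) :=
    fun t ht => by
      rw [← Real.rpow_natCast, ← Real.rpow_mul (hZ t ht).le]; norm_num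
  have p0 : ∀ t, 0 < rho0 s K₁ τ t := fun t => Real.exp_pos _
  have hder : ∀ t, t ∈ Ico 0 T → HasDerivAt (rhoHat s K₁ K₂ τ)
      (rhoHat s K₁ K₂ τ t * ((-(s * K₁) - 3 / 4 * (τ t)⁻¹) * τ' t)) t := by
    intro t ht
    have h1 := ((((hτ_deriv t ht).const_mul K₁).const_mul s).neg).exp
    have h2 := ((hτ_deriv t ht).const_mul K₂).rpow_const (p := -(3:ℝ)/4) (Or.inl (hZ t ht).ne')
    refine (h1.mul h2).congr_deriv ?_
    have e1 : (K₂ * τ t) ^ (-(3:ℝ)/4 - 1) = (K₂ * τ t) ^ (-(3:ℝ)/4) * (K₂ * τ t)⁻¹ := by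
      rw [Real.rpow_sub_one (hZ t ht).ne']; rfl
    have := (hτp t ht).ne'
    have := hK₂.ne'
    rw [e1, rhoHat]
    simp only [Pi.neg_apply]
    field_simp
    ring
  refine ⟨(K₂ * τ₀) ^ (-(3:ℝ)/2), (K₂ * τ₀) ^ (-(1:ℝ)/2),
    K₂ ^ (-(3:ℝ)/2) * τ₀ ^ (-(1:ℝ)/4) * ((-(s * K₁) + 3 / 4 * τ₀⁻¹) * C₃),
    fun t => rhoHat s K₁ K₂ τ t * ((-(s * K₁) - 3 / 4 * (τ t)⁻¹) * τ' t),
    by positivity, ?_, fun t _ => p0 t, fun t ht => ?_, fun t ht => ?_, hder, fun t ht => ?_,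
    fun t ht => ?_, fun t ht => ?_, fun t ht => ?_, fun S hS => ?_⟩
  · have : 0 < -(s * K₁) := by nlinarith
    positivity
  · exact mul_pos (Real.exp_pos _) (Real.rpow_pos_of_pos (hZ t ht) _)
  · exact mul_pos (Real.exp_pos _) (Real.rpow_pos_of_pos (hZ t ht) _)
  · rw [rhoHat, mul_pow, hsq t ht, rho0, rho1]; ring
  · rw [rhoHat, mul_pow, hsq t ht, rho0, mul_comm]
    exact mul_le_mul_of_nonneg_right
      (Real.rpow_le_rpow_of_nonpos hz0 (hZ0 t ht) (by norm_num)) (sq_nonneg _)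
  · have e1 : (K₂ * τ t) ^ (-(3:ℝ)/2) = (K₂ * τ t) ^ (-(1:ℝ)/2) * (K₂ * τ t)⁻¹ := by
      rw [← Real.rpow_neg_one (K₂ * τ t), ← Real.rpow_add (hZ t ht)]; norm_num
    have h2 : (K₂ * τ t) ^ (-(1:ℝ)/2) ≤ (K₂ * τ₀) ^ (-(1:ℝ)/2) :=
      Real.rpow_le_rpow_of_nonpos hz0 (hZ0 t ht) (by norm_num)
    have h3 : Real.exp (-(s * (K₁ * τ t))) ≤ Real.exp (-(3 * s * (K₁ * τ t) / 2)) := by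
      rw [Real.exp_le_exp]
      have : K₁ * τ t < 0 := mul_neg_of_neg_of_pos hK₁ (hτp t ht)
      nlinarith
    have h4 : (K₂ * τ t)⁻¹ ≤ (K₂ * τ t / ζ₀)⁻¹ := by
      have hζ : 0 < ζ₀ := zero_lt_one.trans_le hζ₀
      refine inv_anti₀ (div_pos (hZ t ht) hζ) (div_le_self (hZ t ht).le hζ₀)
    have h5 : 0 < (K₂ * τ t)⁻¹ := inv_pos.2 (hZ t ht)
    rw [rho1, rho2, e1]
    calc _ = (K₂ * τ t) ^ (-(1:ℝ)/2) * (Real.exp (-(s * (K₁ * τ t))) * (K₂ * τ t)⁻¹) := by ring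
      _ ≤ _ := by gcongr
  · simp only
    have e0 : rhoHat s K₁ K₂ τ t * (rhoHat s K₁ K₂ τ t *
        ((-(s * K₁) - 3 / 4 * (τ t)⁻¹) * τ' t)) =
        rhoHat s K₁ K₂ τ t ^ 2 * ((-(s * K₁) - 3 / 4 * (τ t)⁻¹) * τ' t) := by ring
    have hτ := hτp t ht
    have hi : (τ t)⁻¹ ≤ τ₀⁻¹ := inv_anti₀ hτ₀ (hτ_lb t ht)
    have hip : 0 < (τ t)⁻¹ := inv_pos.2 hτ
    have hk : 0 < -(s * K₁) := by nlinarith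
    have g1 : |-(s * K₁) - 3 / 4 * (τ t)⁻¹| ≤ -(s * K₁) + 3 / 4 * τ₀⁻¹ := by
      rw [abs_le]; constructor <;> linarith
    have e2 : (K₂ * τ t) ^ (-(3:ℝ)/2) * τ t ^ ((5:ℝ)/4) = K₂ ^ (-(3:ℝ)/2) * τ t ^ (-(1:ℝ)/4) := by
      rw [Real.mul_rpow hK₂.le hτ.le, mul_assoc, ← Real.rpow_add hτ]; norm_num
    have g2 : τ t ^ (-(1:ℝ)/4) ≤ τ₀ ^ (-(1:ℝ)/4) :=
      Real.rpow_le_rpow_of_nonpos hτ₀ (hτ_lb t ht) (by norm_num)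
    rw [e0, abs_mul, abs_mul, abs_of_nonneg (sq_nonneg _), rhoHat, mul_pow, hsq t ht, rho0]
    have hZr : 0 < (K₂ * τ t) ^ (-(3:ℝ)/2) := Real.rpow_pos_of_pos (hZ t ht) _
    calc _ ≤ Real.exp (-(s * (K₁ * τ t))) ^ 2 * (K₂ * τ t) ^ (-(3:ℝ)/2) *
          ((-(s * K₁) + 3 / 4 * τ₀⁻¹) * (C₃ * τ t ^ ((5:ℝ)/4))) := by
          gcongr
          exact hτ_grow t ht
      _ = K₂ ^ (-(3:ℝ)/2) * τ t ^ (-(1:ℝ)/4) * ((-(s * K₁) + 3 / 4 * τ₀⁻¹) * C₃) *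
          Real.exp (-(s * (K₁ * τ t))) ^ 2 := by rw [← e2]; ring
      _ ≤ _ := by gcongr
  · have hI : ∀ t, t ∈ Icc 0 S → t ∈ Ico 0 T := fun t ht => ⟨ht.1, ht.2.trans_lt hS⟩
    have hc : ContinuousOn (fun t => (K₂ * τ t) ^ ((3:ℝ)/2)) (Icc 0 S) := by
      intro t ht
      exact (((hτ_deriv t (hI t ht)).const_mul K₂).continuousAt.rpow_const
        (Or.inl (hZ t (hI t ht)).ne')).continuousWithinAt
    obtain ⟨L, hL⟩ := isCompact_Icc.exists_bound_of_continuousOn hc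
    refine ⟨L, fun t ht => ?_⟩
    have h1 := (Real.le_norm_self _).trans (hL t ht)
    have hZt := hZ t (hI t ht)
    have e1 : (K₂ * τ t) ^ ((3:ℝ)/2) * (K₂ * τ t) ^ (-(3:ℝ)/2) = 1 := by
      rw [← Real.rpow_add hZt]; norm_num
    have hZr : 0 < (K₂ * τ t) ^ (-(3:ℝ)/2) := Real.rpow_pos_of_pos hZt _
    rw [rho0, rho1]
    calc _ = Real.exp (-(s * (K₁ * τ t))) * ((K₂ * τ t) ^ ((3:ℝ)/2) * (K₂ * τ t) ^ (-(3:ℝ)/2)) := by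
          rw [e1, mul_one]
      _ ≤ Real.exp (-(s * (K₁ * τ t))) * (L * (K₂ * τ t) ^ (-(3:ℝ)/2)) := by gcongr
      _ = _ := by ring

/-- First additional weighted energy estimate for classical solutions of the linearized
degenerate parabolic system `z_t − b(t)(a z_x)_x − d₁ √a z_x + c₁ z = h̃ 1_{ω₁} + G` on
`(0,1) × (0,T)` with Dirichlet boundary conditions:
`sup_t ρ̂² ∫ z² + ∫∫ ρ̂² a z_x² ≤ C (∫∫ ρ₀² z² + ∫∫_{ω₁} ρ₁² h̃² + ∫∫ ρ₂² G² + ∫ z₀²)`,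
with `C` depending only on `T`, `m`, `M`, `Λ` and the weight constants. -/
theorem first_weighted_energy_estimate
    (T : ℝ) (hT : 0 < T)
    (a a' : ℝ → ℝ)
    (ha_cont : ContinuousOn a (Icc 0 1))
    (ha_nonneg : ∀ x ∈ Icc (0:ℝ) 1, 0 ≤ a x)
    (ha_deriv : ∀ x ∈ Ioc (0:ℝ) 1, HasDerivAt a (a' x) x)
    (ha'_cont : ContinuousOn a' (Ioc 0 1))
    (m M Λ : ℝ) (hm : 0 < m) (hmM : m ≤ M) (hΛ : 0 < Λ)
    (s K₁ K₂ τ₀ ζ₀ C₃ : ℝ) (hs : 0 < s) (hK₁ : K₁ < 0) (hK₂ : 0 < K₂)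
    (hτ₀ : 0 < τ₀) (hζ₀ : 1 ≤ ζ₀) (hC₃ : 0 < C₃)
    (τ τ' : ℝ → ℝ)
    (hτ_deriv : ∀ t ∈ Ico (0:ℝ) T, HasDerivAt τ (τ' t) t)
    (hτ_lb : ∀ t ∈ Ico (0:ℝ) T, τ₀ ≤ τ t)
    (hτ_grow : ∀ t ∈ Ico (0:ℝ) T, |τ' t| ≤ C₃ * τ t ^ ((5:ℝ)/4))
    (α₁ β₁ : ℝ) (hω : 0 < α₁ ∧ α₁ < β₁ ∧ β₁ < 1) :
    ∃ C > (0:ℝ),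
      ∀ (b : ℝ → ℝ) (c₁ d₁ z zx zt azxx h G : ℝ → ℝ → ℝ) (z₀ : ℝ → ℝ),
        ContinuousOn b (Icc 0 T) →
        (∀ t ∈ Icc (0:ℝ) T, m ≤ b t ∧ b t ≤ M) →
        (∀ x t, |c₁ x t| ≤ Λ ∧ |d₁ x t| ≤ Λ) →
        ContinuousOn (fun p : ℝ × ℝ => z p.1 p.2) (Icc 0 1 ×ˢ Icc 0 T) →
        (∀ x ∈ Ioo (0:ℝ) 1, ∀ t ∈ Ico (0:ℝ) T, HasDerivAt (fun w => z w t) (zx x t) x) →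
        (∀ x ∈ Ioo (0:ℝ) 1, ∀ t ∈ Ioo (0:ℝ) T,
          HasDerivAt (fun w => a w * zx w t) (azxx x t) x) →
        (∀ x ∈ Ioo (0:ℝ) 1, ∀ t ∈ Ioo (0:ℝ) T, HasDerivAt (fun u => z x u) (zt x t) t) →
        (∀ x ∈ Ioo (0:ℝ) 1, ∀ t ∈ Ioo (0:ℝ) T,
          zt x t - b t * azxx x t - d₁ x t * Real.sqrt (a x) * zx x t + c₁ x t * z x t
            = (if x ∈ Ioo α₁ β₁ then h x t else 0) + G x t) →
        (∀ t ∈ Icc (0:ℝ) T, z 0 t = 0 ∧ z 1 t = 0) →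
        (∀ x, z x 0 = z₀ x) →
        IntegrableOn
          (fun p : ℝ × ℝ => rhoHat s K₁ K₂ τ p.2 ^ 2 * a p.1 * zx p.1 p.2 ^ 2)
          (Ioo 0 1 ×ˢ Ioo 0 T) →
        IntegrableOn
          (fun p : ℝ × ℝ => rho0 s K₁ τ p.2 ^ 2 * z p.1 p.2 ^ 2)
          (Ioo 0 1 ×ˢ Ioo 0 T) →
        IntegrableOn
          (fun p : ℝ × ℝ => rho1 s K₁ K₂ τ p.2 ^ 2 * h p.1 p.2 ^ 2)
          (Ioo α₁ β₁ ×ˢ Ioo 0 T) →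
        IntegrableOn
          (fun p : ℝ × ℝ => rho2 s K₁ K₂ ζ₀ τ p.2 ^ 2 * G p.1 p.2 ^ 2)
          (Ioo 0 1 ×ˢ Ioo 0 T) →
        ∀ t ∈ Ico (0:ℝ) T,
          rhoHat s K₁ K₂ τ t ^ 2 * (∫ x in Ioo (0:ℝ) 1, z x t ^ 2) +
              (∫ p in Ioo (0:ℝ) 1 ×ˢ Ioo (0:ℝ) T,
                rhoHat s K₁ K₂ τ p.2 ^ 2 * a p.1 * zx p.1 p.2 ^ 2)
            ≤ C * ((∫ p in Ioo (0:ℝ) 1 ×ˢ Ioo (0:ℝ) T,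
                      rho0 s K₁ τ p.2 ^ 2 * z p.1 p.2 ^ 2) +
                   (∫ p in Ioo α₁ β₁ ×ˢ Ioo (0:ℝ) T,
                      rho1 s K₁ K₂ τ p.2 ^ 2 * h p.1 p.2 ^ 2) +
                   (∫ p in Ioo (0:ℝ) 1 ×ˢ Ioo (0:ℝ) T,
                      rho2 s K₁ K₂ ζ₀ τ p.2 ^ 2 * G p.1 p.2 ^ 2) +
                   (∫ x in Ioo (0:ℝ) 1, z₀ x ^ 2)) := by
  obtain ⟨k₁, k₂, k₃, rh', hk₁, hk₃, p0, p1, ph, hrd, hW1, hW2, hW3, hW4, hW5⟩ :=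
    weights (T := T) hs hK₁ hK₂ hτ₀ hζ₀ hC₃ hτ_deriv hτ_lb hτ_grow
  obtain ⟨K, hK⟩ : ∃ K, K = 1 + k₁ * (Λ ^ 2 / (2 * m)) + Λ * k₁ + k₃ := ⟨_, rfl⟩
  have hKp : 0 < K := by rw [hK]; positivity
  obtain ⟨C₀, hC₀⟩ : ∃ C₀, C₀ = rhoHat s K₁ K₂ τ 0 ^ 2 / 2 + K + 1 / 2 + k₂ ^ 2 / 2 := ⟨_, rfl⟩
  have hC₀p : 0 < C₀ := by rw [hC₀]; positivity
  refine ⟨(2 + 2 / m) * C₀, by positivity, ?_⟩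
  intro b c₁ d₁ z zx zt azxx h G z₀ hbc hbm hcd hzc hzx hazx hzt hpde hbd hz0 iw iz ih iG t ht
  obtain ⟨ih', eh⟩ := control_restrict hω.1 hω.2.2 ih
  have step : ∀ u, u ∈ Ico 0 T → _ := fun u hu => core_step ha_cont ha_nonneg ha_deriv ha'_cont
    hm hΛ hk₁ hk₃ p0 p1 ph hrd hW1 hW2 hW3 hW4 hW5 hbc hbm hcd hzc hzx hazx hzt
    (f := fun x t => if x ∈ Ioo α₁ β₁ then h x t else 0) hpde hbd iw iz ih' iG hu
  simp only [hz0] at step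
  rw [eh, ← hK] at step
  have n1 : 0 ≤ ∫ p in Ioo (0:ℝ) 1 ×ˢ Ioo (0:ℝ) T, rho0 s K₁ τ p.2 ^ 2 * z p.1 p.2 ^ 2 :=
    integral_nonneg fun p => by simp only [Pi.zero_apply]; positivity
  have n2 : 0 ≤ ∫ p in Ioo α₁ β₁ ×ˢ Ioo (0:ℝ) T, rho1 s K₁ K₂ τ p.2 ^ 2 * h p.1 p.2 ^ 2 :=
    integral_nonneg fun p => by simp only [Pi.zero_apply]; positivity
  have n3 : 0 ≤ ∫ p in Ioo (0:ℝ) 1 ×ˢ Ioo (0:ℝ) T, rho2 s K₁ K₂ ζ₀ τ p.2 ^ 2 * G p.1 p.2 ^ 2 :=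
    integral_nonneg fun p => by simp only [Pi.zero_apply]; positivity
  have n4 : 0 ≤ ∫ x in Ioo (0:ℝ) 1, z₀ x ^ 2 :=
    integral_nonneg fun p => by simp only [Pi.zero_apply]; positivity
  generalize (∫ p in Ioo (0:ℝ) 1 ×ˢ Ioo (0:ℝ) T, rho0 s K₁ τ p.2 ^ 2 * z p.1 p.2 ^ 2) = A1 at *
  generalize (∫ p in Ioo α₁ β₁ ×ˢ Ioo (0:ℝ) T, rho1 s K₁ K₂ τ p.2 ^ 2 * h p.1 p.2 ^ 2) = A2 at *
  generalize (∫ p in Ioo (0:ℝ) 1 ×ˢ Ioo (0:ℝ) T,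
    rho2 s K₁ K₂ ζ₀ τ p.2 ^ 2 * G p.1 p.2 ^ 2) = A3 at *
  generalize (∫ x in Ioo (0:ℝ) 1, z₀ x ^ 2) = A4 at *
  have bd : rhoHat s K₁ K₂ τ 0 ^ 2 / 2 * A4 + (K * A1 + 1 / 2 * A2 + k₂ ^ 2 / 2 * A3) ≤
      C₀ * (A1 + A2 + A3 + A4) := by
    have w1 : 0 ≤ rhoHat s K₁ K₂ τ 0 ^ 2 / 2 := by positivity
    have w2 : 0 ≤ k₂ ^ 2 / 2 := by positivity
    have g1 : K ≤ C₀ := by rw [hC₀]; linarith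
    have g2 : 1 / 2 ≤ C₀ := by rw [hC₀]; linarith
    have g3 : k₂ ^ 2 / 2 ≤ C₀ := by rw [hC₀]; linarith
    have g4 : rhoHat s K₁ K₂ τ 0 ^ 2 / 2 ≤ C₀ := by rw [hC₀]; linarith
    linarith [mul_le_mul_of_nonneg_right g1 n1, mul_le_mul_of_nonneg_right g2 n2,
      mul_le_mul_of_nonneg_right g3 n3, mul_le_mul_of_nonneg_right g4 n4]
  have pw : ∀ u, 0 ≤ ∫ p in Ioo (0:ℝ) 1 ×ˢ Ioo (0:ℝ) u,
      rhoHat s K₁ K₂ τ p.2 ^ 2 * a p.1 * zx p.1 p.2 ^ 2 := fun u =>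
    setIntegral_nonneg (measurableSet_Ioo.prod measurableSet_Ioo) fun p hp => by
      have := ha_nonneg p.1 (Ioo_subset_Icc_self hp.1)
      positivity
  have pz : ∀ u, 0 ≤ rhoHat s K₁ K₂ τ u ^ 2 / 2 * ∫ x in Ioo (0:ℝ) 1, z x u ^ 2 := fun u =>
    mul_nonneg (by positivity) (integral_nonneg fun p => by simp only [Pi.zero_apply]; positivity)
  have r1 := step t ht
  have r2 : (∫ p in Ioo (0:ℝ) 1 ×ˢ Ioo (0:ℝ) T,
      rhoHat s K₁ K₂ τ p.2 ^ 2 * a p.1 * zx p.1 p.2 ^ 2) ≤ 2 / m * (C₀ * (A1 + A2 + A3 + A4)) := by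
    refine lim_right hT iw fun u hu => ?_
    have h1 := step u hu
    have h2 : m / 2 * (∫ p in Ioo (0:ℝ) 1 ×ˢ Ioo (0:ℝ) u,
        rhoHat s K₁ K₂ τ p.2 ^ 2 * a p.1 * zx p.1 p.2 ^ 2) ≤ C₀ * (A1 + A2 + A3 + A4) := by
      linarith [pz u]
    have h3 := mul_le_mul_of_nonneg_left h2 (by positivity : 0 ≤ 2 / m)
    rw [← mul_assoc, show 2 / m * (m / 2) = 1 by field_simp, one_mul] at h3
    exact h3
  have r3 := mul_nonneg (by positivity : 0 ≤ m / 2) (pw t)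
  linarith
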